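/- arXiv:2605.19517 — 2 statements merged into one kernel-verified Lean document; each statement's English description precedes it below -/
import Mathlib

section
/- Let p be a prime with p ≡ 1 (mod 4) and n = (p−1)/2. Let H be the n×n real matrix with entries H_{j,k} = χ(j−k+1) (0 ≤ j,k ≤ n−1), let η ∈ ℝⁿ be the vector with entries η_j = χ(j), and let 𝟏 ∈ ℝⁿ be the all-ones vector. Then H is invertible with det H = L·(B − A), and the four bilinear forms of the inverse are: 𝟏ᵀH⁻¹𝟏 = L·(pB − A)/(B − A), 𝟏ᵀH⁻¹η = 1, ηᵀH⁻¹𝟏 = (B − A − 1)/(B − A), and ηᵀH⁻¹η = 1. -/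
open Complex Matrix BigOperators Finset

namespace Evil

noncomputable def ch (p : ℕ) [Fact p.Prime] (a : ZMod p) : ℂ := ((quadraticChar (ZMod p) a : ℤ) : ℂ)
noncomputable def ee (p : ℕ) [Fact p.Prime] : AddChar (ZMod p) ℂ := ZMod.stdAddChar
def uu (p : ℕ) {n : ℕ} (i : Fin n) : ZMod p := (((i : ℕ) + 1 : ℕ) : ZMod p)

section basics
variable {p m n : ℕ} [Fact p.Prime]

lemma uu_ne (hp : p = 2 * n + 1) (i : Fin n) : uu p i ≠ 0 := by
  unfold uu
  rw [Ne, ZMod.natCast_eq_zero_iff]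
  intro h
  have := Nat.le_of_dvd (by omega) h
  have := i.2
  omega

lemma half_bij (hp : p = 2 * n + 1) : Function.Bijective
    (fun o : Option (Fin n ⊕ Fin n) => (o.elim 0 (Sum.elim (uu p) (fun i => - uu p i)) : ZMod p)) := by
  rw [Fintype.bijective_iff_injective_and_card]
  refine ⟨?_, by simp [ZMod.card]; omega⟩
  have key : ∀ a b : ℕ, a < p → b < p → (a : ZMod p) = b → a = b := by
    intro a b ha hb h
    rw [ZMod.natCast_eq_natCast_iff'] at h
    rwa [Nat.mod_eq_of_lt ha, Nat.mod_eq_of_lt hb] at h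
  have key2 : ∀ i j : Fin n, uu p i ≠ - uu p j := by
    intro i j h
    unfold uu at h
    have h2 : (((i : ℕ) + 1 + ((j : ℕ) + 1) : ℕ) : ZMod p) = (0 : ℕ) := by
      push_cast at h ⊢
      rw [h]; ring
    have := key _ _ (by omega) (by omega) h2
    omega
  have key1 : ∀ i j : Fin n, uu p i = uu p j → i = j := by
    intro i j h
    have := key _ _ (by omega) (by omega) h
    ext; omega
  rintro (_ | i | i) (_ | j | j) h
  · rfl
  · simp at h; exact absurd h.symm (uu_ne hp j)
  · simp at h; exact absurd h (uu_ne hp j)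
  · simp at h; exact absurd h (uu_ne hp i)
  · simp at h; rw [key1 _ _ h]
  · simp at h; exact absurd h (key2 _ _)
  · simp at h; exact absurd h (uu_ne hp i)
  · simp at h; exact absurd h.symm (key2 _ _)
  · simp at h; rw [key1 _ _ h]

lemma prod_half {M : Type*} [CommMonoid M] (hp : p = 2 * n + 1) (f : ZMod p → M) :
    ∏ a ∈ univ.erase 0, f a = (∏ i : Fin n, f (uu p i)) * ∏ i : Fin n, f (- uu p i) := by
  have h : ∏ a ∈ univ.erase 0, f a = ∏ a, (if a = 0 then 1 else f a) := by
    rw [← Finset.mul_prod_erase univ _ (mem_univ (0 : ZMod p))]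
    simp only [if_true, one_mul]
    apply Finset.prod_congr rfl
    intro a ha
    rw [if_neg (Finset.ne_of_mem_erase ha)]
  rw [h, ← (half_bij hp).prod_comp]
  simp [Fintype.prod_option, uu_ne hp]

lemma sum_half (hp : p = 2 * n + 1) (f : ZMod p → ℂ) :
    ∑ a, f a = f 0 + ((∑ i : Fin n, f (uu p i)) + ∑ i : Fin n, f (- uu p i)) := by
  rw [← (half_bij hp).sum_comp]
  simp [Fintype.sum_option]

lemma ringChar_ne (hp : p = 2 * n + 1) : ringChar (ZMod p) ≠ 2 := by
  rw [ZMod.ringChar_zmod_n]; omega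

lemma two_ne (hp : p = 2 * n + 1) : (2 : ZMod p) ≠ 0 := by
  have := (Fact.out : p.Prime).two_le
  have h : ((2 : ℕ) : ZMod p) ≠ 0 := by
    rw [Ne, ZMod.natCast_eq_zero_iff]
    intro h
    have := Nat.le_of_dvd (by omega) h
    omega
  simpa using h

@[simp] lemma ch_zero : ch p 0 = 0 := by simp [ch]
@[simp] lemma ch_one : ch p 1 = 1 := by simp [ch]
lemma ch_mul (a b : ZMod p) : ch p (a * b) = ch p a * ch p b := by
  unfold ch; rw [map_mul]; push_cast; rfl
lemma ch_sq {a : ZMod p} (ha : a ≠ 0) : ch p a ^ 2 = 1 := by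
  unfold ch; exact_mod_cast congrArg (Int.cast : ℤ → ℂ) (quadraticChar_sq_one ha)
lemma ch_cases {a : ZMod p} (ha : a ≠ 0) : ch p a = 1 ∨ ch p a = -1 := by
  have := ch_sq ha
  have h : (ch p a - 1) * (ch p a + 1) = 0 := by linear_combination this
  rcases mul_eq_zero.mp h with h | h
  · left; linear_combination h
  · right; linear_combination h
lemma ch_neg_one (hp : p = 4 * m + 1) : ch p (-1) = 1 := by
  unfold ch
  rw [quadraticChar_neg_one (ringChar_ne (n := 2 * m) (by omega)), ZMod.card, ZMod.χ₄_nat_one_mod_four (by omega)]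
  simp
lemma ch_neg (hp : p = 4 * m + 1) (a : ZMod p) : ch p (-a) = ch p a := by
  rw [← neg_one_mul, ch_mul, ch_neg_one hp, one_mul]

lemma ee_zero : ee p 0 = 1 := AddChar.map_zero_eq_one _
lemma ee_add (a b : ZMod p) : ee p (a + b) = ee p a * ee p b := AddChar.map_add_eq_mul _ _ _
lemma ee_ne (a : ZMod p) : ee p a ≠ 0 := by
  intro h
  have := ee_add a (-a)
  rw [add_neg_cancel, ee_zero, h, zero_mul] at this
  exact one_ne_zero this
lemma ee_neg (a : ZMod p) : ee p (-a) = (ee p a)⁻¹ := by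
  apply eq_inv_of_mul_eq_one_left
  rw [← ee_add, neg_add_cancel, ee_zero]
lemma ee_inj {a b : ZMod p} (h : ee p a = ee p b) : a = b := ZMod.injective_stdAddChar h
lemma ee_nsmul (k : ℕ) (a : ZMod p) : ee p (k * a) = ee p a ^ k := by
  rw [← nsmul_eq_mul, AddChar.map_nsmul_eq_pow]

lemma ee_prim {t : ZMod p} (ht : t ≠ 0) : IsPrimitiveRoot (ee p t) p := by
  refine IsPrimitiveRoot.iff_def _ _ |>.mpr ⟨?_, ?_⟩
  · rw [← ee_nsmul]; simp
  · intro l hl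
    rw [← ee_nsmul, ← ee_zero (p := p)] at hl
    have := ee_inj hl
    rw [mul_eq_zero] at this
    exact (ZMod.natCast_eq_zero_iff _ _).mp (this.resolve_right ht)

lemma prod_erase_mul (f : ZMod p → ℂ) {t : ZMod p} (ht : t ≠ 0) :
    ∏ a ∈ univ.erase 0, f (t * a) = ∏ a ∈ univ.erase 0, f a := by
  apply Finset.prod_bij (fun a _ => t * a)
  · intro a ha; simp at ha ⊢; exact ⟨ht, ha⟩
  · intro a _ b _ h; exact mul_left_cancel₀ ht h
  · intro b hb
    refine ⟨t⁻¹ * b, ?_, ?_⟩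
    · simp at hb ⊢; exact ⟨ht, hb⟩
    · field_simp
  · intros; rfl

lemma prod_range_erase {M : Type*} [CommMonoid M] (hp : p = 2 * n + 1) (f : ZMod p → M) :
    ∏ k ∈ Finset.range (2 * n), f ((k + 1 : ℕ) : ZMod p) = ∏ a ∈ univ.erase 0, f a := by
  apply Finset.prod_bij (fun (k : ℕ) _ => ((k + 1 : ℕ) : ZMod p))
  · intro a ha
    simp only [mem_erase, mem_univ, and_true, Finset.mem_range] at ha ⊢
    rw [Ne, ZMod.natCast_eq_zero_iff]
    intro h
    have := Nat.le_of_dvd (by omega) h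
    omega
  · intro a ha b hb h
    simp only [Finset.mem_range] at ha hb
    rw [ZMod.natCast_eq_natCast_iff'] at h
    rw [Nat.mod_eq_of_lt (by omega), Nat.mod_eq_of_lt (by omega)] at h
    omega
  · intro b hb
    have hb0 : b ≠ 0 := Finset.ne_of_mem_erase hb
    have h1 : b.val ≠ 0 := by rwa [Ne, ZMod.val_eq_zero]
    have h2 := ZMod.val_lt b
    refine ⟨b.val - 1, by simp; omega, ?_⟩
    rw [Nat.sub_add_cancel (by omega), ZMod.natCast_zmod_val]
  · intro a _
    rfl

lemma prod_one_sub (hp : p = 2 * n + 1) {t : ZMod p} (ht : t ≠ 0) :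
    ∏ a ∈ univ.erase 0, (1 - ee p (t * a)) = p := by
  rw [prod_erase_mul (fun a => 1 - ee p a) ht]
  have h1 : IsPrimitiveRoot (ee p 1) (2 * n + 1) := hp ▸ ee_prim one_ne_zero
  have h2 := h1.prod_one_sub_pow_eq_order
  have : (p : ℂ) = ((2 * n : ℕ) : ℂ) + 1 := by rw [hp]; push_cast; ring
  rw [this, ← h2]
  rw [← prod_range_erase hp]
  apply Finset.prod_congr rfl
  intro a _
  rw [← ee_nsmul, mul_one]

lemma p_ne : (p : ℂ) ≠ 0 := by exact_mod_cast (Fact.out : p.Prime).ne_zero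

lemma prod_one_add (hp : p = 2 * n + 1) {t : ZMod p} (ht : t ≠ 0) :
    ∏ a ∈ univ.erase 0, (1 + ee p (t * a)) = 1 := by
  have h1 := prod_one_sub hp ht
  have h2 := prod_one_sub hp (mul_ne_zero (two_ne hp) ht)
  have h3 : ∏ a ∈ univ.erase 0, (1 - ee p (2 * t * a))
    = (∏ a ∈ univ.erase 0, (1 - ee p (t * a))) * ∏ a ∈ univ.erase 0, (1 + ee p (t * a)) := by
    rw [← Finset.prod_mul_distrib]
    apply Finset.prod_congr rfl
    intro a _
    rw [show 2 * t * a = t * a + t * a by ring, ee_add]; ring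
  rw [h1, h2] at h3
  have := p_ne (p := p)
  field_simp at h3
  exact h3.symm

end basics

section gauss
variable {p m n : ℕ} [Fact p.Prime]

lemma prod_uu_sq (hp : p = 2 * n + 1) (hn : n = 2 * m) : (∏ i : Fin n, uu p i) ^ 2 = -1 := by
  have h1 := prod_range_erase hp (fun a : ZMod p => a)
  rw [prod_half hp (fun a => a)] at h1
  have h2 : ∏ k ∈ Finset.range (2 * n), ((k + 1 : ℕ) : ZMod p) = -1 := by
    rw [← Nat.cast_prod, Finset.prod_range_add_one_eq_factorial, ← ZMod.wilsons_lemma]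
    congr 2; omega
  rw [h2, Finset.prod_neg] at h1
  simp only [Finset.card_univ, Fintype.card_fin] at h1
  rw [hn, Even.neg_one_pow ⟨m, by ring⟩, one_mul, ← pow_two] at h1
  rw [hn]; exact h1.symm

lemma prod_uu_fact : (∏ i : Fin n, uu p i) = (n.factorial : ZMod p) := by
  unfold uu
  rw [← Finset.prod_range_add_one_eq_factorial, Nat.cast_prod, Finset.prod_range]

lemma prod_qc (hp : p = 2 * n + 1) (hn : n = 2 * m) :
    quadraticChar (ZMod p) (∏ i : Fin n, uu p i) = (-1) ^ m := by
  have hF := ringChar_ne hp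
  have h := quadraticChar_eq_pow_of_char_ne_two' hF (∏ i : Fin n, uu p i)
  rw [ZMod.card, show p / 2 = 2 * m by omega, pow_mul, prod_uu_sq hp hn] at h
  have hne : (∏ i : Fin n, uu p i) ≠ 0 := Finset.prod_ne_zero_iff.mpr (fun i _ => uu_ne hp i)
  have h11 : (1 : ZMod p) ≠ -1 := fun h => two_ne hp (by linear_combination h)
  rcases quadraticChar_dichotomy hne with h1 | h1 <;> rw [h1] at h ⊢ <;>
    rcases neg_one_pow_eq_or (ZMod p) m with h2 | h2 <;>
    rcases Nat.even_or_odd m with h3 | h3 <;>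
    simp_all

lemma qc_two (hp : p = 2 * n + 1) (hn : n = 2 * m) :
    quadraticChar (ZMod p) 2 = (-1) ^ m := by
  rw [quadraticChar_two (ringChar_ne hp), ZMod.card, ZMod.χ₈_nat_eq_if_mod_eight]
  rcases Nat.even_or_odd m with h3 | h3
  · rw [h3.neg_one_pow]
    obtain ⟨k, hk⟩ := h3
    have h8 : p % 8 = 1 := by omega
    have h2 : p % 2 = 1 := by omega
    simp [h8, h2]
  · rw [h3.neg_one_pow]
    obtain ⟨k, hk⟩ := h3
    have h8 : p % 8 = 5 := by omega
    have h2 : p % 2 = 1 := by omega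
    simp [h8, h2]

noncomputable def GG (p : ℕ) [Fact p.Prime] (a : ZMod p) : ℂ := ∑ r, ch p r * ee p (a * r)
noncomputable def TT (p : ℕ) [Fact p.Prime] (n : ℕ) (a : ZMod p) : ℂ :=
  ∏ i : Fin n, (ch p (uu p i) * (ee p (a * uu p i) - ee p (-(a * uu p i))))

lemma prod_ch (hp : p = 2 * n + 1) (hn : n = 2 * m) : ∏ i : Fin n, ch p (uu p i) = (-1) ^ m := by
  unfold ch
  rw [← Int.cast_prod, ← map_prod, prod_qc hp hn]; simp

lemma ch_two (hp : p = 2 * n + 1) (hn : n = 2 * m) : ch p 2 = (-1) ^ m := by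
  unfold ch; rw [qc_two hp hn]; simp

lemma TT_sq (hp : p = 2 * n + 1) (hn : n = 2 * m) {a : ZMod p} (ha : a ≠ 0) : TT p n a ^ 2 = p := by
  have h := prod_one_sub hp (mul_ne_zero (two_ne hp) ha)
  rw [prod_half hp] at h
  rw [← h, ← Finset.prod_mul_distrib]
  unfold TT
  rw [← Finset.prod_pow]
  have : ∀ i : Fin n, (ch p (uu p i) * (ee p (a * uu p i) - ee p (-(a * uu p i)))) ^ 2
     = (-1) * ((1 - ee p (2 * a * uu p i)) * (1 - ee p (2 * a * -uu p i))) := by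
    intro i
    rw [mul_pow, ch_sq (uu_ne hp i), show 2 * a * uu p i = a * uu p i + a * uu p i by ring,
      show 2 * a * -uu p i = -(a * uu p i) + -(a * uu p i) by ring, ee_add, ee_add]
    have := ee_ne (a * uu p i)
    rw [ee_neg]
    field_simp
    ring
  rw [Finset.prod_congr rfl (fun i _ => this i), Finset.prod_mul_distrib]
  simp [hn]

lemma GG_mul (a : ZMod p) (hp : p = 2 * n + 1) (hn : n = 2 * m) : GG p a = ch p a * GG p 1 := by
  by_cases ha : a = 0
  · subst ha
    simp only [GG, zero_mul, ee_zero, mul_one, ch_zero]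
    unfold ch
    rw [← Int.cast_sum, quadraticChar_sum_zero (ringChar_ne hp)]; simp
  · unfold GG
    rw [Finset.mul_sum]
    apply Finset.sum_bij (fun r _ => a * r)
    · simp
    · intro r _ s _ h; exact mul_left_cancel₀ ha h
    · intro b _; exact ⟨a⁻¹ * b, mem_univ _, by field_simp⟩
    · intro r _
      have := ch_sq ha
      rw [ch_mul, one_mul]; linear_combination (- ch p r * ee p (a * r)) * this

lemma GG_sq (hp : p = 2 * n + 1) (hn : n = 2 * m) {a : ZMod p} (ha : a ≠ 0) : GG p a ^ 2 = p := by
  rw [GG_mul a hp hn, mul_pow, ch_sq ha, one_mul]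
  have h1 : GG p 1 = gaussSum ((quadraticChar (ZMod p)).ringHomComp (Int.castRingHom ℂ)) (ee p) := by
    simp only [GG, gaussSum, one_mul]; rfl
  have hq : ((quadraticChar (ZMod p)).ringHomComp (Int.castRingHom ℂ)).IsQuadratic :=
    (quadraticChar_isQuadratic _).comp _
  have hne : (quadraticChar (ZMod p)).ringHomComp (Int.castRingHom ℂ) ≠ 1 := by
    rw [MulChar.ringHomComp_ne_one_iff (RingHom.injective_int _)]
    exact quadraticChar_ne_one (ringChar_ne hp)
  have hprim : (ee p).IsPrimitive := ZMod.isPrimitive_stdAddChar p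
  rw [h1, gaussSum_sq hne hq hprim, ZMod.card]
  have : ((quadraticChar (ZMod p)).ringHomComp (Int.castRingHom ℂ)) (-1) = ch p (-1) := rfl
  rw [this, ch_neg_one (m := m) (by omega), one_mul]

open Polynomial in
lemma sum_eval_monic {Q : (ZMod p)[X]} (hm : Q.Monic) (hd : Q.natDegree = p - 1) :
    ∑ r : ZMod p, Q.eval r = -1 := by
  have hp2 := (Fact.out : p.Prime).two_le
  simp_rw [eval_eq_sum_range, hd]
  rw [Finset.sum_comm, Finset.sum_range_succ, Finset.sum_eq_zero, zero_add]
  · rw [← Finset.mul_sum, ← hd, hm.coeff_natDegree, one_mul, hd,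
      ← Finset.add_sum_erase univ _ (mem_univ (0 : ZMod p)), zero_pow (by omega), zero_add]
    rw [Finset.sum_congr rfl (fun r hr => ZMod.pow_card_sub_one_eq_one (Finset.ne_of_mem_erase hr))]
    simp [Finset.card_erase_of_mem, ZMod.card]
    rw [Nat.cast_sub (by omega)]; simp
  · intro k hk
    rw [← Finset.mul_sum, FiniteField.sum_pow_lt_card_sub_one, mul_zero]
    rw [ZMod.card]; simpa using hk

open Polynomial in
lemma GG_eq_TT (hp : p = 2 * n + 1) (hn : n = 2 * m) {a : ZMod p} (ha : a ≠ 0) :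
    GG p a = TT p n a := by
  have hsq : (GG p a - TT p n a) * (GG p a + TT p n a) = 0 := by
    have h1 := GG_sq hp hn ha
    have h2 := TT_sq hp hn ha
    linear_combination h1 - h2
  rcases mul_eq_zero.mp hsq with h | h
  · exact sub_eq_zero.mp h
  exfalso
  set z := ee p a with hz
  have hzp : IsPrimitiveRoot z p := ee_prim ha
  set N := ∑ i : Fin n, ((i : ℕ) + 1) with hN
  let Gp : ℤ[X] := ∑ r : ZMod p, C (quadraticChar (ZMod p) r) * X ^ r.val
  let Hp : ℤ[X] := ∏ i : Fin n, (X ^ (2 * ((i : ℕ) + 1)) - 1)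
  let Tp : ℤ[X] := C ((-1) ^ m) * X ^ ((p - 1) * N) * Hp
  have hG : aeval z Gp = GG p a := by
    simp only [Gp, map_sum, map_mul, aeval_C, map_pow, aeval_X, GG]
    apply Finset.sum_congr rfl
    intro r _
    rw [hz, ← ee_nsmul, ZMod.natCast_zmod_val, mul_comm r a]; rfl
  have hT : aeval z Tp = TT p n a := by
    simp only [Tp, Hp, map_mul, aeval_C, map_pow, aeval_X, TT, map_prod, map_sub, map_one]
    rw [Finset.prod_mul_distrib, prod_ch hp hn, mul_assoc]
    congr 1
    · simp
    rw [hN, Finset.mul_sum, ← Finset.prod_pow_eq_pow_sum, ← Finset.prod_mul_distrib]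
    apply Finset.prod_congr rfl
    intro i _
    have e1 : z ^ ((p - 1) * ((i : ℕ) + 1)) = ee p (-(a * uu p i)) := by
      rw [hz, ← ee_nsmul]
      congr 1
      unfold uu
      have : ((p - 1 : ℕ) : ZMod p) = -1 := by
        rw [Nat.cast_sub (by omega)]; simp
      push_cast at this ⊢
      rw [this]; ring
    have e2 : z ^ (2 * ((i : ℕ) + 1)) = ee p (a * uu p i) * ee p (a * uu p i) := by
      rw [hz, ← ee_nsmul, ← ee_add]
      congr 1
      unfold uu
      push_cast; ring
    rw [e1, e2, ee_neg]
    have := ee_ne (a * uu p i)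
    field_simp
  have hdvd : cyclotomic p ℤ ∣ Gp + Tp := by
    rw [cyclotomic_eq_minpoly hzp (by omega)]
    apply minpoly.isIntegrallyClosed_dvd (hzp.isIntegral (by omega))
    rw [map_add, hG, hT, h]
  have hcyc : (cyclotomic p ℤ).map (Int.castRingHom (ZMod p)) = (X - 1) ^ (p - 1) := by
    rw [map_cyclotomic]
    have := cyclotomic_mul_prime_eq_pow_of_not_dvd (ZMod p) (p := p) (n := 1)
      (by have := (Fact.out : p.Prime).one_lt; simp; omega)
    simpa using this
  have hdvd2 : (X - 1 : (ZMod p)[X]) ^ (p - 1) ∣ (Gp + Tp).map (Int.castRingHom (ZMod p)) := by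
    rw [← hcyc]; exact Polynomial.map_dvd _ hdvd
  have hdvd3 : (X : (ZMod p)[X]) ^ (p - 1) ∣
      taylorAlgHom (1 : ZMod p) ((Gp + Tp).map (Int.castRingHom (ZMod p))) := by
    have := map_dvd (taylorAlgHom (1 : ZMod p)) hdvd2
    rw [map_pow, map_sub, map_one] at this
    simpa using this
  have hp2 := (Fact.out : p.Prime).two_le
  have hcoef := (X_pow_dvd_iff.mp hdvd3) n (by omega)
  have hU := prod_uu_sq hp hn
  rw [prod_uu_fact] at hU
  have cG : (taylorAlgHom (1 : ZMod p) (Gp.map (Int.castRingHom (ZMod p)))).coeff n * (n.factorial : ZMod p) = -1 := by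
    have h1 : (taylorAlgHom (1 : ZMod p) (Gp.map (Int.castRingHom (ZMod p)))).coeff n
        = ∑ r : ZMod p, r ^ n * (r.val.choose n : ZMod p) := by
      simp only [Gp, Polynomial.map_sum, map_sum, Polynomial.map_mul, map_mul, Polynomial.map_C,
        Polynomial.map_pow, map_pow, Polynomial.map_X, finsetSum_coeff]
      apply Finset.sum_congr rfl
      intro r _
      have e1 : (taylorAlgHom (1 : ZMod p)) (X : (ZMod p)[X]) = X + C 1 := by simp
      have e2 : ∀ c, (taylorAlgHom (1 : ZMod p)) (C c : (ZMod p)[X]) = C c := by intro c; simp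
      rw [e1, e2, coeff_C_mul, coeff_X_add_C_pow, one_pow, one_mul]
      congr 1
      have := quadraticChar_eq_pow_of_char_ne_two' (ringChar_ne hp) r
      rw [ZMod.card, show p / 2 = n by omega] at this
      exact this
    rw [h1, Finset.sum_mul]
    have h2 : ∀ r : ZMod p, r ^ n * (r.val.choose n : ZMod p) * (n.factorial : ZMod p)
        = (X ^ n * descPochhammer (ZMod p) n).eval r := by
      intro r
      rw [eval_mul, eval_pow, eval_X]
      conv_rhs => rw [← ZMod.natCast_zmod_val r, descPochhammer_eval_eq_descFactorial]
      rw [Nat.descFactorial_eq_factorial_mul_choose, ZMod.natCast_zmod_val]; push_cast; ring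
    rw [Finset.sum_congr rfl (fun r _ => h2 r)]
    have hm : (X ^ n * descPochhammer (ZMod p) n).Monic :=
      (monic_X_pow n).mul (monic_descPochhammer _ _)
    have hd : (X ^ n * descPochhammer (ZMod p) n).natDegree = p - 1 := by
      rw [(monic_X_pow n).natDegree_mul (monic_descPochhammer _ _), natDegree_X_pow,
        descPochhammer_natDegree]; omega
    exact sum_eval_monic hm hd
  have cT : (taylorAlgHom (1 : ZMod p) (Tp.map (Int.castRingHom (ZMod p)))).coeff n = (n.factorial : ZMod p) := by
    have e1 : (taylorAlgHom (1 : ZMod p)) (X : (ZMod p)[X]) = X + 1 := by simp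
    have e2 : ∀ c, (taylorAlgHom (1 : ZMod p)) (C c : (ZMod p)[X]) = C c := by intro c; simp
    have h1 : taylorAlgHom (1 : ZMod p) (Tp.map (Int.castRingHom (ZMod p)))
      = C ((-1) ^ m) * (X + 1) ^ ((p - 1) * N) * ∏ i : Fin n, ((X + 1) ^ (2 * ((i : ℕ) + 1)) - 1) := by
      simp only [Tp, Hp, Polynomial.map_prod, map_prod, Polynomial.map_mul, map_mul, Polynomial.map_C,
        Polynomial.map_pow, map_pow, Polynomial.map_X, Polynomial.map_sub, map_sub, Polynomial.map_one,
        map_one, e1]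
      congr 2
      simp
    have h2 : ∀ k : ℕ, ((X + 1) ^ k - 1 : (ZMod p)[X]) = X * divX ((X + 1) ^ k - 1) := by
      intro k
      conv_lhs => rw [← divX_mul_X_add ((X + 1) ^ k - 1 : (ZMod p)[X])]
      rw [coeff_zero_eq_eval_zero]; simp [mul_comm]
    rw [h1, Finset.prod_congr rfl (fun i _ => h2 _), Finset.prod_mul_distrib]
    simp only [Finset.prod_const, Finset.card_univ, Fintype.card_fin]
    rw [mul_left_comm, coeff_X_pow_mul', if_pos le_rfl, Nat.sub_self, coeff_zero_eq_eval_zero]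
    simp only [eval_mul, eval_C, eval_pow, eval_add, eval_X, eval_one, zero_add, one_pow, mul_one,
      eval_prod]
    have h3 : ∀ k : ℕ, (divX ((X + 1) ^ k - 1 : (ZMod p)[X])).eval 0 = k := by
      intro k
      rw [← coeff_zero_eq_eval_zero, coeff_divX, coeff_sub, coeff_X_add_one_pow]
      simp [coeff_one]
    rw [Finset.prod_congr rfl (fun i _ => h3 _)]
    push_cast
    rw [Finset.prod_mul_distrib]
    have h4 : ∏ i : Fin n, (((i : ℕ) : ZMod p) + 1) = (n.factorial : ZMod p) := by
      rw [← prod_uu_fact]; unfold uu; push_cast; rfl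
    have h5 : ((-1) ^ m : ZMod p) = 2 ^ n := by
      have := quadraticChar_eq_pow_of_char_ne_two' (ringChar_ne hp) (2 : ZMod p)
      rw [ZMod.card, show p / 2 = n by omega, qc_two hp hn] at this
      rw [← this]; simp
    have h6 : ((-1) ^ m : ZMod p) * (-1) ^ m = 1 := by rw [← mul_pow]; simp
    rw [h4, Finset.prod_const, Finset.card_univ, Fintype.card_fin, ← h5, ← mul_assoc, h6, one_mul]
  rw [Polynomial.map_add, map_add, coeff_add, cT] at hcoef
  have : (2 : ZMod p) = 0 := by linear_combination (-(n.factorial : ZMod p)) * hcoef + cG + hU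
  exact two_ne hp this

end gauss

section consts
variable {p m n : ℕ} [Fact p.Prime]

lemma uu_inj (hp : p = 2 * n + 1) {i j : Fin n} (h : uu p i = uu p j) : i = j := by
  have := (half_bij hp).1 (a₁ := some (Sum.inl i)) (a₂ := some (Sum.inl j)) (by simpa using h)
  simpa using this

lemma uu_add_ne (hp : p = 2 * n + 1) (i j : Fin n) : uu p i + uu p j ≠ 0 := by
  intro h
  have h' : uu p i = - uu p j := by linear_combination h
  have := (half_bij hp).1 (a₁ := some (Sum.inl i)) (a₂ := some (Sum.inr j)) (by simpa using h')
  simp at this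

lemma ee_uu (i : Fin n) : ee p (uu p i) = Complex.exp (((2 * Real.pi * ((i : ℕ) + 1) / p : ℝ) : ℂ) * I) := by
  have := ZMod.stdAddChar_coe (N := p) (((i : ℕ) + 1 : ℕ) : ℤ)
  unfold ee uu
  rw [Int.cast_natCast] at this
  rw [this]
  congr 1
  push_cast
  ring

lemma ee_sub (i : Fin n) : ee p (uu p i) - ee p (- uu p i) =
    2 * I * ((Real.sin (2 * Real.pi * ((i : ℕ) + 1) / p) : ℝ) : ℂ) := by
  rw [ee_neg, ee_uu, ← Complex.exp_neg, Complex.ofReal_sin, Complex.sin, neg_mul]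
  linear_combination (-(Complex.exp (-(((2 * Real.pi * ((i : ℕ) + 1) / p : ℝ) : ℂ) * I))
    - Complex.exp (((2 * Real.pi * ((i : ℕ) + 1) / p : ℝ) : ℂ) * I))) * Complex.I_sq

lemma ee_add_neg (i : Fin n) : ee p (uu p i) + ee p (- uu p i) =
    ((2 * Real.cos (2 * Real.pi * ((i : ℕ) + 1) / p) : ℝ) : ℂ) := by
  rw [ee_neg, ee_uu, ← Complex.exp_neg, Complex.ofReal_mul, Complex.ofReal_cos, Complex.cos]
  push_cast
  ring

lemma TT_one (hp : p = 2 * n + 1) (hn : n = 2 * m) : TT p n 1 = ((Real.sqrt p : ℝ) : ℂ) := by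
  have hsq := TT_sq hp hn (a := 1) one_ne_zero
  have h1 : TT p n 1 = ((∏ i : Fin n, (2 * Real.sin (2 * Real.pi * ((i : ℕ) + 1) / p)) : ℝ) : ℂ) := by
    unfold TT
    simp only [one_mul]
    rw [Finset.prod_mul_distrib, prod_ch hp hn]
    simp_rw [ee_sub]
    push_cast
    simp_rw [mul_assoc]
    rw [Finset.prod_mul_distrib, Finset.prod_mul_distrib (f := fun _ => I), Finset.prod_mul_distrib]
    simp only [Finset.prod_const, Finset.card_univ, Fintype.card_fin]
    have hI : I ^ n = (-1) ^ m := by rw [hn, pow_mul I, I_sq]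
    rw [hI]
    have : ((-1 : ℂ) ^ m) * (-1) ^ m = 1 := by rw [← mul_pow]; simp
    have key : ∀ Q : ℂ, (-1) ^ m * (2 ^ n * ((-1) ^ m * Q)) = 2 ^ n * Q := fun Q => by
      linear_combination 2 ^ n * Q * this
    exact key _
  have hpos : 0 ≤ ∏ i : Fin n, (2 * Real.sin (2 * Real.pi * ((i : ℕ) + 1) / p)) := by
    apply Finset.prod_nonneg
    intro i _
    have hppos : (0 : ℝ) < p := by exact_mod_cast (Fact.out : p.Prime).pos
    have : 0 ≤ Real.sin (2 * Real.pi * ((i : ℕ) + 1) / p) := by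
      apply Real.sin_nonneg_of_nonneg_of_le_pi
      · positivity
      · rw [div_le_iff₀ hppos]
        have : (2 : ℝ) * ((i : ℕ) + 1) ≤ p := by
          have := i.2
          have h : 2 * ((i : ℕ) + 1) ≤ p := by omega
          exact_mod_cast h
        nlinarith [Real.pi_pos]
    linarith
  rw [h1] at hsq ⊢
  congr 1
  symm
  rw [Real.sqrt_eq_iff_mul_self_eq (by positivity) hpos]
  rw [← pow_two]
  exact_mod_cast hsq.symm

noncomputable def xx (p : ℕ) [Fact p.Prime] {n : ℕ} (i : Fin n) : ℂ := ch p (uu p i) * ee p (- uu p i)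
noncomputable def sp (p : ℕ) : ℂ := ((Real.sqrt p : ℝ) : ℂ)

lemma sp_sq : sp p ^ 2 = p := by
  unfold sp
  rw [← Complex.ofReal_pow, Real.sq_sqrt (by positivity)]; simp
lemma sp_ne : sp p ≠ 0 := by
  intro h
  have := sp_sq (p := p)
  rw [h] at this
  exact p_ne (p := p) (by rw [← this]; simp)

lemma GG_sp (hp : p = 2 * n + 1) (hn : n = 2 * m) (a : ZMod p) : GG p a = ch p a * sp p := by
  rw [GG_mul a hp hn, GG_eq_TT hp hn one_ne_zero, TT_one hp hn, sp]

lemma ch_ne {a : ZMod p} (ha : a ≠ 0) : ch p a ≠ 0 := by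
  intro h; have := ch_sq ha; rw [h] at this; simp at this

lemma xx_ne (hp : p = 2 * n + 1) (i : Fin n) : xx p i ≠ 0 :=
  mul_ne_zero (ch_ne (uu_ne hp i)) (ee_ne _)

lemma xx_inv (hp : p = 2 * n + 1) (i : Fin n) : (xx p i)⁻¹ = ch p (uu p i) * ee p (uu p i) := by
  rw [inv_eq_iff_eq_inv]
  apply eq_inv_of_mul_eq_one_left
  unfold xx
  rw [ee_neg]
  have := ee_ne (uu p i)
  have := ch_sq (uu_ne hp i)
  field_simp
  exact this

lemma xx_sq (hp : p = 2 * n + 1) (i : Fin n) : xx p i ^ 2 = ee p (-2 * uu p i) := by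
  unfold xx
  rw [mul_pow, ch_sq (uu_ne hp i), one_mul, pow_two, ← ee_add]; ring_nf

lemma xx_sq_inj (hp : p = 2 * n + 1) {i j : Fin n} (h : xx p i ^ 2 = xx p j ^ 2) : i = j := by
  rw [xx_sq hp, xx_sq hp] at h
  have h2 := ee_inj h
  exact uu_inj hp (mul_left_cancel₀ (neg_ne_zero.mpr (two_ne hp)) h2)

lemma one_sub_sq_ne (hp : p = 2 * n + 1) (i : Fin n) : 1 - xx p i ^ 2 ≠ 0 := by
  rw [xx_sq hp, ← ee_zero (p := p)]
  intro h
  have := ee_inj (sub_eq_zero.mp h)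
  exact mul_ne_zero (neg_ne_zero.mpr (two_ne hp)) (uu_ne hp i) this.symm

lemma one_sub_sq_sq_ne (hp : p = 2 * n + 1) (i j : Fin n) : 1 - xx p i ^ 2 * xx p j ^ 2 ≠ 0 := by
  rw [xx_sq hp, xx_sq hp, ← ee_add, ← ee_zero (p := p)]
  intro h
  have := ee_inj (sub_eq_zero.mp h)
  exact mul_ne_zero (neg_ne_zero.mpr (two_ne hp)) (uu_add_ne hp i j) (by rw [this]; ring)

lemma one_add_ne (hp : p = 2 * n + 1) (i j : Fin n) : 1 + xx p i * xx p j ≠ 0 := by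
  intro h
  exact one_sub_sq_sq_ne hp i j (by linear_combination (1 - xx p i * xx p j) * h)

lemma prod_one_sub_sq (hp : p = 2 * n + 1) (hn : n = 2 * m) :
    ∏ i : Fin n, (1 - xx p i ^ 2) = sp p * ∏ i : Fin n, xx p i := by
  rw [sp, ← TT_one hp hn, TT, ← Finset.prod_mul_distrib]
  apply Finset.prod_congr rfl
  intro i _
  rw [one_mul, mul_sub, ← xx_inv hp]
  have h : ch p (uu p i) * ee p (-uu p i) = xx p i := rfl
  rw [h]
  have := xx_ne hp i
  field_simp

lemma sum_xx (hp : p = 2 * n + 1) (hn : n = 2 * m) :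
    ∑ i : Fin n, (xx p i + (xx p i)⁻¹) = sp p := by
  have h := GG_sp hp hn (1 : ZMod p)
  rw [ch_one, one_mul] at h
  rw [← h, GG, sum_half hp, ch_zero, zero_mul, zero_add, ← Finset.sum_add_distrib]
  apply Finset.sum_congr rfl
  intro i _
  rw [xx_inv hp, one_mul, one_mul, ch_neg (m := m) (by omega), xx]; ring

/-- the even function `c` -/
noncomputable def cc (p : ℕ) [Fact p.Prime] (a : ZMod p) : ℂ := ch p a * (ee p a + ee p (-a))

lemma cc_neg (hp : p = 4 * m + 1) (a : ZMod p) : cc p (-a) = cc p a := by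
  unfold cc; rw [ch_neg hp, neg_neg]; ring

lemma cc_uu (hp : p = 2 * n + 1) (i : Fin n) : cc p (uu p i) = xx p i + (xx p i)⁻¹ := by
  rw [xx_inv hp, cc, xx]; ring

lemma prod_even {M : Type*} [CommMonoid M] (hp : p = 2 * n + 1) (f : ZMod p → M)
    (hf : ∀ a, f (-a) = f a) : ∏ a ∈ univ.erase 0, f a = (∏ i : Fin n, f (uu p i)) ^ 2 := by
  rw [prod_half hp]; simp_rw [hf]; rw [pow_two]

lemma prod_cc (hp : p = 2 * n + 1) (hn : n = 2 * m) : ∏ i : Fin n, cc p (uu p i) = 1 := by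
  have h2 : GG p 2 = ch p 2 * GG p 1 := GG_mul 2 hp hn
  rw [GG_eq_TT hp hn (two_ne hp), GG_eq_TT hp hn one_ne_zero, ch_two hp hn] at h2
  have h3 : (∏ i : Fin n, cc p (uu p i)) * TT p n 1 = (∏ i : Fin n, ch p (uu p i)) * TT p n 2 := by
    unfold TT
    rw [← Finset.prod_mul_distrib, ← Finset.prod_mul_distrib]
    apply Finset.prod_congr rfl
    intro i _
    rw [cc, one_mul, show 2 * uu p i = uu p i + uu p i by ring, neg_add, ee_add, ee_add]
    ring
  rw [h2, prod_ch hp hn] at h3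
  have : ((-1 : ℂ) ^ m) * (-1) ^ m = 1 := by rw [← mul_pow]; simp
  rw [← mul_assoc, this] at h3
  refine mul_right_cancel₀ ?_ h3
  rw [TT_one hp hn]; exact sp_ne

lemma psi_one (hp : p = 2 * n + 1) (t : ZMod p) :
    ∏ a ∈ univ.erase 0, (1 + 1 * ee p (t * a)) = if t = 0 then 2 ^ (2 * n) else 1 := by
  simp only [one_mul]
  split_ifs with h
  · subst h
    simp only [zero_mul, ee_zero, Finset.prod_const]
    rw [Finset.card_erase_of_mem (mem_univ _), Finset.card_univ, ZMod.card, hp]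
    norm_num
  · exact prod_one_add hp h

lemma prod_cc_k (hp : p = 2 * n + 1) (hn : n = 2 * m) {k : ZMod p} (hk : k ≠ 0) :
    ∏ a ∈ univ.erase 0, (cc p a + cc p (a * k)) =
    (∏ a ∈ univ.erase 0, (1 + ch p k * ee p ((k + 1) * a))) *
    (∏ a ∈ univ.erase 0, (1 + ch p k * ee p ((k - 1) * a))) := by
  have h4 : p = 4 * m + 1 := by omega
  have h1 : ∀ a : ZMod p, cc p a + cc p (a * k) = (ch p a * ch p k) * ee p (-(a * k)) *
      ((1 + ch p k * ee p ((k + 1) * a)) * (1 + ch p k * ee p ((k - 1) * a))) := by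
    intro a
    unfold cc
    rw [ch_mul, show (k + 1) * a = a * k + a by ring, show (k - 1) * a = a * k + -a by ring,
      ee_add, ee_add, ee_neg, ee_neg]
    have e1 := ee_ne a
    have e2 := ee_ne (a * k)
    have := ch_sq hk
    field_simp
    linear_combination (-ch p a * ee p a * ch p k * ee p (a*k)^2 - ch p a * ee p a ^2 * ee p (a*k) - ch p a * ee p (a*k)) * this
  rw [Finset.prod_congr rfl (fun a _ => h1 a), Finset.prod_mul_distrib,
    Finset.prod_mul_distrib (f := fun a => ch p a * ch p k)]
  have h2 : ∏ a ∈ univ.erase 0, (ch p a * ch p k) = 1 := by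
    rw [prod_even hp _ (fun a => by rw [ch_neg h4]), ← Finset.prod_pow]
    apply Finset.prod_eq_one
    intro i _
    rw [mul_pow, ch_sq hk, ch_sq (uu_ne hp i), one_mul]
  have h3 : ∏ a ∈ univ.erase 0, ee p (-(a * k)) = 1 := by
    rw [prod_half hp, ← Finset.prod_mul_distrib]
    apply Finset.prod_eq_one
    intro i _
    rw [← ee_add, ← ee_zero (p := p)]; ring_nf
  rw [h2, h3, one_mul, one_mul, Finset.prod_mul_distrib]

lemma card_nonres (hp : p = 2 * n + 1) :
    ((univ.erase (0 : ZMod p)).filter (fun k => ch p k = -1)).card = n := by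
  have h0 : ∑ k : ZMod p, ch p k = 0 := by
    unfold ch
    rw [← Int.cast_sum, quadraticChar_sum_zero (ringChar_ne hp)]; simp
  rw [← Finset.add_sum_erase univ _ (mem_univ (0 : ZMod p)), ch_zero, zero_add] at h0
  have h1 : ∑ k ∈ univ.erase (0 : ZMod p), (1 - ch p k) =
      ∑ k ∈ univ.erase (0 : ZMod p), 2 * (if ch p k = -1 then (1 : ℂ) else 0) := by
    apply Finset.sum_congr rfl
    intro k hk
    rcases ch_cases (Finset.ne_of_mem_erase hk) with h | h <;> rw [h] <;> norm_num
  rw [Finset.sum_sub_distrib, h0, ← Finset.mul_sum, Finset.sum_boole] at h1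
  simp only [Finset.sum_const, Finset.card_erase_of_mem (mem_univ _), Finset.card_univ, ZMod.card] at h1
  rw [show p - 1 = 2 * n by omega] at h1
  simp only [nsmul_eq_mul, mul_one, sub_zero] at h1
  have h2 : 2 * n = 2 * ((univ.erase (0 : ZMod p)).filter (fun k => ch p k = -1)).card := by
    exact_mod_cast h1
  omega

lemma Q_four (hp : p = 2 * n + 1) (hn : n = 2 * m) :
    (∏ i : Fin n, ∏ j : Fin n, (cc p (uu p i) + cc p (uu p j))) ^ 4 = ((p : ℂ) ^ m * 2 ^ n) ^ 4 := by
  have h4 : p = 4 * m + 1 := by omega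
  have h1 : ∏ a ∈ univ.erase 0, ∏ b ∈ univ.erase 0, (cc p a + cc p b) =
      (∏ i : Fin n, ∏ j : Fin n, (cc p (uu p i) + cc p (uu p j))) ^ 4 := by
    rw [prod_even hp _ (fun a => by simp_rw [cc_neg h4])]
    have : ∀ i : Fin n, ∏ b ∈ univ.erase 0, (cc p (uu p i) + cc p b) =
      (∏ j : Fin n, (cc p (uu p i) + cc p (uu p j))) ^ 2 :=
      fun i => prod_even hp _ (fun a => by rw [cc_neg h4])
    simp_rw [this]
    rw [Finset.prod_pow, ← pow_mul]
  rw [← h1]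
  have h2 : ∏ a ∈ univ.erase 0, ∏ b ∈ univ.erase 0, (cc p a + cc p b) =
      ∏ a ∈ univ.erase 0, ∏ k ∈ univ.erase 0, (cc p a + cc p (a * k)) := by
    apply Finset.prod_congr rfl
    intro a ha
    exact (prod_erase_mul (fun b => cc p a + cc p b) (Finset.ne_of_mem_erase ha)).symm
  rw [h2, Finset.prod_comm]
  have h3 : ∀ k ∈ univ.erase (0 : ZMod p), ∏ a ∈ univ.erase 0, (cc p a + cc p (a * k)) =
      (if ch p k = -1 then (p : ℂ) ^ 2 else 1) *
       ((if k = -1 then 2 ^ (2 * n) else 1) * (if k = 1 then 2 ^ (2 * n) else 1)) := by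
    intro k hk
    have hk0 := Finset.ne_of_mem_erase hk
    rw [prod_cc_k hp hn hk0]
    rcases ch_cases hk0 with h | h
    · rw [h, psi_one hp, psi_one hp, if_neg (by norm_num : ¬ ((1 : ℂ) = -1)), one_mul]
      simp only [add_eq_zero_iff_eq_neg, sub_eq_zero]
    · have k1 : k ≠ 1 := by rintro rfl; rw [ch_one] at h; norm_num at h
      have k2 : k ≠ -1 := by rintro rfl; rw [ch_neg_one h4] at h; norm_num at h
      rw [h, if_pos rfl, if_neg k1, if_neg k2]
      have e1 := prod_one_sub hp (t := k + 1) (fun h => k2 (by linear_combination h))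
      have e2 := prod_one_sub hp (t := k - 1) (fun h => k1 (by linear_combination h))
      simp only [neg_one_mul, ← sub_eq_add_neg]
      rw [e1, e2]; ring
  rw [Finset.prod_congr rfl h3, Finset.prod_mul_distrib, Finset.prod_mul_distrib,
    Finset.prod_ite_eq', Finset.prod_ite_eq', Finset.prod_ite, Finset.prod_const, card_nonres hp]
  rw [if_pos (by simp), if_pos (by simp)]
  simp only [Finset.prod_const_one, mul_one]
  rw [hn]; ring

lemma Q_val (hp : p = 2 * n + 1) (hn : n = 2 * m) :
    ∏ i : Fin n, ∏ j : Fin n, (cc p (uu p i) + cc p (uu p j)) = (p : ℂ) ^ m * 2 ^ n := by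
  have h4 := Q_four hp hn
  obtain ⟨c, hc⟩ : ∃ c : Fin n → ℝ, ∀ i, cc p (uu p i) = (c i : ℂ) := by
    refine ⟨fun i => ((quadraticChar (ZMod p) (uu p i) : ℤ) : ℝ) *
      (2 * Real.cos (2 * Real.pi * ((i : ℕ) + 1) / p)), fun i => ?_⟩
    rw [cc, ee_add_neg, ch]; push_cast; rfl
  have hpc := prod_cc hp hn
  simp_rw [hc] at h4 hpc ⊢
  have h4' : (∏ i : Fin n, ∏ j : Fin n, (c i + c j)) ^ 4 = ((p : ℝ) ^ m * 2 ^ n) ^ 4 := by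
    exact_mod_cast h4
  have hpc' : ∏ i, c i = 1 := by exact_mod_cast hpc
  have hnn : 0 ≤ ∏ i : Fin n, ∏ j : Fin n, (c i + c j) := by
    have : ∀ i : Fin n, ∏ j : Fin n, (c i + c j) = 2 * c i * ∏ j ∈ {i}ᶜ, (c j + c i) := by
      intro i
      rw [← Finset.prod_mul_prod_compl {i}, Finset.prod_singleton]
      congr 1
      · ring
      · simp_rw [add_comm]
    simp_rw [this]
    rw [Finset.prod_mul_distrib, Finset.prod_mul_distrib, hpc',
      ← Finset.prod_prod_Ioi_mul_eq_prod_prod_off_diag (fun j i => c j + c i)]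
    apply mul_nonneg
    · simp
    · apply Finset.prod_nonneg; intro i _; apply Finset.prod_nonneg; intro j _
      rw [add_comm]; exact mul_self_nonneg _
  have := (pow_left_inj₀ hnn (by positivity) (by norm_num : 4 ≠ 0)).mp h4'
  exact_mod_cast congrArg (fun x : ℝ => (x : ℂ)) this

lemma Z_val (hp : p = 2 * n + 1) (hn : n = 2 * m) :
    ∏ i : Fin n, ∏ j : Fin n, ((xx p i + xx p j) * (1 + xx p i * xx p j)) =
     (p : ℂ) ^ m * 2 ^ n * (∏ i : Fin n, xx p i) ^ (2 * n) := by
  rw [← Q_val hp hn]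
  have : ∀ i j : Fin n, (xx p i + xx p j) * (1 + xx p i * xx p j) =
    (cc p (uu p i) + cc p (uu p j)) * (xx p i * xx p j) := by
    intro i j
    rw [cc_uu hp, cc_uu hp]
    have := xx_ne hp i
    have := xx_ne hp j
    field_simp
    ring
  simp_rw [this, Finset.prod_mul_distrib]
  congr 1
  simp only [Finset.prod_const, Finset.card_univ, Fintype.card_fin]
  rw [Finset.prod_pow]; ring

end consts

section generic

lemma lag {n : ℕ} (y : Fin n → ℂ) (hy : Function.Injective y) (t : ℂ) (k : Fin n) :
    t ^ (k : ℕ) = ∑ j, (∏ l ∈ {j}ᶜ, (t - y l)) / (∏ l ∈ {j}ᶜ, (y j - y l)) * y j ^ (k : ℕ) := by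
  have h := Lagrange.eq_interpolate_of_eval_eq (s := univ) (v := y) (f := (Polynomial.X : Polynomial ℂ) ^ (k : ℕ))
    (fun i => y i ^ (k : ℕ)) (hy.injOn) (by
      rw [Polynomial.degree_X_pow]; simp) (by simp)
  have h2 := congrArg (Polynomial.eval t) h
  rw [Lagrange.interpolate_apply, Polynomial.eval_finsetSum] at h2
  rw [Polynomial.eval_pow, Polynomial.eval_X] at h2
  rw [h2]
  apply Finset.sum_congr rfl
  intro j _
  rw [Polynomial.eval_mul, Polynomial.eval_C, mul_comm, Lagrange.basis, Polynomial.eval_prod,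
    ← Finset.prod_div_distrib]
  congr 1
  have : (univ.erase j : Finset (Fin n)) = {j}ᶜ := by ext; simp
  rw [this]
  apply Finset.prod_congr rfl
  intro l _
  simp [Lagrange.basisDivisor, div_eq_inv_mul]

lemma poly_vand {n : ℕ} (x : Fin n → ℂ) (Q : Fin n → Polynomial ℂ) (hQ : ∀ j, (Q j).natDegree < n) :
    (Matrix.of fun i j => (Q j).eval (x i)) =
      Matrix.vandermonde x * Matrix.of (fun (s j : Fin n) => (Q j).coeff s) := by
  ext i j
  rw [Matrix.mul_apply]
  simp only [Matrix.of_apply, Matrix.vandermonde_apply]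
  rw [Polynomial.eval_eq_sum_range' (hQ j), ← Fin.sum_univ_eq_sum_range (fun s => (Q j).coeff s * x i ^ s)]
  exact Finset.sum_congr rfl (fun s _ => mul_comm _ _)

lemma cauchy_num {n : ℕ} (x : Fin n → ℂ) (hx : ∀ i, x i ≠ 0) (hinj : Function.Injective x) :
    (Matrix.of fun i j => ∏ k ∈ {j}ᶜ, (1 + x i * x k)).det = ∏ i, ∏ k ∈ {i}ᶜ, (x i - x k) := by
  let Q : Fin n → Polynomial ℂ := fun j => ∏ k ∈ {j}ᶜ, (1 + Polynomial.X * Polynomial.C (x k))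
  have hdeg : ∀ j, (Q j).natDegree < n := by
    intro j
    refine lt_of_le_of_lt (Polynomial.natDegree_prod_le _ _) ?_
    refine lt_of_le_of_lt (Finset.sum_le_sum (g := fun _ => 1) ?_) ?_
    · intro k _
      compute_degree
    · simp [Finset.card_compl]
      have := j.2; omega
  have hev : ∀ j t, (Q j).eval t = ∏ k ∈ {j}ᶜ, (1 + t * x k) := by
    intro j t
    simp [Q, Polynomial.eval_prod, mul_comm t]
  have h1 := poly_vand x Q hdeg
  simp_rw [hev] at h1
  rw [h1, Matrix.det_mul]
  have hV : (Matrix.vandermonde x).det = (Matrix.projVandermonde (fun _ => (-1 : ℂ)) x).det := by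
    rw [Matrix.det_vandermonde, Matrix.det_projVandermonde]
    apply Finset.prod_congr rfl; intro i _
    apply Finset.prod_congr rfl; intro j _
    ring
  rw [hV, ← Matrix.det_mul]
  have h2 : Matrix.projVandermonde (fun _ => (-1 : ℂ)) x * Matrix.of (fun (s j : Fin n) => (Q j).coeff s) =
      Matrix.diagonal (fun i => ∏ k ∈ {i}ᶜ, (x i - x k)) := by
    ext i j
    have hc : ∀ j : Fin n, (({j}ᶜ : Finset (Fin n))).card = n - 1 := by
      intro j; simp [Finset.card_compl]
    have : (Matrix.projVandermonde (fun _ => (-1 : ℂ)) x * Matrix.of (fun (s j : Fin n) => (Q j).coeff s)) i j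
       = x i ^ (n - 1) * (Q j).eval (-(x i)⁻¹) := by
      rw [Matrix.mul_apply, Polynomial.eval_eq_sum_range' (hdeg j),
        ← Fin.sum_univ_eq_sum_range (fun s => (Q j).coeff s * (-(x i)⁻¹) ^ s), Finset.mul_sum]
      apply Finset.sum_congr rfl
      intro s _
      rw [Matrix.projVandermonde_apply, Matrix.of_apply]
      have e : n - 1 = (s.rev : ℕ) + s := by rw [Fin.val_rev]; have := s.2; omega
      rw [e, pow_add, neg_eq_neg_one_mul (x i)⁻¹, mul_pow, inv_pow]
      have := pow_ne_zero (s : ℕ) (hx i)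
      field_simp
    rw [this, hev, ← hc j, ← Finset.prod_const, ← Finset.prod_mul_distrib]
    have h3 : ∏ k ∈ {j}ᶜ, x i * (1 + -(x i)⁻¹ * x k) = ∏ k ∈ {j}ᶜ, (x i - x k) := by
      apply Finset.prod_congr rfl; intro k _
      have := hx i
      field_simp
      ring
    rw [h3, Matrix.diagonal_apply]
    split_ifs with hij
    · rw [hij]
    · apply Finset.prod_eq_zero (i := i) (by simpa using hij)
      ring
  rw [h2, Matrix.det_diagonal]

lemma cauchy_det {n : ℕ} (x : Fin n → ℂ) (hx : ∀ i, x i ≠ 0) (hinj : Function.Injective x)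
    (hne : ∀ i j, 1 + x i * x j ≠ 0) :
    (Matrix.of fun i j => 1 / (1 + x i * x j)).det * (∏ i, ∏ k, (1 + x i * x k)) =
      ∏ i, ∏ k ∈ {i}ᶜ, (x i - x k) := by
  rw [← cauchy_num x hx hinj, mul_comm, ← Matrix.det_mul_column]
  congr 1
  ext i j
  simp only [Matrix.of_apply]
  rw [← Finset.prod_mul_prod_compl {j}, Finset.prod_singleton]
  have := hne i j
  field_simp

lemma vand_sq {m n : ℕ} (hn : n = 2 * m) (y : Fin n → ℂ) :
    (Matrix.vandermonde y).det ^ 2 = (-1) ^ m * ∏ i, ∏ k ∈ {i}ᶜ, (y i - y k) := by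
  have h0 : ∏ i, ∏ k ∈ {i}ᶜ, (y i - y k) = ∏ i : Fin n, ∏ j ∈ Ioi i, ((-1) * (y j - y i) ^ 2) := by
    rw [← Finset.prod_prod_Ioi_mul_eq_prod_prod_off_diag (fun j i => y i - y j)]
    apply Finset.prod_congr rfl; intro i _
    apply Finset.prod_congr rfl; intro j _
    ring
  have h1 : ∏ i : Fin n, ∏ j ∈ Ioi i, (-1 : ℂ) = (-1) ^ m := by
    simp only [Finset.prod_const, Fin.card_Ioi]
    rw [Finset.prod_pow_eq_pow_sum]
    rw [Fin.sum_univ_eq_sum_range (fun i => n - 1 - i), Finset.sum_range_reflect (fun i => i), Finset.sum_range_id]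
    have : n * (n - 1) / 2 = m * (2 * m - 1) := by
      rw [hn, mul_assoc]; exact Nat.mul_div_cancel_left _ (by norm_num)
    rw [this]
    rcases Nat.eq_zero_or_pos m with h | h
    · simp [h]
    · rw [mul_comm, pow_mul, Odd.neg_one_pow]
      exact ⟨m - 1, by omega⟩
  have h2 : (Matrix.vandermonde y).det ^ 2 = ∏ i : Fin n, ∏ j ∈ Ioi i, (y j - y i) ^ 2 := by
    rw [Matrix.det_vandermonde, ← Finset.prod_pow]
    simp_rw [← Finset.prod_pow]
  rw [h0, h2]
  simp_rw [Finset.prod_mul_distrib]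
  rw [h1]
  have : ((-1 : ℂ) ^ m) * (-1) ^ m = 1 := by rw [← mul_pow]; simp
  rw [← mul_assoc, this, one_mul]

lemma det_gen {k : ℕ} (H E : Matrix (Fin (k + 1)) (Fin (k + 1)) ℂ) (η w : Fin (k + 1) → ℂ)
    (h0 : ∀ j, E 0 j = H 0 j - η j) (hs : ∀ (i : Fin k) j, E i.succ j = H i.succ j - H i.castSucc j)
    (hw : E *ᵥ w = Pi.single 0 1) : H.det = E.det * (1 + η ⬝ᵥ w) := by
  have h1 : H.det = (E + Matrix.vecMulVec (Pi.single 0 1) η).det := by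
    apply Matrix.det_eq_of_forall_row_eq_smul_add_pred (fun _ => 1)
    · intro j; simp [Matrix.vecMulVec_apply, h0]
    · intro i j; simp [Matrix.vecMulVec_apply, hs]
  have h2 : E + Matrix.vecMulVec (Pi.single 0 1) η = E * (1 + Matrix.vecMulVec w η) := by
    rw [mul_add, mul_one, Matrix.mul_vecMulVec, hw]
  rw [h1, h2, Matrix.det_mul]
  congr 1
  rw [Matrix.vecMulVec_eq Unit, Matrix.det_one_add_replicateCol_mul_replicateRow]

lemma prod_expand {ι : Type*} (s : Finset ι) (c : ι → ℂ) :
    ∃ q : Polynomial ℂ, ∏ i ∈ s, (1 + Polynomial.C (c i) * Polynomial.X) =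
      1 + Polynomial.C (∑ i ∈ s, c i) * Polynomial.X + Polynomial.X ^ 2 * q := by
  classical
  induction s using Finset.induction_on with
  | empty => exact ⟨0, by simp⟩
  | insert a s ha ih =>
    obtain ⟨q, hq⟩ := ih
    rw [Finset.prod_insert ha, Finset.sum_insert ha, hq]
    refine ⟨q + Polynomial.C (c a) * Polynomial.C (∑ i ∈ s, c i) + Polynomial.C (c a) * Polynomial.X * q, ?_⟩
    rw [Polynomial.C_add]; ring

open Polynomial in
/-- partial fractions -/
lemma parfrac {m n : ℕ} (hn : n = 2 * m) (x d : Fin n → ℂ) (hx : ∀ i, x i ≠ 0) (hinj : Function.Injective x)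
    (hne : ∀ i j, 1 + x i * x j ≠ 0)
    (hd : ∀ i, ∑ j, d j / (1 + x i * x j) = - (∏ i, x i) ^ 2 / x i ^ 2) (a : ℂ) :
    a ^ 2 * ∑ j, d j * ∏ k ∈ {j}ᶜ, (1 + a * x k) =
     - (∏ i, x i) ^ 2 * ∏ j, (1 + a * x j) +
      (∏ i, x i) * (1 + (∑ i, (x i + (x i)⁻¹)) * a) * ∏ i, (a - x i) := by
  obtain ⟨q1, h1⟩ := prod_expand univ x
  obtain ⟨q2, h2⟩ := prod_expand univ (fun i => - (x i)⁻¹)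
  set PX := ∏ i, x i with hPX
  have hP : ∏ i, ((X : Polynomial ℂ) - C (x i)) = C PX * ∏ i, (1 + C (- (x i)⁻¹) * X) := by
    have hneg : C PX = ∏ i : Fin n, C (- x i) := by
      rw [hPX, ← map_prod, Finset.prod_neg]
      simp [hn]
    rw [hneg, ← Finset.prod_mul_distrib]
    apply Finset.prod_congr rfl; intro i _
    rw [mul_add, ← mul_assoc, ← C_mul, neg_mul_neg, mul_inv_cancel₀ (hx i), C_neg]
    simp; ring
  set S : Polynomial ℂ := ∑ j, C (d j) * ∏ k ∈ {j}ᶜ, (1 + C (x k) * X) with hS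
  set s := ∑ i, (x i + (x i)⁻¹) with hs
  -- quotient polynomial
  let G : Polynomial ℂ := C (-PX ^ 2) * q1 + C (PX ^ 2) * (q2 - C s * C (∑ i, (x i)⁻¹) + C s * X * q2) - S
  have hG : X ^ 2 * G = C (-PX ^ 2) * ∏ i, (1 + C (x i) * X) + C PX * (1 + C s * X) * ∏ i, (X - C (x i)) - X ^ 2 * S := by
    rw [hP, h1, h2]
    simp only [G, Finset.sum_neg_distrib, hs, Finset.sum_add_distrib, C_add, C_neg, C_pow]
    ring
  have hdegS : S.natDegree ≤ n - 1 := by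
    apply Polynomial.natDegree_sum_le_of_forall_le
    intro j _
    refine (Polynomial.natDegree_C_mul_le _ _).trans ((Polynomial.natDegree_prod_le _ _).trans ?_)
    refine (Finset.sum_le_sum (g := fun _ => 1) ?_).trans ?_
    · intro k _; compute_degree
    · simp [Finset.card_compl]
  have hGdeg : (X ^ 2 * G).natDegree ≤ n + 1 := by
    rw [hG]
    have e1 : (∏ i : Fin n, (1 + C (x i) * X)).natDegree ≤ n := by
      refine (Polynomial.natDegree_prod_le _ _).trans ?_
      refine (Finset.sum_le_sum (g := fun _ => 1) ?_).trans ?_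
      · intro k _; compute_degree
      · simp
    have e2 : (∏ i : Fin n, (X - C (x i))).natDegree ≤ n := by
      rw [Polynomial.natDegree_finsetProd_X_sub_C_eq_card]; simp
    rcases Nat.eq_zero_or_pos n with h | h
    · have hS0 : S = 0 := by subst h; simp [hS]
      rw [hS0, mul_zero, sub_zero]
      compute_degree
      omega
    compute_degree
    omega
  have hGz : G = 0 := by
    by_contra hG0
    have hlt : G.natDegree < n := by
      rw [Polynomial.natDegree_X_pow_mul 2 hG0] at hGdeg
      omega
    apply hG0
    apply Polynomial.eq_zero_of_degree_lt_of_eval_index_eq_zero (s := univ) (v := x) hinj.injOn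
    · rw [Finset.card_univ, Fintype.card_fin, Polynomial.degree_eq_natDegree hG0]; exact_mod_cast hlt
    · intro i _
      have h := congrArg (Polynomial.eval (x i)) hG
      have hz : ∏ j, (x i - x j) = 0 := Finset.prod_eq_zero (mem_univ i) (sub_self _)
      have hSi : S.eval (x i) = (∏ j, (1 + x i * x j)) * (- PX ^ 2 / x i ^ 2) := by
        rw [← hd i, Finset.mul_sum]
        simp only [hS, eval_finsetSum, eval_mul, eval_C, eval_prod, eval_add, eval_one, eval_X]
        apply Finset.sum_congr rfl
        intro j _
        rw [← Finset.prod_mul_prod_compl {j}, Finset.prod_singleton]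
        have := hne i j
        field_simp
        congr 1
        apply Finset.prod_congr rfl; intro k _; ring
      simp only [eval_mul, eval_sub, eval_add, eval_pow, eval_X, eval_C, eval_prod, eval_one] at h
      rw [hz, hSi] at h
      have hxi := hx i
      have e : ∏ j, (1 + x j * x i) = ∏ j, (1 + x i * x j) := by simp_rw [mul_comm]
      rw [e] at h
      have h' : x i ^ 2 * eval (x i) G = 0 := by
        rw [h]; field_simp; ring
      exact (mul_eq_zero.mp h').resolve_left (pow_ne_zero _ hxi)
  rw [hGz, mul_zero] at hG
  have h := congrArg (Polynomial.eval a) hG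
  simp only [hS, eval_finsetSum, eval_zero, eval_mul, eval_sub, eval_add, eval_pow, eval_X, eval_C, eval_prod, eval_one] at h
  simp only [mul_comm a]
  linear_combination h

end generic

section matE
variable {p m n : ℕ} [Fact p.Prime]

noncomputable def yy (p : ℕ) [Fact p.Prime] {n : ℕ} (i : Fin n) : ℂ := xx p i ^ 2
noncomputable def Pd (p : ℕ) [Fact p.Prime] {n : ℕ} (i : Fin n) : ℂ := ∏ l ∈ {i}ᶜ, (yy p i - yy p l)
noncomputable def PX (p : ℕ) [Fact p.Prime] (n : ℕ) : ℂ := ∏ i : Fin n, xx p i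
noncomputable def EE (p : ℕ) [Fact p.Prime] (n : ℕ) : Matrix (Fin n) (Fin n) ℂ :=
  Matrix.of fun j k => ch p (((((j : ℕ) + 1 : ℕ)) : ZMod p) - ((k : ℕ) : ZMod p)) -
    ch p (((j : ℕ) : ZMod p) - ((k : ℕ) : ZMod p))
noncomputable def KK (p : ℕ) [Fact p.Prime] (m n : ℕ) : ℂ := - ((-1) ^ m * sp p * PX p n ^ 2)
noncomputable def MM (p : ℕ) [Fact p.Prime] (m n : ℕ) : Matrix (Fin n) (Fin n) ℂ :=
  Matrix.of fun a b => KK p m n / (Pd p a * Pd p b * xx p b * (1 + xx p a * xx p b))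

lemma yy_inj (hp : p = 2 * n + 1) : Function.Injective (fun i : Fin n => yy p i) :=
  fun _ _ h => xx_sq_inj hp h

lemma xx_inj (hp : p = 2 * n + 1) : Function.Injective (fun i : Fin n => xx p i) :=
  fun i j h => xx_sq_inj hp (by simp only at h; rw [h])

lemma yy_ne (hp : p = 2 * n + 1) (i : Fin n) : yy p i ≠ 0 := pow_ne_zero _ (xx_ne hp i)

lemma Pd_ne (hp : p = 2 * n + 1) (i : Fin n) : Pd p i ≠ 0 := by
  rw [Pd, Finset.prod_ne_zero_iff]
  intro l hl h
  exact (by simpa using hl : ¬ l = i) ((yy_inj hp (sub_eq_zero.mp h)).symm)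

lemma PX_ne (hp : p = 2 * n + 1) : PX p n ≠ 0 := by
  rw [PX, Finset.prod_ne_zero_iff]
  exact fun i _ => xx_ne hp i

lemma neg_one_sq (m : ℕ) : ((-1 : ℂ) ^ m) * (-1) ^ m = 1 := by rw [← mul_pow]; simp

lemma yy_ee (hp : p = 2 * n + 1) (i : Fin n) : yy p i = ee p (-2 * uu p i) := xx_sq hp i

lemma ch_fourier (hp : p = 2 * n + 1) (hn : n = 2 * m) (s t : ℕ) :
    ch p ((s : ZMod p) - t) = (-1) ^ m / sp p * ∑ r : Fin n, ch p (uu p r) *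
      (yy p r ^ s * (yy p r)⁻¹ ^ t + (yy p r)⁻¹ ^ s * yy p r ^ t) := by
  have h := GG_sp hp hn (-2 * ((s : ZMod p) - t))
  have h4 : p = 4 * m + 1 := by omega
  rw [ch_mul, ch_neg h4, ch_two hp hn, GG, sum_half hp, ch_zero, zero_mul, zero_add,
    ← Finset.sum_add_distrib] at h
  have h2 : ∑ r : Fin n, ch p (uu p r) *
      (yy p r ^ s * (yy p r)⁻¹ ^ t + (yy p r)⁻¹ ^ s * yy p r ^ t) = (-1) ^ m * ch p (s - t) * sp p := by
    rw [← h]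
    apply Finset.sum_congr rfl
    intro r _
    rw [ch_neg h4, yy_ee hp, ← ee_neg, ← ee_nsmul, ← ee_nsmul, ← ee_nsmul, ← ee_nsmul, ← ee_add, ← ee_add, ← mul_add]
    congr 3 <;> ring_nf
  rw [h2]
  have := neg_one_sq m
  have := sp_ne (p := p)
  field_simp
  linear_combination (-ch p (s - t)) * neg_one_sq m

lemma prodA (hp : p = 2 * n + 1) (hn : n = 2 * m) (i : Fin n) :
    (1 - yy p i) * (yy p i * Pd p i) * ∏ j : Fin n, (1 - yy p i * yy p j) = - (p * PX p n ^ 2) := by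
  have h0 : ∏ a ∈ univ.erase 0, (1 - ee p (2 * a)) = p := prod_one_sub hp (two_ne hp)
  have h1 : ∏ a ∈ univ.erase 0, (1 - ee p (2 * a)) = ∏ b ∈ univ.erase (uu p i), (1 - ee p (2 * (b - uu p i))) := by
    symm
    apply Finset.prod_bij (fun b _ => b - uu p i)
    · intro b hb; simpa [sub_eq_zero] using hb
    · intro a _ b _ h; simpa using h
    · intro b hb; exact ⟨b + uu p i, by simpa using hb, by ring⟩
    · intro b _; rfl
  have h2 : ∏ b ∈ univ.erase (uu p i), (1 - ee p (2 * (b - uu p i))) =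
      ∏ b, (if b = uu p i then 1 else (1 - ee p (2 * (b - uu p i)))) := by
    rw [← Finset.mul_prod_erase univ _ (mem_univ (uu p i)), if_pos rfl, one_mul]
    apply Finset.prod_congr rfl
    intro b hb
    rw [if_neg (Finset.ne_of_mem_erase hb)]
  rw [h1, h2, ← Finset.mul_prod_erase univ _ (mem_univ (0 : ZMod p)), prod_half hp,
    if_neg (uu_ne hp i).symm] at h0
  have h3 : ∏ j : Fin n, (if uu p j = uu p i then 1 else (1 - ee p (2 * (uu p j - uu p i)))) =
     ∏ j ∈ {i}ᶜ, (1 - yy p i / yy p j) := by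
    rw [← Finset.prod_mul_prod_compl {i}, Finset.prod_singleton, if_pos rfl, one_mul]
    apply Finset.prod_congr rfl
    intro j hj
    rw [if_neg (fun h => (by simpa using hj : ¬ j = i) (uu_inj hp h)), yy_ee hp, yy_ee hp, div_eq_mul_inv,
      ← ee_neg, ← ee_add]
    ring_nf
  have h4 : ∏ j : Fin n, (if - uu p j = uu p i then 1 else (1 - ee p (2 * (- uu p j - uu p i)))) =
     ∏ j : Fin n, (1 - yy p i * yy p j) := by
    apply Finset.prod_congr rfl
    intro j hj
    rw [if_neg (fun h => uu_add_ne hp i j (by rw [← h]; ring)), yy_ee hp, yy_ee hp, ← ee_add]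
    ring_nf
  rw [h3, h4] at h0
  have h5 : (∏ j ∈ {i}ᶜ, (1 - yy p i / yy p j)) * PX p n ^ 2 = - (yy p i * Pd p i) := by
    rw [PX, ← Finset.prod_pow, ← Finset.prod_mul_prod_compl {i}, Finset.prod_singleton]
    have : (∏ j ∈ {i}ᶜ, (1 - yy p i / yy p j)) * ∏ j ∈ {i}ᶜ, xx p j ^ 2 = - Pd p i := by
      rw [← Finset.prod_mul_distrib, Pd]
      have e : ∏ j ∈ {i}ᶜ, ((1 - yy p i / yy p j) * xx p j ^ 2) = ∏ j ∈ {i}ᶜ, (-(yy p i - yy p j)) := by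
        apply Finset.prod_congr rfl
        intro j _
        have := yy_ne hp j
        rw [show xx p j ^ 2 = yy p j from rfl]
        field_simp
        ring
      rw [e, Finset.prod_neg]
      have : (({i}ᶜ : Finset (Fin n))).card = 2 * (m - 1) + 1 := by
        rw [Finset.card_compl, Finset.card_singleton, Fintype.card_fin]
        have := i.2; omega
      rw [this, pow_succ, pow_mul]; simp
    rw [show xx p i ^ 2 = yy p i from rfl]
    linear_combination yy p i * this
  have h6 : ee p (2 * (0 - uu p i)) = yy p i := by rw [yy_ee hp]; ring_nf
  rw [h6] at h0
  linear_combination (-PX p n ^ 2) * h0 + (1 - yy p i) * (∏ j : Fin n, (1 - yy p i * yy p j)) * h5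

lemma Pinv (hp : p = 2 * n + 1) (hn : n = 2 * m) (i : Fin n) :
    ch p (uu p i) * xx p i * (1 - yy p i) * Pd p i * ∏ j : Fin n, ((yy p i)⁻¹ - yy p j) = - (p * PX p n ^ 2) := by
  rw [← prodA hp hn i]
  have h1 : ∏ j : Fin n, (1 - yy p i * yy p j) = yy p i ^ n * ∏ j : Fin n, ((yy p i)⁻¹ - yy p j) := by
    have : yy p i ^ n = ∏ j : Fin n, yy p i := by simp
    rw [this, ← Finset.prod_mul_distrib]
    apply Finset.prod_congr rfl
    intro j _
    have := yy_ne hp i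
    field_simp
  have h2 : yy p i ^ n = ee p (uu p i) := by
    rw [yy_ee hp, ← ee_nsmul]
    congr 1
    have : ((2 * n + 1 : ℕ) : ZMod p) = 0 := by rw [← hp]; simp
    push_cast at this
    linear_combination (-uu p i) * this
  have h3 : yy p i * ee p (uu p i) = ch p (uu p i) * xx p i := by
    rw [yy_ee hp, ← ee_add, xx, ← mul_assoc, ← pow_two, ch_sq (uu_ne hp i), one_mul]; ring_nf
  rw [h1, h2]
  linear_combination (-(1 - yy p i) * Pd p i * ∏ j : Fin n, ((yy p i)⁻¹ - yy p j)) * h3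

lemma Nval (hp : p = 2 * n + 1) (hn : n = 2 * m) (a b : Fin n) :
    ch p (uu p a) * (1 - yy p a) * ((∏ l ∈ {b}ᶜ, ((yy p a)⁻¹ - yy p l)) / Pd p b) =
     - (p * PX p n ^ 2 * xx p a) / (Pd p a * Pd p b * (1 - xx p a ^ 2 * xx p b ^ 2)) := by
  have h := Pinv hp hn a
  rw [← Finset.prod_mul_prod_compl {b}, Finset.prod_singleton] at h
  have h1 := Pd_ne hp a
  have h2 := Pd_ne hp b
  have h3 := one_sub_sq_sq_ne hp a b
  have h4 := xx_ne hp a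
  have e : (yy p a)⁻¹ - yy p b = (1 - xx p a ^ 2 * xx p b ^ 2) / xx p a ^ 2 := by
    unfold yy; field_simp
  rw [e] at h
  field_simp at h ⊢
  linear_combination h

lemma Mval (hp : p = 2 * n + 1) (hn : n = 2 * m) (a b : Fin n) :
    (-1) ^ m / sp p * (ch p (uu p a) * (yy p a - 1) * ((∏ l ∈ {b}ᶜ, ((yy p a)⁻¹ - yy p l)) / Pd p b) +
     ch p (uu p b) * ((yy p b)⁻¹ - 1) * ((∏ l ∈ {a}ᶜ, ((yy p b)⁻¹ - yy p l)) / Pd p a)) = MM p m n a b := by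
  have e1 := Nval hp hn a b
  have e2 := Nval hp hn b a
  have h1 := Pd_ne hp a
  have h2 := Pd_ne hp b
  have h3 := one_sub_sq_sq_ne hp a b
  have h4 := xx_ne hp a
  have h5 := xx_ne hp b
  have h6 := one_add_ne hp a b
  have h7 := yy_ne hp b
  have h8 := sp_ne (p := p)
  have f1 : ch p (uu p a) * (yy p a - 1) * ((∏ l ∈ {b}ᶜ, ((yy p a)⁻¹ - yy p l)) / Pd p b) =
    (p * PX p n ^ 2 * xx p a) / (Pd p a * Pd p b * (1 - xx p a ^ 2 * xx p b ^ 2)) := by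
    linear_combination -e1
  have f2 : ch p (uu p b) * ((yy p b)⁻¹ - 1) * ((∏ l ∈ {a}ᶜ, ((yy p b)⁻¹ - yy p l)) / Pd p a) =
    - (p * PX p n ^ 2 * xx p b) / (Pd p b * Pd p a * (1 - xx p b ^ 2 * xx p a ^ 2)) / yy p b := by
    rw [← e2]; field_simp
  rw [f1, f2, MM, KK, Matrix.of_apply, yy, ← sp_sq]
  have h9 : 1 - xx p b ^ 2 * xx p a ^ 2 = (1 + xx p a * xx p b) * (1 - xx p a * xx p b) := by ring
  have h10 : 1 - xx p a ^ 2 * xx p b ^ 2 = (1 + xx p a * xx p b) * (1 - xx p a * xx p b) := by ring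
  have h11 : 1 - xx p a * xx p b ≠ 0 := by intro h; rw [h10, h] at h3; simp at h3
  rw [h9, h10]
  field_simp
  ring

lemma EE_eq (hp : p = 2 * n + 1) (hn : n = 2 * m) : EE p n =
    (Matrix.vandermonde (fun i : Fin n => yy p i))ᵀ * MM p m n * Matrix.vandermonde (fun i : Fin n => yy p i) := by
  ext j k
  rw [EE, Matrix.of_apply, ch_fourier hp hn, ch_fourier hp hn, Matrix.mul_apply]
  simp_rw [Matrix.mul_apply, Matrix.transpose_apply, Matrix.vandermonde_apply, ← Mval hp hn]
  have hl : ∀ (r k : Fin n), (yy p r)⁻¹ ^ (k : ℕ) = ∑ b : Fin n,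
      (∏ l ∈ {b}ᶜ, ((yy p r)⁻¹ - yy p l)) / Pd p b * yy p b ^ (k : ℕ) :=
    fun r k => lag (fun i => yy p i) (yy_inj hp) _ k
  rw [← mul_sub, ← Finset.sum_sub_distrib]
  have h1 : ∀ r : Fin n, ch p (uu p r) * (yy p r ^ ((j : ℕ) + 1) * (yy p r)⁻¹ ^ (k : ℕ) +
        (yy p r)⁻¹ ^ ((j : ℕ) + 1) * yy p r ^ (k : ℕ)) -
      ch p (uu p r) * (yy p r ^ (j : ℕ) * (yy p r)⁻¹ ^ (k : ℕ) + (yy p r)⁻¹ ^ (j : ℕ) * yy p r ^ (k : ℕ)) =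
      ∑ b : Fin n, (ch p (uu p r) * (yy p r - 1) * ((∏ l ∈ {b}ᶜ, ((yy p r)⁻¹ - yy p l)) / Pd p b) *
          (yy p r ^ (j : ℕ) * yy p b ^ (k : ℕ))) +
      ∑ a : Fin n, (ch p (uu p r) * ((yy p r)⁻¹ - 1) * ((∏ l ∈ {a}ᶜ, ((yy p r)⁻¹ - yy p l)) / Pd p a) *
          (yy p a ^ (j : ℕ) * yy p r ^ (k : ℕ))) := by
    intro r
    have e1 : ∑ b : Fin n, (ch p (uu p r) * (yy p r - 1) * ((∏ l ∈ {b}ᶜ, ((yy p r)⁻¹ - yy p l)) / Pd p b) *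
          (yy p r ^ (j : ℕ) * yy p b ^ (k : ℕ))) = ch p (uu p r) * (yy p r - 1) * yy p r ^ (j : ℕ) * (yy p r)⁻¹ ^ (k : ℕ) := by
      rw [hl r k, Finset.mul_sum]
      exact Finset.sum_congr rfl (fun b _ => by ring)
    have e2 : ∑ a : Fin n, (ch p (uu p r) * ((yy p r)⁻¹ - 1) * ((∏ l ∈ {a}ᶜ, ((yy p r)⁻¹ - yy p l)) / Pd p a) *
          (yy p a ^ (j : ℕ) * yy p r ^ (k : ℕ))) = ch p (uu p r) * ((yy p r)⁻¹ - 1) * yy p r ^ (k : ℕ) * (yy p r)⁻¹ ^ (j : ℕ) := by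
      rw [hl r j, Finset.mul_sum]
      exact Finset.sum_congr rfl (fun b _ => by ring)
    rw [e1, e2]; ring
  rw [Finset.sum_congr rfl (fun r _ => h1 r), Finset.sum_add_distrib, Finset.sum_comm, ← Finset.sum_add_distrib,
    Finset.mul_sum]
  apply Finset.sum_congr rfl
  intro b _
  rw [← Finset.sum_add_distrib, Finset.mul_sum, Finset.sum_mul]
  apply Finset.sum_congr rfl
  intro a _
  ring

lemma det_EE (hp : p = 2 * n + 1) (hn : n = 2 * m) : (EE p n).det = (-1) ^ m := by
  rw [EE_eq hp hn, Matrix.det_mul, Matrix.det_mul, Matrix.det_transpose]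
  have hM : (MM p m n).det = (∏ a : Fin n, KK p m n / Pd p a) * ((∏ b : Fin n, 1 / (Pd p b * xx p b)) *
      (Matrix.of fun i j : Fin n => 1 / (1 + xx p i * xx p j)).det) := by
    rw [← Matrix.det_mul_row, ← Matrix.det_mul_column]
    congr 1
    ext a b
    simp only [MM, Matrix.of_apply]
    have h1 := Pd_ne hp a
    have h2 := Pd_ne hp b
    have h5 := xx_ne hp b
    have h6 := one_add_ne hp a b
    field_simp
  have hV := vand_sq hn (fun i : Fin n => yy p i)
  have hC := cauchy_det (fun i : Fin n => xx p i) (xx_ne hp) (xx_inj hp) (one_add_ne hp)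
  have hZ := Z_val hp hn
  have hPd : ∏ i : Fin n, ∏ k ∈ {i}ᶜ, (yy p i - yy p k) = ∏ i : Fin n, Pd p i := rfl
  have hfac : ∏ i : Fin n, Pd p i = (∏ i : Fin n, ∏ k ∈ {i}ᶜ, (xx p i - xx p k)) *
      ∏ i : Fin n, ∏ k ∈ {i}ᶜ, (xx p i + xx p k) := by
    rw [← Finset.prod_mul_distrib]
    apply Finset.prod_congr rfl; intro i _
    rw [Pd, ← Finset.prod_mul_distrib]
    apply Finset.prod_congr rfl; intro k _
    unfold yy; ring
  have hdiag : ∏ i : Fin n, ∏ k : Fin n, (xx p i + xx p k) = 2 ^ n * PX p n *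
      ∏ i : Fin n, ∏ k ∈ {i}ᶜ, (xx p i + xx p k) := by
    have : (2 : ℂ) ^ n = ∏ i : Fin n, 2 := by simp
    rw [this, PX, ← Finset.prod_mul_distrib, ← Finset.prod_mul_distrib]
    apply Finset.prod_congr rfl; intro i _
    rw [← Finset.prod_mul_prod_compl {i}, Finset.prod_singleton]
    ring
  simp_rw [Finset.prod_mul_distrib] at hZ
  rw [hdiag] at hZ
  have hK : KK p m n ^ n = p ^ m * PX p n ^ (2 * n) := by
    rw [KK, hn, pow_mul, ← sp_sq (p := p)]
    have : (-((-1) ^ m * sp p * PX p (2 * m) ^ 2)) ^ 2 = sp p ^ 2 * PX p (2 * m) ^ 4 := by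
      linear_combination (sp p ^ 2 * PX p (2 * m) ^ 4) * neg_one_sq m
    rw [this, mul_pow]; ring
  have hD : ∏ i : Fin n, Pd p i ≠ 0 := Finset.prod_ne_zero_iff.mpr (fun i _ => Pd_ne hp i)
  rw [hPd] at hV
  rw [hM, Finset.prod_div_distrib, Finset.prod_div_distrib, Finset.prod_mul_distrib]
  simp only [Finset.prod_const, Finset.card_univ, Fintype.card_fin, one_pow]
  rw [hK]
  rw [show (∏ i : Fin n, xx p i) = PX p n from rfl] at hZ ⊢
  have hX := PX_ne hp
  have h2 : (2 : ℂ) ^ n ≠ 0 := by simp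
  have hpm : (p : ℂ) ^ m ≠ 0 := pow_ne_zero _ p_ne
  generalize (∏ i : Fin n, ∏ k : Fin n, (1 + xx p i * xx p k)) = W at *
  generalize (∏ i : Fin n, ∏ k ∈ {i}ᶜ, (xx p i - xx p k)) = D at *
  generalize (∏ i : Fin n, ∏ k ∈ {i}ᶜ, (xx p i + xx p k)) = S at *
  generalize (∏ i : Fin n, Pd p i) = Q at *
  generalize (Matrix.vandermonde fun i : Fin n => yy p i).det = v at *
  generalize (Matrix.of fun i j : Fin n => 1 / (1 + xx p i * xx p j)).det = c at *
  have hR : (p : ℂ) ^ m * 2 ^ n * PX p n ^ (2 * n) ≠ 0 := mul_ne_zero (mul_ne_zero hpm h2) (pow_ne_zero _ hX)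
  have hW : W ≠ 0 := by rintro rfl; exact hR (by rw [← hZ]; ring)
  have hS : S ≠ 0 := by rintro rfl; exact hR (by rw [← hZ]; ring)
  have hDD : D ≠ 0 := by rintro rfl; simp at hfac; exact hD hfac
  have hc : c = D / W := by field_simp; exact hC
  have hpp : (p : ℂ) ^ m * PX p n ^ (2 * n) = PX p n * S * W := by
    apply mul_left_cancel₀ h2
    linear_combination -hZ
  rw [hpp, hc]
  have hv : v * (PX p n * S * W / Q * (1 / (Q * PX p n) * (D / W))) * v = v ^ 2 * (S * D / Q ^ 2) := by
    field_simp
  rw [hv, hV, hfac]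
  field_simp

end matE

section solve
variable {p m n : ℕ} [Fact p.Prime]

/-- the two elementary sums coming out of the partial fraction decomposition -/
lemma dsums (hp : p = 2 * n + 1) (hn : n = 2 * m) (a b : ℂ) (d : Fin n → ℂ)
    (h1 : ∏ i : Fin n, (1 + xx p i) = (∏ i : Fin n, (1 - xx p i)) * (b * sp p + a))
    (h2 : ∏ i : Fin n, (1 - xx p i) = (∏ i : Fin n, (1 + xx p i)) * (b * sp p - a))
    (hd : ∀ i : Fin n, ∑ j, d j / (1 + xx p i * xx p j) = - (PX p n) ^ 2 / xx p i ^ 2) :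
    ∑ j, d j / (1 - xx p j ^ 2) = PX p n * sp p * (b - a) - PX p n ^ 2 ∧
    ∑ j, d j * xx p j / (1 - xx p j ^ 2) = PX p n * (a - b * p) := by
  have hpf := parfrac hn (fun i : Fin n => xx p i) d (xx_ne hp) (xx_inj hp) (one_add_ne hp) hd
  rw [sum_xx hp hn] at hpf
  have g1 := hpf 1
  have g2 := hpf (-1)
  have hfac : ∀ i : Fin n, 1 - xx p i ^ 2 = (1 + xx p i) * (1 - xx p i) := fun i => by ring
  have n1 : ∀ i : Fin n, 1 + xx p i ≠ 0 := fun i h => one_sub_sq_ne hp i (by rw [hfac, h, zero_mul])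
  have n2 : ∀ i : Fin n, 1 - xx p i ≠ 0 := fun i h => one_sub_sq_ne hp i (by rw [hfac, h, mul_zero])
  have N1 : ∏ i : Fin n, (1 + xx p i) ≠ 0 := Finset.prod_ne_zero_iff.mpr (fun i _ => n1 i)
  have N2 : ∏ i : Fin n, (1 - xx p i) ≠ 0 := Finset.prod_ne_zero_iff.mpr (fun i _ => n2 i)
  have e1 : ∑ j, d j * ∏ k ∈ {j}ᶜ, (1 + 1 * xx p k) = (∏ i : Fin n, (1 + xx p i)) * ∑ j, d j / (1 + xx p j) := by
    rw [Finset.mul_sum]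
    apply Finset.sum_congr rfl; intro j _
    rw [← Finset.prod_mul_prod_compl {j} (fun i => 1 + xx p i), Finset.prod_singleton]
    have := n1 j
    field_simp
  have e2 : ∑ j, d j * ∏ k ∈ {j}ᶜ, (1 + (-1) * xx p k) = (∏ i : Fin n, (1 - xx p i)) * ∑ j, d j / (1 - xx p j) := by
    rw [Finset.mul_sum]
    apply Finset.sum_congr rfl; intro j _
    rw [← Finset.prod_mul_prod_compl {j} (fun i => 1 - xx p i), Finset.prod_singleton]
    have := n2 j
    field_simp
    congr 1
  have e3 : ∏ i : Fin n, (-1 - xx p i) = ∏ i : Fin n, (1 + xx p i) := by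
    have : ∏ i : Fin n, (-1 - xx p i) = ∏ i : Fin n, (- (1 + xx p i)) :=
      Finset.prod_congr rfl (fun i _ => by ring)
    rw [this, Finset.prod_neg]; simp [hn]
  have e4 : ∏ i : Fin n, (1 + 1 * xx p i) = ∏ i : Fin n, (1 + xx p i) := by simp
  have e5 : ∏ i : Fin n, (1 + (-1) * xx p i) = ∏ i : Fin n, (1 - xx p i) :=
      Finset.prod_congr rfl (fun i _ => by ring)
  rw [e1, e4] at g1
  rw [e2, e3, e5] at g2
  rw [show (∏ i : Fin n, xx p i) = PX p n from rfl] at g1 g2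
  have s1 : ∑ j, d j / (1 + xx p j) = PX p n * (1 + sp p) * (b * sp p - a) - PX p n ^ 2 := by
    apply mul_left_cancel₀ N1
    linear_combination g1 + PX p n * (1 + sp p) * h2
  have s2 : ∑ j, d j / (1 - xx p j) = PX p n * (1 - sp p) * (b * sp p + a) - PX p n ^ 2 := by
    apply mul_left_cancel₀ N2
    linear_combination g2 + PX p n * (1 - sp p) * h1
  constructor
  · have : ∑ j, d j / (1 - xx p j ^ 2) = (∑ j, d j / (1 + xx p j) + ∑ j, d j / (1 - xx p j)) / 2 := by
      rw [← Finset.sum_add_distrib, Finset.sum_div]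
      apply Finset.sum_congr rfl; intro j _
      have := n1 j
      have := n2 j
      rw [hfac]; field_simp; ring
    rw [this, s1, s2]; ring
  · have : ∑ j, d j * xx p j / (1 - xx p j ^ 2) = (∑ j, d j / (1 - xx p j) - ∑ j, d j / (1 + xx p j)) / 2 := by
      rw [← Finset.sum_sub_distrib, Finset.sum_div]
      apply Finset.sum_congr rfl; intro j _
      have := n1 j
      have := n2 j
      rw [hfac]; field_simp; ring
    rw [this, s1, s2, ← sp_sq]; ring

lemma prod_one_sub_yy (hp : p = 2 * n + 1) (hn : n = 2 * m) :
    ∏ i : Fin n, (1 - yy p i) = sp p * PX p n := prod_one_sub_sq hp hn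

lemma solve_w (hp : p = 2 * n + 1) (hn : n = 2 * m) (a b : ℂ) (w : Fin n → ℂ)
    (h1 : ∏ i : Fin n, (1 + xx p i) = (∏ i : Fin n, (1 - xx p i)) * (b * sp p + a))
    (h2 : ∏ i : Fin n, (1 - xx p i) = (∏ i : Fin n, (1 + xx p i)) * (b * sp p - a))
    (hw : EE p n *ᵥ w = fun j : Fin n => if (j : ℕ) = 0 then (1 : ℂ) else 0) :
    ∑ k, w k = (-1) ^ m * (p * b - a) ∧
    1 + ∑ k : Fin n, ch p (((0 : ℕ) : ZMod p) - ((k : ℕ) : ZMod p)) * w k = b - a ∧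
    ∀ s : ℕ, s ≤ n → s ≠ 0 → ∑ k : Fin n, ch p ((s : ZMod p) - ((k : ℕ) : ZMod p)) * w k = b - a := by
  set V := Matrix.vandermonde (fun i : Fin n => yy p i) with hV
  set γ := V *ᵥ w with hγ
  have hVdet : V.det ≠ 0 := Matrix.det_vandermonde_ne_zero_iff.mpr (yy_inj hp)
  have hVT : Function.Injective Vᵀ.mulVec := by
    rw [Matrix.mulVec_injective_iff_isUnit, Matrix.isUnit_iff_isUnit_det, Matrix.det_transpose]
    exact hVdet.isUnit
  let δ : Fin n → ℂ := fun i => (∏ l ∈ {i}ᶜ, (0 - yy p l)) / Pd p i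
  have hMγ : MM p m n *ᵥ γ = δ := by
    apply hVT
    rw [EE_eq hp hn, ← Matrix.mulVec_mulVec, ← Matrix.mulVec_mulVec] at hw
    rw [hγ]
    refine hw.trans ?_
    ext k
    have := lag (fun i : Fin n => yy p i) (yy_inj hp) 0 k
    rw [zero_pow_eq] at this
    rw [this, Matrix.mulVec, dotProduct]
    apply Finset.sum_congr rfl
    intro j _
    rw [mul_comm]
    rfl
  let d : Fin n → ℂ := fun j => γ j * KK p m n / (Pd p j * xx p j)
  have hK : KK p m n ≠ 0 := by
    unfold KK
    exact neg_ne_zero.mpr (mul_ne_zero (mul_ne_zero (pow_ne_zero _ (by norm_num)) sp_ne) (pow_ne_zero _ (PX_ne hp)))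
  have hd : ∀ i : Fin n, ∑ j, d j / (1 + xx p i * xx p j) = - (PX p n) ^ 2 / xx p i ^ 2 := by
    intro i
    have h := congrFun hMγ i
    have hi := Pd_ne hp i
    have e1 : ∑ j, d j / (1 + xx p i * xx p j) = Pd p i * (MM p m n *ᵥ γ) i := by
      rw [Matrix.mulVec, dotProduct, Finset.mul_sum]
      apply Finset.sum_congr rfl; intro j _
      simp only [d, MM, Matrix.of_apply]
      have := Pd_ne hp j
      have := xx_ne hp j
      have := one_add_ne hp i j
      field_simp
    rw [e1, h]
    simp only [δ]
    rw [mul_div_cancel₀ _ hi]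
    have e2 : ∏ l ∈ {i}ᶜ, (0 - yy p l) = - ∏ l ∈ {i}ᶜ, (xx p l ^ 2) := by
      simp only [zero_sub]
      rw [Finset.prod_neg]
      have : (({i}ᶜ : Finset (Fin n))).card = 2 * (m - 1) + 1 := by
        rw [Finset.card_compl, Finset.card_singleton, Fintype.card_fin]
        have := i.2; omega
      rw [this, pow_succ, pow_mul]; simp [yy]
    rw [e2, PX, ← Finset.prod_pow, ← Finset.prod_mul_prod_compl {i} (fun l => xx p l ^ 2), Finset.prod_singleton]
    have := xx_ne hp i
    field_simp
  obtain ⟨S1, S2⟩ := dsums hp hn a b d h1 h2 hd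
  have hX := PX_ne hp
  have hs := sp_ne (p := p)
  have hm0 : ((-1 : ℂ) ^ m) ≠ 0 := pow_ne_zero _ (by norm_num)
  constructor
  · have e1 : ∑ k, w k = ∑ j, (∏ l ∈ {j}ᶜ, (1 - yy p l)) / Pd p j * γ j := by
      have : ∀ k, w k = ∑ j : Fin n, (∏ l ∈ {j}ᶜ, (1 - yy p l)) / Pd p j * (yy p j ^ (k : ℕ) * w k) := by
        intro k
        have := lag (fun i : Fin n => yy p i) (yy_inj hp) 1 k
        rw [one_pow] at this
        simp_rw [← mul_assoc]
        rw [← Finset.sum_mul]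
        change w k = (∑ j : Fin n, (∏ l ∈ {j}ᶜ, (1 - yy p l)) / (∏ l ∈ {j}ᶜ, (yy p j - yy p l)) * yy p j ^ (k : ℕ)) * w k
        rw [← this, one_mul]
      rw [Finset.sum_congr rfl (fun k _ => this k), Finset.sum_comm]
      apply Finset.sum_congr rfl; intro j _
      rw [← Finset.mul_sum]
      rfl
    have e2 : ∑ k, w k = (sp p * PX p n / KK p m n) * ∑ j, d j * xx p j / (1 - xx p j ^ 2) := by
      rw [e1, Finset.mul_sum, ← prod_one_sub_yy hp hn]
      apply Finset.sum_congr rfl; intro j _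
      rw [← Finset.prod_mul_prod_compl {j} (fun l => 1 - yy p l), Finset.prod_singleton]
      simp only [d]
      have := Pd_ne hp j
      have := xx_ne hp j
      have h3 : 1 - yy p j ≠ 0 := one_sub_sq_ne hp j
      rw [show xx p j ^ 2 = yy p j from rfl]
      field_simp
    rw [e2, S2, KK]
    field_simp
    linear_combination (a - b * p) * neg_one_sq m
  · set Φ : ℕ → ℂ := fun s => ∑ k : Fin n, ch p ((s : ZMod p) - ((k : ℕ) : ZMod p)) * w k with hΦ
    have hstep : ∀ j : ℕ, j < n → Φ (j + 1) - Φ j = if j = 0 then 1 else 0 := by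
      intro j hj
      have := congrFun hw ⟨j, hj⟩
      simp only [Matrix.mulVec, dotProduct, EE, Matrix.of_apply] at this
      rw [← this, hΦ]
      simp only
      rw [← Finset.sum_sub_distrib]
      exact Finset.sum_congr rfl (fun k _ => by ring)
    have hall : ∀ s : ℕ, s ≤ n → Φ s = (Φ 0 + 1) - if s = 0 then 1 else 0 := by
      intro s
      induction s with
      | zero => intro _; simp
      | succ j ih =>
        intro hj
        have e := hstep j (by omega)
        have := ih (by omega)
        rw [if_neg (by omega)]
        linear_combination e + this
    let P : Polynomial ℂ := ∏ i : Fin n, (Polynomial.X - Polynomial.C (yy p i))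
    have hdeg : P.natDegree < n + 1 := by
      simp only [P]
      rw [Polynomial.natDegree_finsetProd_X_sub_C_eq_card]; simp
    have hPe : ∀ t, ∑ s ∈ range (n + 1), P.coeff s * t ^ s = ∏ i : Fin n, (t - yy p i) := by
      intro t
      rw [← Polynomial.eval_eq_sum_range' hdeg]
      simp [P, Polynomial.eval_prod]
    have w1 : ∑ s ∈ range (n + 1), P.coeff s * Φ s = sp p * PX p n * (Φ 0 + 1) - PX p n ^ 2 := by
      have : ∑ s ∈ range (n + 1), P.coeff s * Φ s =
         (∑ s ∈ range (n + 1), P.coeff s * 1 ^ s) * (Φ 0 + 1) - ∑ s ∈ range (n + 1), P.coeff s * 0 ^ s := by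
        rw [Finset.sum_mul, ← Finset.sum_sub_distrib]
        apply Finset.sum_congr rfl; intro s hs
        rw [hall s (by simp at hs; omega), zero_pow_eq]; ring
      rw [this, hPe, hPe, prod_one_sub_yy hp hn]
      congr 1
      simp only [zero_sub]
      rw [Finset.prod_neg, PX, ← Finset.prod_pow]
      simp [hn, yy]
    have w2 : ∑ s ∈ range (n + 1), P.coeff s * Φ s = ∑ j, d j / (1 - xx p j ^ 2) := by
      have f1 : ∀ s, Φ s = (-1) ^ m / sp p * ∑ r : Fin n, ∑ k : Fin n, ch p (uu p r) *
      (yy p r ^ s * (yy p r)⁻¹ ^ (k : ℕ) + (yy p r)⁻¹ ^ s * yy p r ^ (k : ℕ)) * w k := by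
        intro s
        rw [Finset.sum_comm, Finset.mul_sum]
        simp only [hΦ]
        apply Finset.sum_congr rfl; intro k _
        rw [ch_fourier hp hn, ← Finset.sum_mul, mul_assoc]
      have f2 : ∑ s ∈ range (n + 1), P.coeff s * Φ s = (-1) ^ m / sp p * ∑ r : Fin n, ∑ k : Fin n,
         ch p (uu p r) * ((∑ s ∈ range (n + 1), P.coeff s * yy p r ^ s) * (yy p r)⁻¹ ^ (k : ℕ) +
          (∑ s ∈ range (n + 1), P.coeff s * (yy p r)⁻¹ ^ s) * yy p r ^ (k : ℕ)) * w k := by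
        simp_rw [f1]
        have : ∀ s ∈ range (n + 1), P.coeff s * ((-1) ^ m / sp p * ∑ r : Fin n, ∑ k : Fin n, ch p (uu p r) *
            (yy p r ^ s * (yy p r)⁻¹ ^ (k : ℕ) + (yy p r)⁻¹ ^ s * yy p r ^ (k : ℕ)) * w k) =
           (-1) ^ m / sp p * ∑ r : Fin n, ∑ k : Fin n, P.coeff s * (ch p (uu p r) *
            (yy p r ^ s * (yy p r)⁻¹ ^ (k : ℕ) + (yy p r)⁻¹ ^ s * yy p r ^ (k : ℕ)) * w k) := by
          intro s _
          simp_rw [← Finset.mul_sum]; ring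
        rw [Finset.sum_congr rfl this, ← Finset.mul_sum, Finset.sum_comm]
        congr 1
        apply Finset.sum_congr rfl; intro r _
        rw [Finset.sum_comm]
        apply Finset.sum_congr rfl; intro k _
        rw [Finset.sum_mul, Finset.sum_mul, ← Finset.sum_add_distrib, Finset.mul_sum, Finset.sum_mul]
        apply Finset.sum_congr rfl; intro s _
        ring
      rw [f2, Finset.mul_sum]
      apply Finset.sum_congr rfl; intro r _
      have hz : ∏ i : Fin n, (yy p r - yy p i) = 0 := Finset.prod_eq_zero (mem_univ r) (sub_self _)
      rw [hPe, hPe, hz]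
      have hγr : γ r = ∑ k : Fin n, yy p r ^ (k : ℕ) * w k := rfl
      have e : ∑ k : Fin n, ch p (uu p r) * (0 * (yy p r)⁻¹ ^ (k : ℕ) +
         (∏ i : Fin n, ((yy p r)⁻¹ - yy p i)) * yy p r ^ (k : ℕ)) * w k =
          ch p (uu p r) * (∏ i : Fin n, ((yy p r)⁻¹ - yy p i)) * γ r := by
        rw [hγr, Finset.mul_sum]
        exact Finset.sum_congr rfl (fun k _ => by ring)
      rw [e]
      have hP := Pinv hp hn r
      simp only [d, KK]
      have h3 : 1 - yy p r ≠ 0 := one_sub_sq_ne hp r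
      rw [show xx p r ^ 2 = yy p r from rfl]
      have h4 := Pd_ne hp r
      have h5 := xx_ne hp r
      rw [← sp_sq] at hP
      generalize (∏ i : Fin n, ((yy p r)⁻¹ - yy p i)) = Q at hP ⊢
      field_simp
      linear_combination γ r * hP
    have hfin : sp p * PX p n * (Φ 0 + 1) = sp p * PX p n * (b - a) := by
      rw [S1] at w2
      linear_combination w2 - w1
    have := mul_left_cancel₀ (mul_ne_zero hs hX) hfin
    refine ⟨by rw [← this, add_comm], fun s hs h0 => ?_⟩
    have e := hall s hs
    rw [if_neg h0, sub_zero, this] at e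
    exact e

end solve

section final
variable {p m n : ℕ} [Fact p.Prime]

lemma zeta_pow (k : ℤ) : (Complex.exp (2 * Real.pi * Complex.I / p)) ^ k = ee p (k : ZMod p) := by
  rw [← Complex.exp_int_mul, ee, ZMod.stdAddChar_coe]
  congr 1
  ring

lemma leg_ch (k : ℤ) : ((legendreSym p k : ℤ) : ℂ) = ch p (k : ZMod p) := rfl

lemma prod_Icc_fin (f : ℕ → ℂ) : ∏ r ∈ Finset.Icc 1 n, f r = ∏ i : Fin n, f ((i : ℕ) + 1) := by
  rw [Fin.prod_univ_eq_prod_range (fun i => f (i + 1)) n]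
  have : Finset.Icc 1 n = Finset.Ico 1 (n + 1) := by ext; simp
  rw [this, Finset.prod_Ico_eq_prod_range]
  simp [add_comm]

lemma PX_eq (hp : p = 2 * n + 1) (hn : n = 2 * m) :
    PX p n = (-1) ^ m * ee p ((-((n * (n + 1) / 2 : ℕ) : ℤ) : ℤ) : ZMod p) := by
  unfold PX xx
  rw [Finset.prod_mul_distrib, prod_ch hp hn]
  congr 1
  have h : ∀ s : Finset (Fin n), ∏ i ∈ s, ee p (-uu p i) = ee p (- ∑ i ∈ s, uu p i) := by
    intro s
    classical
    induction s using Finset.induction_on with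
    | empty => simp
    | insert a s ha ih => rw [Finset.prod_insert ha, Finset.sum_insert ha, ih, ← ee_add]; congr 1; ring
  rw [h]
  congr 1
  rw [Int.cast_neg, Int.cast_natCast]
  congr 1
  unfold uu
  rw [← Nat.cast_sum, Fin.sum_univ_eq_sum_range (fun i => i + 1) n]
  congr 1
  have h3 := Finset.sum_range_succ' (fun i => i) n
  rw [add_zero] at h3
  rw [← h3, Finset.sum_range_id]
  rw [Nat.add_sub_cancel, mul_comm]

lemma consts (hp : p = 2 * n + 1) (hn : n = 2 * m) (ζ : ℂ) (hζ : ζ = Complex.exp (2 * Real.pi * Complex.I / p))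
    (A B : ℝ)
    (hAB1 : ∏ r ∈ Finset.Icc 1 n, (1 + (legendreSym p (r : ℤ) : ℂ) * ζ ^ (-(r : ℤ))) ^ 2
        = (-1 : ℂ) ^ (n / 2) * ζ ^ (-((n * (n + 1) / 2 : ℕ) : ℤ))
          * ((B : ℂ) * (p : ℂ) + (A : ℂ) * ((Real.sqrt p : ℝ) : ℂ)))
    (hAB2 : ∏ r ∈ Finset.Icc 1 n, (1 - (legendreSym p (r : ℤ) : ℂ) * ζ ^ (-(r : ℤ))) ^ 2
        = (-1 : ℂ) ^ (n / 2) * ζ ^ (-((n * (n + 1) / 2 : ℕ) : ℤ))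
          * ((B : ℂ) * (p : ℂ) - (A : ℂ) * ((Real.sqrt p : ℝ) : ℂ))) :
    (∏ i : Fin n, (1 + xx p i) = (∏ i : Fin n, (1 - xx p i)) * (B * sp p + A)) ∧
    (∏ i : Fin n, (1 - xx p i) = (∏ i : Fin n, (1 + xx p i)) * (B * sp p - A)) := by
  have hx : ∀ i : Fin n, (legendreSym p ((((i : ℕ) + 1 : ℕ)) : ℤ) : ℂ) * ζ ^ (-((((i : ℕ) + 1 : ℕ)) : ℤ)) = xx p i := by
    intro i
    rw [hζ, zeta_pow, leg_ch, xx, uu]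
    push_cast; rfl
  have hm : n / 2 = m := by omega
  have hX : (-1 : ℂ) ^ (n / 2) * ζ ^ (-((n * (n + 1) / 2 : ℕ) : ℤ)) = PX p n := by
    rw [hm, hζ, zeta_pow, PX_eq hp hn]
  rw [prod_Icc_fin (fun r => (1 + (legendreSym p (r : ℤ) : ℂ) * ζ ^ (-(r : ℤ))) ^ 2), hX] at hAB1
  rw [prod_Icc_fin (fun r => (1 - (legendreSym p (r : ℤ) : ℂ) * ζ ^ (-(r : ℤ))) ^ 2), hX] at hAB2
  simp_rw [hx] at hAB1 hAB2
  rw [Finset.prod_pow, ← sp_sq, show ((Real.sqrt p : ℝ) : ℂ) = sp p from rfl] at hAB1 hAB2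
  have hpm : (∏ i : Fin n, (1 + xx p i)) * (∏ i : Fin n, (1 - xx p i)) = sp p * PX p n := by
    rw [PX, ← prod_one_sub_sq hp hn, ← Finset.prod_mul_distrib]
    exact Finset.prod_congr rfl (fun i _ => by ring)
  have hne : sp p * PX p n ≠ 0 := mul_ne_zero sp_ne (PX_ne hp)
  rw [← hpm] at hne
  have N1 := left_ne_zero_of_mul hne
  have N2 := right_ne_zero_of_mul hne
  constructor
  · apply mul_left_cancel₀ N1
    linear_combination hAB1 - (B * sp p + A) * hpm
  · apply mul_left_cancel₀ N2
    linear_combination hAB2 - (B * sp p - A) * hpm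

end final

end Evil

/-- The inverse package for the adjacent minor `H = [χ(j-k+1)]`. -/
theorem stmt_1 (p : ℕ) [Fact p.Prime] (hp4 : p % 4 = 1)
    (n : ℕ) (hn : n = (p - 1) / 2)
    (ζ : ℂ) (hζ : ζ = Complex.exp (2 * Real.pi * Complex.I / p))
    (A B : ℝ) (hBA : B ≠ A)
    (hAB1 : ∏ r ∈ Finset.Icc 1 n, (1 + (legendreSym p (r : ℤ) : ℂ) * ζ ^ (-(r : ℤ))) ^ 2
        = (-1 : ℂ) ^ (n / 2) * ζ ^ (-((n * (n + 1) / 2 : ℕ) : ℤ))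
          * ((B : ℂ) * (p : ℂ) + (A : ℂ) * ((Real.sqrt p : ℝ) : ℂ)))
    (hAB2 : ∏ r ∈ Finset.Icc 1 n, (1 - (legendreSym p (r : ℤ) : ℂ) * ζ ^ (-(r : ℤ))) ^ 2
        = (-1 : ℂ) ^ (n / 2) * ζ ^ (-((n * (n + 1) / 2 : ℕ) : ℤ))
          * ((B : ℂ) * (p : ℂ) - (A : ℂ) * ((Real.sqrt p : ℝ) : ℂ)))
    (L : ℝ) (hL : L = (legendreSym p 2 : ℝ))
    (H : Matrix (Fin n) (Fin n) ℝ)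
    (hH : ∀ j k : Fin n, H j k = (legendreSym p (((j : ℕ) : ℤ) - ((k : ℕ) : ℤ) + 1) : ℝ))
    (η : Fin n → ℝ) (hη : ∀ j : Fin n, η j = (legendreSym p ((j : ℕ) : ℤ) : ℝ)) :
    IsUnit H ∧
    H.det = L * (B - A) ∧
    (fun _ : Fin n => (1 : ℝ)) ⬝ᵥ (H⁻¹ *ᵥ fun _ : Fin n => (1 : ℝ))
      = L * ((p : ℝ) * B - A) / (B - A) ∧
    (fun _ : Fin n => (1 : ℝ)) ⬝ᵥ (H⁻¹ *ᵥ η) = 1 ∧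
    η ⬝ᵥ (H⁻¹ *ᵥ fun _ : Fin n => (1 : ℝ)) = (B - A - 1) / (B - A) ∧
    η ⬝ᵥ (H⁻¹ *ᵥ η) = 1 := by
  have hprime : p.Prime := Fact.out
  have hp2 := hprime.two_le
  obtain ⟨m, hm⟩ : ∃ m, p = 4 * m + 1 := ⟨p / 4, by omega⟩
  have hm1 : 1 ≤ m := by omega
  have hp : p = 2 * n + 1 := by omega
  have hn2 : n = 2 * m := by omega
  obtain ⟨c1, c2⟩ := Evil.consts hp hn2 ζ hζ A B hAB1 hAB2
  have hdE := Evil.det_EE hp hn2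
  have hEu : IsUnit (Evil.EE p n).det := by
    rw [hdE]; exact (pow_ne_zero _ (by norm_num : (-1 : ℂ) ≠ 0)).isUnit
  let e0 : Fin n → ℂ := fun j => if (j : ℕ) = 0 then 1 else 0
  let w : Fin n → ℂ := (Evil.EE p n)⁻¹ *ᵥ e0
  have hw : Evil.EE p n *ᵥ w = e0 := by
    simp only [w]
    rw [Matrix.mulVec_mulVec, Matrix.mul_nonsing_inv _ hEu, Matrix.one_mulVec]
  obtain ⟨s1, s2, s3⟩ := Evil.solve_w hp hn2 A B w c1 c2 hw
  let HC : Matrix (Fin n) (Fin n) ℂ := H.map Complex.ofRealHom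
  have hHC : ∀ j k : Fin n, HC j k = Evil.ch p (((((j : ℕ) + 1 : ℕ)) : ZMod p) - ((k : ℕ) : ZMod p)) := by
    intro j k
    simp only [HC, Matrix.map_apply, hH, Complex.ofRealHom_eq_coe, Complex.ofReal_intCast]
    rw [Evil.leg_ch]
    congr 1; push_cast; ring
  have hLC : (L : ℂ) = (-1) ^ m := by
    rw [hL, Complex.ofReal_intCast, Evil.leg_ch, ← Evil.ch_two hp hn2]
    norm_num
  have hηC : ∀ k : Fin n, (η k : ℂ) = Evil.ch p (((0 : ℕ) : ZMod p) - ((k : ℕ) : ZMod p)) := by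
    intro k
    rw [hη, Complex.ofReal_intCast, Evil.leg_ch, Nat.cast_zero, zero_sub, Evil.ch_neg hm]
    push_cast; rfl
  have hBAC : (B : ℂ) - A ≠ 0 := by
    rw [sub_ne_zero]; exact_mod_cast hBA
  have hBAR : B - A ≠ 0 := sub_ne_zero.mpr hBA
  have hdetC : HC.det = (-1) ^ m * (B - A) := by
    rw [← s2, ← hdE]
    obtain ⟨k, rfl⟩ : ∃ k, n = k + 1 := ⟨n - 1, by omega⟩
    apply Evil.det_gen HC (Evil.EE p (k + 1)) (fun k => Evil.ch p (((0 : ℕ) : ZMod p) - ((k : ℕ) : ZMod p))) w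
    · intro j
      rw [hHC]; simp [Evil.EE]
    · intro i j
      rw [hHC, hHC]; simp [Evil.EE]
    · rw [hw]
      ext j
      by_cases hj : j = 0
      · subst hj; simp [e0]
      · have hj2 : (j : ℕ) ≠ 0 := fun h => hj (Fin.ext h)
        simp only [e0, if_neg hj2]
        first
          | rw [Pi.single_eq_of_ne hj]
          | simp [hj]
  have hdet : H.det = L * (B - A) := by
    have h1 : HC.det = ((H.det : ℝ) : ℂ) := by
      have := RingHom.map_det Complex.ofRealHom H
      exact this.symm
    rw [h1, ← hLC] at hdetC
    exact_mod_cast hdetC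
  have hL0 : L ≠ 0 := by
    intro h
    rw [h] at hLC
    exact pow_ne_zero m (by norm_num : (-1 : ℂ) ≠ 0) (by rw [← hLC]; simp)
  have hunit : IsUnit H.det := by rw [hdet]; exact (mul_ne_zero hL0 hBAR).isUnit
  have hunitC : IsUnit HC := by
    rw [Matrix.isUnit_iff_isUnit_det, hdetC]
    exact (mul_ne_zero (pow_ne_zero m (by norm_num : (-1 : ℂ) ≠ 0)) hBAC).isUnit
  let v : Fin n → ℝ := H⁻¹ *ᵥ fun _ : Fin n => (1 : ℝ)
  have hv : H *ᵥ v = fun _ => 1 := by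
    simp only [v]
    rw [Matrix.mulVec_mulVec, Matrix.mul_nonsing_inv _ hunit, Matrix.one_mulVec]
  have hwv : w = fun k => ((B : ℂ) - A) * (v k : ℂ) := by
    apply (Matrix.mulVec_injective_iff_isUnit.mpr hunitC)
    ext j
    have e1 : (HC *ᵥ w) j = B - A := by
      rw [Matrix.mulVec, dotProduct]
      simp_rw [hHC]
      exact s3 ((j : ℕ) + 1) (by have := j.2; omega) (by omega)
    have e2 : ∑ k, HC j k * (v k : ℂ) = 1 := by
      have := congrFun hv j
      rw [Matrix.mulVec, dotProduct] at this
      have h2 := congrArg (fun x : ℝ => (x : ℂ)) this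
      simp only [Complex.ofReal_sum, Complex.ofReal_mul, Complex.ofReal_one] at h2
      exact h2
    rw [e1, Matrix.mulVec, dotProduct]
    rw [show (∑ k, HC j k * (((B : ℂ) - A) * (v k : ℂ))) = ((B : ℂ) - A) * ∑ k, HC j k * (v k : ℂ) from by
      rw [Finset.mul_sum]; exact Finset.sum_congr rfl (fun k _ => by ring)]
    rw [e2, mul_one]
  have hsum : (fun _ : Fin n => (1 : ℝ)) ⬝ᵥ v = L * ((p : ℝ) * B - A) / (B - A) := by
    rw [eq_div_iff hBAR, dotProduct]
    simp only [one_mul]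
    rw [hwv, ← Finset.mul_sum, ← hLC] at s1
    rw [mul_comm]
    exact_mod_cast s1
  have hηv : η ⬝ᵥ v = (B - A - 1) / (B - A) := by
    rw [eq_div_iff hBAR, dotProduct]
    rw [hwv] at s2
    simp_rw [← hηC] at s2
    rw [show (∑ k, (η k : ℂ) * (((B : ℂ) - A) * (v k : ℂ))) = ((B : ℂ) - A) * ∑ k, (η k : ℂ) * (v k : ℂ) from by
      rw [Finset.mul_sum]; exact Finset.sum_congr rfl (fun k _ => by ring)] at s2
    have s2' : 1 + (B - A) * ∑ k, η k * v k = B - A := by exact_mod_cast s2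
    linear_combination s2'
  have hηinv : H⁻¹ *ᵥ η = Pi.single (⟨1, by omega⟩ : Fin n) 1 := by
    have : η = H *ᵥ Pi.single (⟨1, by omega⟩ : Fin n) 1 := by
      ext j
      rw [Matrix.mulVec_single_one, Matrix.col_apply, hH, hη]
      congr 2
      push_cast; ring
    rw [this, Matrix.mulVec_mulVec, Matrix.nonsing_inv_mul _ hunit, Matrix.one_mulVec]
  refine ⟨(Matrix.isUnit_iff_isUnit_det H).mpr hunit, hdet, hsum, ?_, hηv, ?_⟩
  · rw [hηinv, dotProduct_single]; simp
  · rw [hηinv, dotProduct_single, hη]; simp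
end

section
/- Let p be a prime with p ≡ 1 (mod 4) and n = (p−1)/2. Then for every real number t, the determinant of the n×n real matrix with (j,k) entry t + χ(j−k+1) (0 ≤ j,k ≤ n−1) equals (pB − A)·t + L·(B − A). -/
open Complex Matrix BigOperators Finset

namespace S3

set_option linter.unusedSectionVars false

variable (p : ℕ) [hpF : Fact p.Prime]

/-- the quadratic character with complex values -/
noncomputable def chi : MulChar (ZMod p) ℂ :=
  (quadraticChar (ZMod p)).ringHomComp (Int.castRingHom ℂ)

/-- the standard additive character -/
noncomputable def psi : AddChar (ZMod p) ℂ := ZMod.stdAddChar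

/-- the signed roots of unity -/
noncomputable def om (c : ZMod p) : ℂ := chi p (2 * c) * psi p c

variable {p}

theorem p_ne_two (hp4 : p % 4 = 1) : p ≠ 2 := by omega

theorem two_ne (hp4 : p % 4 = 1) : (2 : ZMod p) ≠ 0 := by
  have h := ZMod.natCast_eq_zero_iff 2 p
  intro h2
  have : p ∣ 2 := h.1 (by exact_mod_cast h2)
  have := Nat.le_of_dvd (by norm_num) this
  have := hpF.out.two_le
  omega

theorem chi_leg (a : ℤ) : chi p (a : ZMod p) = (legendreSym p a : ℂ) := rfl

theorem chi_sq {c : ZMod p} (hc : c ≠ 0) : chi p c ^ 2 = 1 := by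
  have := quadraticChar_sq_one hc
  simp only [chi, MulChar.ringHomComp_apply]
  rw [← map_pow, this]; simp

theorem chi_neg_one (hp4 : p % 4 = 1) : chi p (-1) = 1 := by
  have h := legendreSym.at_neg_one (p := p) (p_ne_two hp4)
  rw [ZMod.χ₄_nat_one_mod_four hp4] at h
  have := chi_leg (p := p) (-1)
  rw [h] at this
  simpa using this

theorem chi_neg (hp4 : p % 4 = 1) (c : ZMod p) : chi p (-c) = chi p c := by
  rw [neg_eq_neg_one_mul, map_mul, chi_neg_one hp4, one_mul]

theorem chi_quad : (chi p).IsQuadratic := by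
  intro c
  by_cases hc : c = 0
  · left; rw [hc]; exact MulChar.map_zero _
  · right; exact sq_eq_one_iff.1 (chi_sq hc)

theorem psi_prim : (psi p).IsPrimitive := ZMod.isPrimitive_stdAddChar p

theorem psi_ne (c : ZMod p) : psi p c ≠ 0 := by
  simp [psi, ZMod.stdAddChar_apply]

theorem psi_inj : Function.Injective (psi p) := ZMod.injective_stdAddChar

theorem psi_one : psi p 1 = Complex.exp (2 * Real.pi * Complex.I / p) := by
  have := ZMod.stdAddChar_coe (N := p) 1
  simpa [psi] using this

theorem om_sq (hp4 : p % 4 = 1) {c : ZMod p} (hc : c ≠ 0) : om p c ^ 2 = psi p (2 * c) := by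
  rw [om, mul_pow, chi_sq (mul_ne_zero (two_ne hp4) hc), one_mul, two_mul, AddChar.map_add_eq_mul, sq]

theorem om_mul_neg (hp4 : p % 4 = 1) {c : ZMod p} (hc : c ≠ 0) : om p c * om p (-c) = 1 := by
  rw [om, om, mul_neg, chi_neg hp4]
  rw [show ∀ a b d : ℂ, a * b * (a * d) = a ^ 2 * (b * d) by intros; ring, chi_sq (mul_ne_zero (two_ne hp4) hc),
    ← AddChar.map_add_eq_mul]
  simp

theorem sum_psi {d : ZMod p} (hd : d ≠ 0) : ∑ c ∈ univ.erase (0 : ZMod p), psi p (c * d) = -1 := by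
  have h := AddChar.sum_mulShift d (psi_prim (p := p))
  rw [if_neg hd, ← Finset.add_sum_erase _ _ (mem_univ 0), zero_mul, AddChar.map_zero_eq_one] at h
  push_cast at h
  linear_combination h

theorem psi_pow (c : ZMod p) (k : ℕ) : psi p c ^ k = psi p (c * k) := by
  rw [mul_comm, ← nsmul_eq_mul, AddChar.map_nsmul_eq_pow]

theorem prod_zmod {M : Type*} [CommMonoid M] (f : ZMod p → M) : ∏ c : ZMod p, f c = ∏ k ∈ range p, f k := by
  refine Finset.prod_nbij' (fun c => c.val) (fun k => (k : ZMod p)) ?_ ?_ ?_ ?_ ?_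
  · intro c _; simpa using ZMod.val_lt c
  · intro c _; simp
  · intro c _; simp
  · intro c hc; exact ZMod.val_cast_of_lt (by simpa using hc)
  · intro c _; simp

theorem sum_zmod {M : Type*} [AddCommMonoid M] (f : ZMod p → M) : ∑ c : ZMod p, f c = ∑ k ∈ range p, f k := by
  refine Finset.sum_nbij' (fun c => c.val) (fun k => (k : ZMod p)) ?_ ?_ ?_ ?_ ?_
  · intro c _; simpa using ZMod.val_lt c
  · intro c _; simp
  · intro c _; simp
  · intro c hc; exact ZMod.val_cast_of_lt (by simpa using hc)
  · intro c _; simp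

theorem psi_one_prim : IsPrimitiveRoot (psi p 1) p := by
  rw [psi_one]; exact Complex.isPrimitiveRoot_exp p hpF.out.ne_zero

theorem psi_nat (k : ℕ) : psi p (k : ZMod p) = psi p 1 ^ k := by
  rw [psi_pow, one_mul]

theorem prod_x_sub (x : ℂ) : ∏ c ∈ univ.erase (0 : ZMod p), (x - psi p c) = ∑ k ∈ range p, x ^ k := by
  have h := X_pow_sub_C_eq_prod (psi_one_prim (p := p)) hpF.out.pos (one_pow (M := ℂ) p)
  have h2 : (∏ c : ZMod p, (Polynomial.X - Polynomial.C (psi p c))) = Polynomial.X ^ p - 1 := by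
    rw [prod_zmod]
    simp only [psi_nat]
    simpa using h.symm
  rw [← Finset.mul_prod_erase _ _ (mem_univ (0 : ZMod p)), AddChar.map_zero_eq_one, Polynomial.C_1,
    ← mul_geom_sum] at h2
  have h3 := mul_left_cancel₀ (by simpa using Polynomial.X_sub_C_ne_zero (1 : ℂ)) h2
  have h4 := congrArg (Polynomial.eval x) h3
  simpa [Polynomial.eval_prod, Polynomial.eval_finsetSum] using h4

theorem prod_one_sub : ∏ c ∈ univ.erase (0 : ZMod p), (1 - psi p c) = p := by
  rw [prod_x_sub]; simp

theorem prod_one_add (hp4 : p % 4 = 1) : ∏ c ∈ univ.erase (0 : ZMod p), (1 + psi p c) = 1 := by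
  have h := prod_x_sub (p := p) (-1)
  have ho : Odd p := Nat.odd_iff.2 (by omega)
  rw [neg_one_geom_sum, if_neg (by simpa using ho)] at h
  have : ∀ c ∈ univ.erase (0 : ZMod p), (-1 - psi p c) = -1 * (1 + psi p c) := by intros; ring
  rw [prod_congr rfl this, prod_mul_distrib] at h
  simp only [prod_const, card_erase_of_mem (mem_univ _), card_univ, ZMod.card] at h
  rwa [Even.neg_one_pow (by rw [Nat.even_iff]; omega), one_mul] at h

section half
variable (n : ℕ)
/-- half system -/
def e (p : ℕ) {n : ℕ} (i : Fin n) : ZMod p := ((i : ℕ) + 1 : ℕ)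

variable {n}

theorem cast_ne (hn : p = 2 * n + 1) {k : ℕ} (h0 : 0 < k) (h1 : k < p) : (k : ZMod p) ≠ 0 := by
  intro h
  have := (ZMod.natCast_eq_zero_iff k p).1 h
  exact absurd (Nat.le_of_dvd h0 this) (by omega)

theorem e_ne (hn : p = 2 * n + 1) (i : Fin n) : e p i ≠ 0 := cast_ne hn (by omega) (by omega)

theorem e_inj (hn : p = 2 * n + 1) : Function.Injective (e p : Fin n → ZMod p) := by
  intro i j h
  have := (ZMod.natCast_eq_natCast_iff' _ _ _).1 h
  rw [Nat.mod_eq_of_lt (by omega), Nat.mod_eq_of_lt (by omega)] at this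
  ext; omega

theorem e_ne_neg (hn : p = 2 * n + 1) (i j : Fin n) : e p i ≠ - e p j := by
  intro h
  have h2 : ((i + 1 + (j + 1) : ℕ) : ZMod p) = 0 := by
    have : e p i + e p j = 0 := by rw [h]; simp
    simpa [e] using this
  exact cast_ne hn (by omega) (by omega) h2

theorem half_set (hn : p = 2 * n + 1) : univ.erase (0 : ZMod p) = (univ.image (e p : Fin n → ZMod p)) ∪ (univ.image (fun i : Fin n => - e p i)) := by
  symm
  apply Finset.eq_of_subset_of_card_le
  · intro c hc
    simp only [mem_union, mem_image, mem_univ, true_and] at hc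
    rcases hc with ⟨i, rfl⟩ | ⟨i, rfl⟩
    · simp [e_ne hn]
    · simp [e_ne hn]
  · rw [card_union_of_disjoint, card_image_of_injective _ (e_inj hn), card_image_of_injective _ (show Function.Injective (fun i : Fin n => - e p i) from neg_injective.comp (e_inj hn))]
    · simp [ZMod.card]; omega
    · rw [Finset.disjoint_left]
      intro c hc hc'
      simp only [mem_image, mem_univ, true_and] at hc hc'
      obtain ⟨i, rfl⟩ := hc
      obtain ⟨j, hj⟩ := hc'
      exact e_ne_neg hn _ _ hj.symm

theorem half_prod {M : Type*} [CommMonoid M] (hn : p = 2 * n + 1) (f : ZMod p → M) :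
    ∏ c ∈ univ.erase (0 : ZMod p), f c = (∏ i : Fin n, f (e p i)) * ∏ i : Fin n, f (- e p i) := by
  rw [half_set hn, prod_union, prod_image, prod_image]
  · intro a _ b _ h; exact e_inj hn (neg_injective h)
  · intro a _ b _ h; exact e_inj hn h
  · rw [Finset.disjoint_left]
    intro c hc hc'
    simp only [mem_image, mem_univ, true_and] at hc hc'
    obtain ⟨i, rfl⟩ := hc
    obtain ⟨j, hj⟩ := hc'
    exact e_ne_neg hn _ _ hj.symm

theorem half_sum {M : Type*} [AddCommMonoid M] (hn : p = 2 * n + 1) (f : ZMod p → M) :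
    ∑ c ∈ univ.erase (0 : ZMod p), f c = (∑ i : Fin n, f (e p i)) + ∑ i : Fin n, f (- e p i) := by
  rw [half_set hn, sum_union, sum_image, sum_image]
  · intro a _ b _ h; exact e_inj hn (neg_injective h)
  · intro a _ b _ h; exact e_inj hn h
  · rw [Finset.disjoint_left]
    intro c hc hc'
    simp only [mem_image, mem_univ, true_and] at hc hc'
    obtain ⟨i, rfl⟩ := hc
    obtain ⟨j, hj⟩ := hc'
    exact e_ne_neg hn _ _ hj.symm
end half

end S3

open Complex Matrix BigOperators Finset

namespace S3

set_option linter.unusedSectionVars false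
variable {p : ℕ} [hpF : Fact p.Prime]

section euler
open Polynomial

/-- Euler operator -/
noncomputable def Dop {R : Type*} [CommRing R] (f : R[X]) : R[X] := X * derivative f

theorem Dop_iter_pow {R : Type*} [CommRing R] (m : ℕ) : ∀ Q : R[X],
    (Dop^[m] ((X - 1) ^ m * Q)).eval 1 = (m.factorial : R) * Q.eval 1 := by
  induction m with
  | zero => intro Q; simp
  | succ m ih =>
    intro Q
    rw [Function.iterate_succ_apply]
    have : Dop ((X - 1) ^ (m + 1) * Q) = (X - 1) ^ m * (X * (((m : R[X]) + 1) * Q + (X - 1) * derivative Q)) := by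
      simp only [Dop, derivative_mul, derivative_pow, derivative_sub, derivative_X, derivative_one]
      simp only [Nat.cast_add, Nat.cast_one, C_add, C_eq_natCast, C_1, Nat.add_sub_cancel]
      ring
    rw [this, ih]
    simp [Nat.factorial_succ]
    ring

theorem Dop_iter_sum {R : Type*} [CommRing R] (s : Finset ℕ) (m : ℕ) : ∀ a : ℕ → R,
    Dop^[m] (∑ j ∈ s, C (a j) * X ^ j) = ∑ j ∈ s, C (a j * (j : R) ^ m) * X ^ j := by
  induction m with
  | zero => intro a; simp
  | succ m ih =>
    intro a
    rw [Function.iterate_succ_apply]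
    have : Dop (∑ j ∈ s, C (a j) * X ^ j) = ∑ j ∈ s, C (a j * j) * X ^ j := by
      simp only [Dop, derivative_sum, mul_sum]
      apply sum_congr rfl
      intro j _
      rcases j with _ | j
      · simp
      · simp only [derivative_C_mul, derivative_X_pow, C_mul, Nat.add_sub_cancel]
        ring
    rw [this, ih]
    apply sum_congr rfl
    intro j _
    rw [pow_succ]; ring_nf

theorem Dop_sub {R : Type*} [CommRing R] (f g : R[X]) : Dop (f - g) = Dop f - Dop g := by
  simp [Dop, mul_sub]

theorem Dop_iter_sub {R : Type*} [CommRing R] (m : ℕ) : ∀ f g : R[X],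
    Dop^[m] (f - g) = Dop^[m] f - Dop^[m] g := by
  induction m with
  | zero => intro f g; rfl
  | succ m ih => intro f g; simp only [Function.iterate_succ_apply, Dop_sub, ih]

end euler

section
variable {n : ℕ}

theorem L_eq (hp4 : p % 4 = 1) (hn : p = 2 * n + 1) : legendreSym p 2 = (-1) ^ (n / 2) := by
  rw [legendreSym.at_two (p_ne_two hp4), ZMod.χ₈_nat_eq_if_mod_eight, if_neg (by omega)]
  split_ifs with h
  · rw [Even.neg_one_pow]; rw [Nat.even_iff]; omega
  · rw [Odd.neg_one_pow]; rw [Nat.odd_iff]; omega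

theorem fact_sq (hp4 : p % 4 = 1) (hn : p = 2 * n + 1) : ((n.factorial : ZMod p)) ^ 2 = -1 := by
  have hw := ZMod.wilsons_lemma p
  rw [show p - 1 = n + n by omega, ← Nat.factorial_mul_ascFactorial, Nat.ascFactorial_eq_prod_range] at hw
  push_cast at hw
  have : ∏ i ∈ range n, ((n : ZMod p) + 1 + i) = n.factorial := by
    rw [← prod_range_reflect, ← prod_range_add_one_eq_factorial]
    push_cast
    have h2 : ∀ i ∈ range n, ((n : ZMod p) + 1 + ((n - 1 - i : ℕ) : ZMod p)) = -1 * ((i : ZMod p) + 1) := by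
      intro i hi
      have hi' := mem_range.1 hi
      have h3 : ((n + 1 + (n - 1 - i) + (i + 1) : ℕ) : ZMod p) = 0 := by
        rw [show n + 1 + (n - 1 - i) + (i + 1) = p by omega]; simp
      push_cast at h3 ⊢
      linear_combination h3
    rw [prod_congr rfl h2, prod_mul_distrib]
    simp only [prod_const, card_range]
    rw [Even.neg_one_pow (by rw [Nat.even_iff]; omega), one_mul]
  rw [this] at hw
  rw [sq]; exact hw

theorem two_pow (hn : p = 2 * n + 1) : ((legendreSym p 2 : ℤ) : ZMod p) = 2 ^ n := by
  rw [legendreSym.eq_pow, show p / 2 = n by omega]; simp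

/-- signs agreeing mod p agree -/
theorem sign_eq (hp4 : p % 4 = 1) {a b : ℤ} (ha : a = 1 ∨ a = -1) (hb : b = 1 ∨ b = -1)
    (h : (a : ZMod p) = b) : a = b := by
  have h2 := two_ne hp4
  have key : (1 : ZMod p) ≠ -1 := by
    intro h; apply h2; linear_combination h
  rcases ha with rfl | rfl <;> rcases hb with rfl | rfl <;> simp_all

theorem leg_fact (hp4 : p % 4 = 1) (hn : p = 2 * n + 1) :
    legendreSym p (n.factorial : ℤ) = legendreSym p 2 := by
  have h1 := fact_sq hp4 hn
  have hne : ((n.factorial : ℤ) : ZMod p) ≠ 0 := by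
    intro h
    push_cast at h
    rw [h] at h1
    have : (1 : ZMod p) = 0 := by linear_combination h1
    exact one_ne_zero this
  apply sign_eq hp4 (legendreSym.eq_one_or_neg_one p hne)
    (legendreSym.eq_one_or_neg_one p (by exact_mod_cast two_ne hp4))
  rw [legendreSym.eq_pow, show p / 2 = 2 * (n / 2) by omega, pow_mul]
  push_cast
  rw [h1, L_eq hp4 hn]; push_cast; rfl

theorem prod_e (n : ℕ) : ∏ i : Fin n, (e p i) = (n.factorial : ZMod p) := by
  rw [← prod_range_add_one_eq_factorial]
  push_cast
  rw [← Fin.prod_univ_eq_prod_range (fun i => (i : ZMod p) + 1)]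
  simp [e]

theorem prod_chi_e (hp4 : p % 4 = 1) (hn : p = 2 * n + 1) :
    ∏ i : Fin n, chi p (e p i) = (legendreSym p 2 : ℂ) := by
  rw [← map_prod, prod_e, ← leg_fact hp4 hn, ← chi_leg]; simp

/-- sine product -/
noncomputable def del (p n : ℕ) [Fact p.Prime] : ℂ := ∏ i : Fin n, (psi p (e p i) - psi p (- e p i))

theorem psi_neg_mul (c : ZMod p) : psi p c * psi p (-c) = 1 := by
  rw [← AddChar.map_add_eq_mul]; simp

theorem prod_scale (f : ZMod p → ℂ) {a : ZMod p} (ha : a ≠ 0) :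
    ∏ c ∈ univ.erase (0 : ZMod p), f (a * c) = ∏ c ∈ univ.erase (0 : ZMod p), f c := by
  refine Finset.prod_nbij' (fun c => a * c) (fun c => a⁻¹ * c) ?_ ?_ ?_ ?_ ?_
  · intro c hc; simp_all
  · intro c hc; simp_all
  · intro c hc; simp [ha]
  · intro c hc; simp [ha]
  · intro c hc; simp

theorem del_sq (hp4 : p % 4 = 1) (hn : p = 2 * n + 1) : del p n ^ 2 = p := by
  rw [← prod_one_sub (p := p), ← prod_scale _ (two_ne hp4), half_prod hn, ← prod_mul_distrib, del, ← prod_pow]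
  have : ∀ i ∈ (univ : Finset (Fin n)), (1 - psi p (2 * e p i)) * (1 - psi p (2 * - e p i)) = -1 * (psi p (e p i) - psi p (- e p i)) ^ 2 := by
    intro i _
    rw [two_mul, two_mul, AddChar.map_add_eq_mul, AddChar.map_add_eq_mul]
    have := psi_neg_mul (e p i)
    linear_combination (psi p (e p i) * psi p (-e p i) - 1) * this
  rw [prod_congr rfl this, prod_mul_distrib]
  simp only [prod_const, card_univ, Fintype.card_fin]
  rw [Even.neg_one_pow (by rw [Nat.even_iff]; omega), one_mul]

theorem psi_e_exp (i : Fin n) : psi p (e p i) = Complex.exp ((2 * Real.pi * (i + 1) / p : ℝ) * Complex.I) := by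
  rw [e, psi_nat, psi_one, ← Complex.exp_nat_mul]
  congr 1
  push_cast; ring

theorem psi_neg_e_exp (i : Fin n) : psi p (- e p i) = Complex.exp (-(2 * Real.pi * (i + 1) / p : ℝ) * Complex.I) := by
  rw [AddChar.map_neg_eq_inv, psi_e_exp, ← Complex.exp_neg]
  congr 1; ring

theorem del_val (hp4 : p % 4 = 1) (hn : p = 2 * n + 1) : (legendreSym p 2 : ℂ) * del p n = ((Real.sqrt p : ℝ) : ℂ) := by
  have h1 : del p n = (2 * Complex.I) ^ n * ((∏ i : Fin n, Real.sin (2 * Real.pi * (i + 1) / p) : ℝ) : ℂ) := by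
    have h2 : (2 * Complex.I) ^ n = ∏ i : Fin n, (2 * Complex.I) := by simp
    rw [h2, Complex.ofReal_prod, ← prod_mul_distrib, del]
    apply prod_congr rfl
    intro i _
    rw [psi_e_exp, psi_neg_e_exp, Complex.ofReal_sin, Complex.sin]
    field_simp
    ring_nf
    simp only [Complex.I_sq]
    ring
  have hpos : 0 < ∏ i : Fin n, Real.sin (2 * Real.pi * (i + 1) / p) := by
    apply prod_pos
    intro i _
    have hp0 : (0 : ℝ) < p := by exact_mod_cast hpF.out.pos
    apply Real.sin_pos_of_pos_of_lt_pi
    · positivity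
    · rw [div_lt_iff₀ hp0]
      have : ((2 * ((i : ℕ) + 1) : ℕ) : ℝ) < (p : ℝ) := by exact_mod_cast (by omega)
      push_cast at this
      nlinarith [Real.pi_pos]
  have hI : (2 * Complex.I) ^ n = (legendreSym p 2 : ℂ) * (2 ^ n : ℝ) := by
    rw [L_eq hp4 hn]
    have : n = 2 * (n / 2) := by omega
    rw [mul_pow, mul_comm]
    congr 1
    · conv_lhs => rw [this, pow_mul, Complex.I_sq]
      push_cast; rfl
    · push_cast; rfl
  have hL2 : (legendreSym p 2 : ℂ) ^ 2 = 1 := by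
    rw [← chi_leg]; exact chi_sq (by exact_mod_cast two_ne hp4)
  set s := ∏ i : Fin n, Real.sin (2 * Real.pi * (i + 1) / p) with hs
  have h3 : (legendreSym p 2 : ℂ) * del p n = ((2 ^ n * s : ℝ) : ℂ) := by
    rw [h1, hI]; push_cast
    linear_combination (2 ^ n * (s : ℂ)) * hL2
  rw [h3]
  congr 1
  symm
  rw [Real.sqrt_eq_iff_mul_self_eq (by positivity) (by positivity)]
  have h4 := del_sq hp4 hn
  have h5 : ((2 ^ n * s : ℝ) : ℂ) ^ 2 = p := by rw [← h3, mul_pow, hL2, h4, one_mul]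
  rw [← sq]
  exact_mod_cast h5.symm

end
end S3

open Complex Matrix BigOperators Finset

namespace S3

set_option linter.unusedSectionVars false
variable {p : ℕ} [hpF : Fact p.Prime] {n : ℕ}

theorem chi_ne_one (hp4 : p % 4 = 1) : chi p ≠ 1 := by
  have h := quadraticChar_ne_one (F := ZMod p) (by rw [ZMod.ringChar_zmod_n]; exact p_ne_two hp4)
  intro h1
  apply h
  ext a
  have := congrArg (fun f : MulChar (ZMod p) ℂ => f a) h1
  simp only [chi, MulChar.ringHomComp_apply, MulChar.one_apply_coe, eq_intCast] at this ⊢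
  exact_mod_cast this

theorem gauss_sq (hp4 : p % 4 = 1) : gaussSum (chi p) (psi p) ^ 2 = p := by
  rw [gaussSum_sq (χ := chi p) (chi_ne_one hp4) chi_quad psi_prim, chi_neg_one hp4, ZMod.card]; simp

section
open Polynomial

theorem X_pow_sub_factor {R : Type*} [CommRing R] (k m : ℕ) :
    (X : R[X]) ^ k - X ^ m = (X - 1) * ((∑ i ∈ range k, X ^ i) - ∑ i ∈ range m, X ^ i) := by
  rw [mul_sub, mul_geom_sum, mul_geom_sum]; ring

/-- the comparison polynomial -/
noncomputable def cmpP (p n : ℕ) [Fact p.Prime] (ε : ℤ) : ℤ[X] :=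
  (∑ j ∈ range p, C (legendreSym p j) * X ^ j) -
    C (ε * legendreSym p 2) * ∏ i : Fin n, (X ^ ((i : ℕ) + 1) - X ^ (p - ((i : ℕ) + 1)))

theorem gauss_sign (hp4 : p % 4 = 1) (hn : p = 2 * n + 1) :
    gaussSum (chi p) (psi p) = (legendreSym p 2 : ℂ) * del p n := by
  have hL2 : (legendreSym p 2 : ℂ) ^ 2 = 1 := by
    rw [← chi_leg]; exact chi_sq (by exact_mod_cast two_ne hp4)
  have hsq : gaussSum (chi p) (psi p) ^ 2 = ((legendreSym p 2 : ℂ) * del p n) ^ 2 := by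
    rw [gauss_sq hp4, mul_pow, hL2, del_sq hp4 hn, one_mul]
  have hε : ∃ ε : ℤ, (ε = 1 ∨ ε = -1) ∧ gaussSum (chi p) (psi p) = ε * ((legendreSym p 2 : ℂ) * del p n) := by
    rcases sq_eq_sq_iff_eq_or_eq_neg.1 hsq with h | h
    · exact ⟨1, Or.inl rfl, by simpa using h⟩
    · exact ⟨-1, Or.inr rfl, by simpa using h⟩
  obtain ⟨ε, hε1, hε⟩ := hε
  suffices ε = 1 by rw [hε, this]; simp
  have hroot : aeval (psi p 1) (cmpP p n ε) = 0 := by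
    have h1 : gaussSum (chi p) (psi p) = ∑ j ∈ range p, (legendreSym p j : ℂ) * psi p 1 ^ j := by
      rw [gaussSum, sum_zmod]
      apply sum_congr rfl
      intro j _
      rw [psi_nat, ← chi_leg]; simp
    have h2 : del p n = ∏ i : Fin n, (psi p 1 ^ ((i : ℕ) + 1) - psi p 1 ^ (p - ((i : ℕ) + 1))) := by
      rw [del]
      apply prod_congr rfl
      intro i _
      rw [← psi_nat, ← psi_nat, Nat.cast_sub (by omega)]
      simp [e]
    rw [h1, h2] at hε
    simp only [cmpP, map_sub, map_sum, map_mul, map_prod, map_pow, aeval_X, eq_intCast, map_intCast]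
    rw [hε]; push_cast; ring
  have hdvd : cyclotomic p ℤ ∣ cmpP p n ε := by
    rw [cyclotomic_eq_minpoly psi_one_prim hpF.out.pos]
    exact minpoly.isIntegrallyClosed_dvd (psi_one_prim.isIntegral hpF.out.pos) hroot
  have hdvd2 := Polynomial.map_dvd (Int.castRingHom (ZMod p)) hdvd
  rw [map_cyclotomic] at hdvd2
  have hcyc : (X - 1 : (ZMod p)[X]) ^ (n + 1) ∣ cyclotomic p (ZMod p) := by
    have h1 := cyclotomic_prime_mul_X_sub_one (ZMod p) p
    have h2 : (X ^ p - 1 : (ZMod p)[X]) = (X - 1) ^ p := by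
      rw [sub_pow_char]; simp
    have h4 : (X - 1 : (ZMod p)[X]) ^ p = (X - 1) ^ (p - 1) * (X - 1) := by
      rw [← pow_succ, show p - 1 + 1 = p by omega]
    rw [h2, h4] at h1
    have hne : (X - 1 : (ZMod p)[X]) ≠ 0 := by simpa using X_sub_C_ne_zero (1 : ZMod p)
    have h3 := mul_right_cancel₀ hne h1
    rw [h3]
    apply pow_dvd_pow
    have := hpF.out.two_le
    omega
  obtain ⟨Q, hQ⟩ := hcyc.trans hdvd2
  have hmap : (cmpP p n ε).map (Int.castRingHom (ZMod p)) =
      (∑ j ∈ range p, C ((j : ZMod p) ^ n) * X ^ j) -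
        (X - 1) ^ n * (C ((ε : ZMod p) * 2 ^ n) * ∏ i : Fin n, ((∑ k ∈ range ((i : ℕ) + 1), X ^ k) - ∑ k ∈ range (p - ((i : ℕ) + 1)), X ^ k)) := by
    have h1 : ((X - 1 : (ZMod p)[X]) ^ n) = ∏ i : Fin n, (X - 1) := by simp
    rw [h1, mul_left_comm, ← prod_mul_distrib]
    simp only [← X_pow_sub_factor, cmpP, Polynomial.map_sub, Polynomial.map_sum, Polynomial.map_mul,
      Polynomial.map_prod, Polynomial.map_pow, map_X, map_C]
    congr 1
    · apply sum_congr rfl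
      intro j _
      simp only [eq_intCast, legendreSym.eq_pow, show p / 2 = n by omega, Int.cast_natCast]
    · congr 2
      rw [← two_pow hn]; simp
  rw [hmap, pow_succ, mul_assoc] at hQ
  have hE := congrArg (fun f => (Dop^[n] f).eval 1) hQ
  simp only [Dop_iter_sub, eval_sub, Dop_iter_pow, Dop_iter_sum] at hE
  simp only [eval_finsetSum, eval_mul, eval_C, eval_pow, eval_X, one_pow, mul_one, eval_prod, eval_sub,
    eval_one, sub_self, zero_mul, mul_zero, sum_const, card_range, nsmul_eq_mul] at hE
  have hs : ∑ j ∈ range p, (j : ZMod p) ^ n * (j : ZMod p) ^ n = -1 := by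
    rw [← sum_zmod (fun c : ZMod p => c ^ n * c ^ n), ← Finset.add_sum_erase _ _ (mem_univ 0)]
    have h0 : n ≠ 0 := by
      have := hpF.out.two_le
      omega
    have h1 : ∀ c ∈ univ.erase (0 : ZMod p), c ^ n * c ^ n = 1 := by
      intro c hc
      rw [← pow_add, show n + n = p - 1 by omega, ZMod.pow_card_sub_one_eq_one (by simpa using hc)]
    rw [sum_congr rfl h1, sum_const, card_erase_of_mem (mem_univ _), card_univ, ZMod.card]
    have : ((p - 1 + 1 : ℕ) : ZMod p) = 0 := by rw [show p - 1 + 1 = p by omega]; simp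
    push_cast at this
    simp only [nsmul_eq_mul, mul_one]
    simp [h0]
    linear_combination this
  have hprod : ∏ i : Fin n, ((((i : ℕ) + 1 : ℕ) : ZMod p) - ((p - ((i : ℕ) + 1) : ℕ) : ZMod p)) = 2 ^ n * n.factorial := by
    rw [← prod_e, show (2 : ZMod p) ^ n = ∏ i : Fin n, 2 by simp, ← prod_mul_distrib]
    apply prod_congr rfl
    intro i _
    rw [Nat.cast_sub (by omega), e]; simp; ring
  rw [hs, hprod] at hE
  have h22 : (2 ^ n : ZMod p) * 2 ^ n = 1 := by
    rw [← pow_add, show n + n = p - 1 by omega, ZMod.pow_card_sub_one_eq_one (two_ne hp4)]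
  have hf := fact_sq hp4 hn
  apply sign_eq hp4 hε1 (Or.inl rfl)
  push_cast
  linear_combination hE + (ε : ZMod p) * (n.factorial : ZMod p) ^ 2 * h22 + (ε : ZMod p) * hf
end

theorem gauss_val (hp4 : p % 4 = 1) (hn : p = 2 * n + 1) :
    gaussSum (chi p) (psi p) = ((Real.sqrt p : ℝ) : ℂ) := by
  rw [gauss_sign hp4 hn, del_val hp4 hn]

end S3

open Complex Matrix BigOperators Finset

namespace S3

set_option linter.unusedSectionVars false
variable {p : ℕ} [hpF : Fact p.Prime] {n : ℕ}

theorem gchi (hp4 : p % 4 = 1) (m : ZMod p) :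
    gaussSum (chi p) (psi p) * chi p m = ∑ c ∈ univ.erase (0 : ZMod p), chi p (2 * c) * psi p (-(2 * c * m)) := by
  have h0 : ∑ c ∈ univ.erase (0 : ZMod p), chi p (2 * c) * psi p (-(2 * c * m)) =
      ∑ c : ZMod p, chi p (2 * c) * psi p (-(2 * c * m)) := by
    rw [← Finset.add_sum_erase _ _ (mem_univ (0 : ZMod p)), mul_zero, MulChar.map_zero, zero_mul, zero_add]
  have h1 : ∑ c : ZMod p, chi p (2 * c) * psi p (-(2 * c * m)) = ∑ c : ZMod p, chi p c * psi p (c * m) := by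
    have h2 : (-2 : ZMod p) ≠ 0 := neg_ne_zero.2 (two_ne hp4)
    rw [← Equiv.sum_comp (Equiv.mulLeft₀ (-2 : ZMod p) h2) (fun c => chi p c * psi p (c * m))]
    apply sum_congr rfl
    intro c _
    simp only [Equiv.mulLeft₀_apply]
    rw [show (-2 : ZMod p) * c = -(2 * c) by ring, chi_neg hp4, neg_mul]
  rw [h0, h1]
  by_cases hm : m = 0
  · subst hm
    simp only [mul_zero, AddChar.map_zero_eq_one, mul_one, MulChar.map_zero]
    exact (MulChar.sum_eq_zero_of_ne_one (chi_ne_one hp4)).symm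
  · have h3 := gaussSum_mulShift (chi p) (psi p) (Units.mk0 m hm)
    simp only [Units.val_mk0] at h3
    have h4 : gaussSum (chi p) ((psi p).mulShift m) = ∑ c : ZMod p, chi p c * psi p (c * m) := by
      simp only [gaussSum, AddChar.mulShift_apply, mul_comm m]
    rw [← h4, ← h3]
    have := chi_sq hm
    linear_combination (gaussSum (chi p) ((psi p).mulShift m)) * this

section
open Polynomial

/-- product over all other signed roots -/
noncomputable def q (a : ZMod p) : ℂ[X] := ∏ c ∈ (univ.erase 0).erase a, (X - C (om p c))

/-- the full product -/
noncomputable def G (p : ℕ) [Fact p.Prime] (z : ℂ) : ℂ := ∏ c ∈ univ.erase (0 : ZMod p), (z - om p c)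

theorem q_natDegree (hn : p = 2 * n + 1) {a : ZMod p} (ha : a ≠ 0) : (q a).natDegree < 2 * n := by
  rw [q, natDegree_prod_of_monic _ _ (fun c _ => monic_X_sub_C _)]
  simp only [natDegree_X_sub_C, sum_const, smul_eq_mul, mul_one]
  rw [card_erase_of_mem (by simp [ha]), card_erase_of_mem (mem_univ _), card_univ, ZMod.card]
  have := hpF.out.two_le
  omega

theorem q_mul {a : ZMod p} (ha : a ≠ 0) (z : ℂ) : (z - om p a) * (q a).eval z = G p z := by
  rw [q, G, ← Finset.mul_prod_erase (univ.erase (0 : ZMod p)) _ (show a ∈ univ.erase (0 : ZMod p) by simp [ha])]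
  simp [eval_prod]

theorem q_zero {a c : ZMod p} (hc : c ≠ 0) (hac : c ≠ a) : (q a).eval (om p c) = 0 := by
  rw [q, eval_prod]
  apply prod_eq_zero (i := c) (by simp [hc, hac])
  simp

theorem sum_range_two {M : Type*} [AddCommMonoid M] (f : ℕ → M) (n : ℕ) :
    ∑ k ∈ range (2 * n), f k = ∑ k : Fin n, (f (2 * k) + f (2 * k + 1)) := by
  rw [Fin.sum_univ_eq_sum_range (fun k => f (2 * k) + f (2 * k + 1))]
  induction n with
  | zero => simp
  | succ n ih => rw [show 2 * (n + 1) = 2 * n + 1 + 1 by ring, sum_range_succ, sum_range_succ, ih, sum_range_succ, add_assoc]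

theorem eval_split {f : ℂ[X]} (hf : f.natDegree < 2 * n) (z : ℂ) :
    f.eval z = (∑ k : Fin n, f.coeff (2 * k) * (z ^ 2) ^ (k : ℕ)) + ∑ k : Fin n, f.coeff (2 * k + 1) * z ^ (2 * (k : ℕ) + 1) := by
  rw [eval_eq_sum_range' hf, sum_range_two, sum_add_distrib]
  simp only [pow_mul]

theorem sum_even {f : ℂ[X]} (hf : f.natDegree < 2 * n) :
    ∑ k : Fin n, f.coeff (2 * k) = (f.eval 1 + f.eval (-1)) / 2 := by
  rw [eval_split hf, eval_split hf]
  have : ∀ k : ℕ, (-1 : ℂ) ^ (2 * k + 1) = -1 := fun k => Odd.neg_one_pow ⟨k, rfl⟩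
  simp [this]; ring

theorem sum_odd {f : ℂ[X]} (hf : f.natDegree < 2 * n) :
    ∑ k : Fin n, f.coeff (2 * k + 1) = (f.eval 1 - f.eval (-1)) / 2 := by
  rw [eval_split hf, eval_split hf]
  have : ∀ k : ℕ, (-1 : ℂ) ^ (2 * k + 1) = -1 := fun k => Odd.neg_one_pow ⟨k, rfl⟩
  simp [this]

theorem eval_even {f : ℂ[X]} (hf : f.natDegree < 2 * n) (z : ℂ) :
    ∑ k : Fin n, f.coeff (2 * k) * (z ^ 2) ^ (k : ℕ) = (f.eval z + f.eval (-z)) / 2 := by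
  rw [eval_split hf z, eval_split hf (-z)]
  have : ∀ k : ℕ, (-z) ^ (2 * k + 1) = - z ^ (2 * k + 1) := fun k => Odd.neg_pow ⟨k, rfl⟩ z
  simp [this]; ring

theorem om_pow (hp4 : p % 4 = 1) {c : ZMod p} (hc : c ≠ 0) (k : ℕ) :
    om p c ^ (2 * k + 1) = chi p (2 * c) * psi p (c * (2 * k + 1)) := by
  rw [pow_succ, pow_mul, om_sq hp4 hc, psi_pow, om, mul_left_comm, ← AddChar.map_add_eq_mul]
  congr 2; ring

theorem key1 (hp4 : p % 4 = 1) (hn : p = 2 * n + 1) {a : ZMod p} (ha : a ≠ 0) (j : Fin n) :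
    gaussSum (chi p) (psi p) * ∑ k : Fin n, chi p ((j : ℕ) - (k : ℕ) + 1) * (q a).coeff (2 * k)
      = chi p (2 * a) * (q a).eval (om p a) * psi p (-(2 * a)) * (psi p (-(2 * a))) ^ (j : ℕ)
        + ∑ k : Fin n, (q a).coeff (2 * k + 1) := by
  have hd := q_natDegree hn ha
  have h1 : gaussSum (chi p) (psi p) * ∑ k : Fin n, chi p ((j : ℕ) - (k : ℕ) + 1) * (q a).coeff (2 * k)
      = ∑ c ∈ univ.erase (0 : ZMod p), chi p (2 * c) * psi p (-(2 * c * ((j : ℕ) + 1))) *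
        ∑ k : Fin n, (q a).coeff (2 * k) * (om p c ^ 2) ^ (k : ℕ) := by
    simp only [mul_sum]
    rw [sum_comm]
    apply sum_congr rfl
    intro k _
    rw [← mul_assoc, gchi hp4, sum_mul]
    apply sum_congr rfl
    intro c hc
    rw [om_sq hp4 (by simpa using hc), psi_pow]
    rw [show -(2 * c * ((j : ℕ) - (k : ℕ) + 1 : ZMod p)) = -(2 * c * ((j : ℕ) + 1)) + 2 * c * (k : ℕ) by ring,
      AddChar.map_add_eq_mul]
    ring
  rw [h1]
  have h2 : ∀ c ∈ univ.erase (0 : ZMod p), chi p (2 * c) * psi p (-(2 * c * ((j : ℕ) + 1))) *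
        ∑ k : Fin n, (q a).coeff (2 * k) * (om p c ^ 2) ^ (k : ℕ)
      = chi p (2 * c) * psi p (-(2 * c * ((j : ℕ) + 1))) * (q a).eval (om p c) -
        ∑ k : Fin n, (q a).coeff (2 * k + 1) * psi p (c * (2 * (k : ℕ) + 1 - 2 * ((j : ℕ) + 1))) := by
    intro c hc
    have hc' : c ≠ 0 := by simpa using hc
    rw [eval_split hd (om p c), mul_add (chi p (2 * c) * psi p _), add_sub_assoc, left_eq_add, sub_eq_zero, mul_sum]
    apply sum_congr rfl
    intro k _
    rw [om_pow hp4 hc', show c * (2 * (k : ℕ) + 1 - 2 * ((j : ℕ) + 1) : ZMod p) = -(2 * c * ((j : ℕ) + 1)) + c * (2 * (k : ℕ) + 1) by ring,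
      AddChar.map_add_eq_mul]
    have := chi_sq (mul_ne_zero (two_ne hp4) hc')
    linear_combination (psi p (-(2 * c * ((j : ℕ) + 1))) * (q a).coeff (2 * k + 1) * psi p (c * (2 * (k : ℕ) + 1))) * this
  rw [sum_congr rfl h2, sum_sub_distrib, sum_comm (s := univ.erase (0 : ZMod p))]
  have h3 : ∀ k : Fin n, ∑ c ∈ univ.erase (0 : ZMod p), (q a).coeff (2 * k + 1) * psi p (c * (2 * (k : ℕ) + 1 - 2 * ((j : ℕ) + 1)))
      = - (q a).coeff (2 * k + 1) := by
    intro k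
    rw [← mul_sum, sum_psi, mul_neg_one]
    have h4 : (2 * (k : ℕ) + 1 - 2 * ((j : ℕ) + 1) : ZMod p) = ((2 * (k : ℤ) + 1 - 2 * ((j : ℤ) + 1) : ℤ) : ZMod p) := by
      push_cast; rfl
    rw [h4]
    intro h5
    have h6 := (ZMod.intCast_zmod_eq_zero_iff_dvd _ p).1 h5
    have h7 := Int.eq_zero_of_abs_lt_dvd h6 (by rw [abs_lt]; omega)
    omega
  rw [sum_congr rfl (fun k _ => h3 k), sum_eq_single_of_mem a (by simp [ha])]
  · rw [psi_pow, mul_assoc _ (psi p _) (psi p _), ← AddChar.map_add_eq_mul, sum_neg_distrib, sub_neg_eq_add]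
    congr 1
    rw [show -(2 * a) + -(2 * a) * ((j : ℕ) : ZMod p) = -(2 * a * ((j : ℕ) + 1)) by ring]
    ring
  · intro c hc hca
    rw [q_zero (by simpa using hc) hca, mul_zero]

theorem prod_psi_sub (a : ZMod p) (hp4 : p % 4 = 1) :
    ∏ c ∈ univ.erase a, (psi p (2 * a) - psi p (2 * c)) = p * psi p (-(2 * a)) := by
  have h1 : ∏ c ∈ univ.erase a, (psi p (2 * a) - psi p (2 * c)) =
      ∏ d ∈ univ.erase (0 : ZMod p), (psi p (2 * a) * (1 - psi p (2 * d))) := by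
    refine Finset.prod_nbij' (fun c => c - a) (fun d => d + a) ?_ ?_ ?_ ?_ ?_
    · intro c hc; simp_all [sub_eq_zero]
    · intro c hc; simp_all
    · intro c hc; simp
    · intro c hc; simp
    · intro c hc
      rw [mul_sub, ← AddChar.map_add_eq_mul]
      ring_nf
  rw [h1, prod_mul_distrib, prod_scale (fun c => 1 - psi p c) (two_ne hp4), prod_one_sub, prod_const,
    card_erase_of_mem (mem_univ _), card_univ, ZMod.card, psi_pow, mul_comm]
  congr 2
  rw [Nat.cast_sub hpF.out.one_le]; simp

theorem G_neg (hp4 : p % 4 = 1) (z : ℂ) : G p (-z) = ∏ c ∈ univ.erase (0 : ZMod p), (z + om p c) := by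
  have h : ∀ c ∈ univ.erase (0 : ZMod p), (-z - om p c) = -1 * (z + om p c) := by intros; ring
  rw [G, prod_congr rfl h, prod_mul_distrib, prod_const, card_erase_of_mem (mem_univ _), card_univ, ZMod.card,
    Even.neg_one_pow (by rw [Nat.even_iff]; omega), one_mul]

theorem q_self (hp4 : p % 4 = 1) {a : ZMod p} (ha : a ≠ 0) :
    (om p a ^ 2 - 1) * (q a).eval (om p a) * G p (- om p a) * om p a = 2 * p := by
  have hm : a ∈ univ.erase (0 : ZMod p) := by simp [ha]
  have hm0 : (0 : ZMod p) ∈ univ.erase a := by simp [ha.symm]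
  have h1 := prod_psi_sub a hp4
  rw [← Finset.mul_prod_erase _ _ hm0, Finset.erase_right_comm, mul_zero, AddChar.map_zero_eq_one] at h1
  have h2 : (q a).eval (om p a) * G p (- om p a) = 2 * om p a * ∏ c ∈ (univ.erase (0 : ZMod p)).erase a, (psi p (2 * a) - psi p (2 * c)) := by
    rw [G_neg hp4, ← Finset.mul_prod_erase _ _ hm, q, eval_prod, mul_left_comm, ← prod_mul_distrib, ← two_mul]
    congr 1
    apply prod_congr rfl
    intro c hc
    have hc' : c ≠ 0 := by simp at hc; exact hc.2
    rw [← om_sq hp4 ha, ← om_sq hp4 hc']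
    simp; ring
  have h3 : psi p (2 * a) * psi p (-(2 * a)) = 1 := psi_neg_mul _
  have h4 := om_sq hp4 ha
  rw [mul_assoc (om p a ^ 2 - 1), h2, h4]
  linear_combination (2 * om p a ^ 2) * h1 + 2 * p * h3 + 2 * p * psi p (-(2 * a)) * h4

theorem prod_om (hp4 : p % 4 = 1) (hn : p = 2 * n + 1) : ∏ c ∈ univ.erase (0 : ZMod p), om p c = 1 := by
  rw [half_prod hn, ← prod_mul_distrib]
  apply prod_eq_one
  intro i _
  exact om_mul_neg hp4 (e_ne hn i)

theorem prod_neg_idx (f : ZMod p → ℂ) :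
    ∏ c ∈ univ.erase (0 : ZMod p), f (-c) = ∏ c ∈ univ.erase (0 : ZMod p), f c := by
  refine Finset.prod_nbij' (fun c => -c) (fun c => -c) ?_ ?_ ?_ ?_ ?_ <;> simp

theorem G_recip (hp4 : p % 4 = 1) (hn : p = 2 * n + 1) {z y : ℂ} (hz : z * y = 1) :
    G p z = z ^ (2 * n) * G p y := by
  have hc : #(univ.erase (0 : ZMod p)) = 2 * n := by
    rw [card_erase_of_mem (mem_univ _), card_univ, ZMod.card]; omega
  have h1 : z ^ (2 * n) = ∏ c ∈ univ.erase (0 : ZMod p), z := by rw [prod_const, hc]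
  have h2 : (1 : ℂ) = ∏ c ∈ univ.erase (0 : ZMod p), (-1 : ℂ) := by
    rw [prod_const, hc, Even.neg_one_pow (by simp)]
  rw [h1, G, G, ← prod_mul_distrib, ← mul_one (∏ c ∈ univ.erase (0 : ZMod p), (z - om p c)), ← prod_om hp4 hn,
    ← prod_neg_idx (fun c => om p c), ← prod_mul_distrib, ← one_mul (∏ c ∈ univ.erase (0 : ZMod p), (z - om p c) * _), h2,
    ← prod_mul_distrib, ← prod_neg_idx]
  apply prod_congr rfl
  intro c hc
  have := om_mul_neg hp4 (c := c) (by simpa using hc)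
  rw [neg_neg]
  linear_combination this - hz

theorem om_pow_p (hp4 : p % 4 = 1) (hn : p = 2 * n + 1) {c : ZMod p} (hc : c ≠ 0) :
    om p c ^ (2 * n + 1) = chi p (2 * c) := by
  rw [om_pow hp4 hc]
  have : (2 * (n : ZMod p) + 1) = 0 := by
    have : ((2 * n + 1 : ℕ) : ZMod p) = 0 := by rw [← hn]; simp
    simpa using this
  rw [this]; simp

theorem Delta_eq (hp4 : p % 4 = 1) (hn : p = 2 * n + 1) {a : ZMod p} (ha : a ≠ 0) :
    chi p (2 * a) * (q a).eval (om p a) * psi p (-(2 * a)) * (1 - om p (-a) ^ 2) * G p (- om p (-a)) = 2 * p * om p (-a) ^ 4 := by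
  have h1 := q_self hp4 ha
  have h2 := om_mul_neg hp4 ha
  have h3 : G p (- om p a) = (om p a) ^ (2 * n) * G p (- om p (-a)) := by
    rw [G_recip hp4 hn (z := - om p a) (y := - om p (-a)) (by linear_combination h2), Even.neg_pow (by simp)]
  have h4 : psi p (-(2 * a)) = om p (-a) ^ 2 := by
    rw [om_sq hp4 (by simpa using ha)]; congr 1; ring
  rw [h3] at h1
  rw [h4, ← om_pow_p hp4 hn ha]
  have h5 : om p a ^ 2 * om p (-a) ^ 2 = 1 := by rw [← mul_pow, h2, one_pow]
  rw [pow_succ]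
  generalize om p a ^ (2 * n) = T at *
  generalize (q a).eval (om p a) = Q at *
  generalize G p (- om p (-a)) = R at *
  generalize om p a = w at *
  generalize om p (-a) = y at *
  linear_combination y ^ 4 * h1 - (T * Q * R * w * y ^ 2) * h5
end
end S3

open Complex Matrix BigOperators Finset

namespace S3

set_option linter.unusedSectionVars false

section
open Polynomial
variable {n : ℕ}

theorem lag (x : Fin n → ℂ) (hx : Function.Injective x) (f : ℂ[X]) (hf : f.degree < n) (z : ℂ)
    (hz : ∀ a, z ≠ x a) :
    f.eval z = (∏ c, (z - x c)) * ∑ a, f.eval (x a) / ((z - x a) * ∏ c ∈ univ.erase a, (x a - x c)) := by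
  have h1 := Lagrange.eq_interpolate (s := univ) (v := x) (f := f) hx.injOn (by simpa using hf)
  have h2 := Lagrange.eval_interpolate_not_at_node (s := univ) (v := x) (x := z) (fun a => f.eval (x a)) (fun a _ => hz a)
  rw [← h1, Lagrange.eval_nodal] at h2
  rw [h2]
  congr 1
  apply sum_congr rfl
  intro a _
  rw [Lagrange.nodalWeight, prod_inv_distrib, div_eq_mul_inv, mul_inv]
  ring

theorem pairprod_neg (u : Fin n → ℂ) :
    ∏ a, ∏ c ∈ univ.erase a, (u a - u c) = (-1) ^ (n * (n - 1) / 2) * (vandermonde u).det ^ 2 := by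
  rw [Matrix.det_vandermonde]
  have h1 : ∏ a, ∏ c ∈ univ.erase a, (u a - u c) = ∏ a, ∏ c ∈ Ioi a, ((u a - u c) * (u c - u a)) := by
    have := Finset.prod_prod_Ioi_mul_eq_prod_prod_off_diag (fun a c : Fin n => u c - u a)
    rw [this]
    apply prod_congr rfl
    intro a _
    apply prod_congr _ (fun _ _ => rfl)
    ext; simp
  have h2 : ∏ a : Fin n, ∏ c ∈ Ioi a, (-1 : ℂ) = (-1) ^ (n * (n - 1) / 2) := by
    simp only [prod_const, Fin.card_Ioi]
    rw [prod_pow_eq_pow_sum, ← Finset.sum_range_id, ← Finset.sum_range_reflect, Fin.sum_univ_eq_sum_range (fun i => n - 1 - i)]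
  rw [h1, ← h2, sq, ← prod_mul_distrib, ← prod_mul_distrib]
  apply prod_congr rfl
  intro a _
  rw [← prod_mul_distrib, ← prod_mul_distrib]
  apply prod_congr rfl
  intro c _
  ring

theorem pairprod_w (w : Fin n → ℂ) : ∏ a, ∏ c ∈ Ioi a, (w a * w c) = (∏ a, w a) ^ (n - 1) := by
  have h1 := Finset.prod_prod_Ioi_mul_eq_prod_prod_off_diag (fun _ c : Fin n => w c)
  rw [h1, ← prod_pow]
  apply prod_congr rfl
  intro a _
  simp [card_compl]

theorem cauchy (y w : Fin n → ℂ) (hyw : ∀ i, w i * y i = 1) (hw : Function.Injective w)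
    (h0 : ∀ i j, y i + w j ≠ 0) :
    (Matrix.of fun b a : Fin n => (y b + w a)⁻¹).det * ∏ b, ∏ c, (y b + w c) =
      (-1) ^ (n * (n - 1) / 2) * (vandermonde y).det ^ 2 * (∏ i, w i) ^ (n - 1) := by
  let P : Fin n → ℂ[X] := fun a => ∏ c ∈ univ.erase a, (X + C (w c))
  have hP : ∀ a, (P a).natDegree < n := by
    intro a
    have : 0 < n := a.pos
    simp only [P]
    rw [natDegree_prod_of_monic _ _ (fun c _ => monic_X_add_C _)]
    simp [card_erase_of_mem, this]
  let F : Matrix (Fin n) (Fin n) ℂ := Matrix.of fun k a => (P a).coeff k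
  have hV : ∀ v : Fin n → ℂ, vandermonde v * F = Matrix.of fun b a => (P a).eval (v b) := by
    intro v
    ext b a
    rw [Matrix.mul_apply, Matrix.of_apply, eval_eq_sum_range' (hP a), ← Fin.sum_univ_eq_sum_range (fun k => (P a).coeff k * v b ^ k)]
    apply sum_congr rfl
    intro k _
    simp [F, vandermonde_apply, mul_comm]
  have hev : ∀ a z, (P a).eval z = ∏ c ∈ univ.erase a, (z + w c) := by
    intro a z; simp [P, eval_prod]
  have h1 : (vandermonde y).det * F.det = (∏ b, ∏ c, (y b + w c)) * (Matrix.of fun b a : Fin n => (y b + w a)⁻¹).det := by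
    rw [← Matrix.det_mul, hV, ← Matrix.det_mul_column]
    congr 1
    ext b a
    simp only [Matrix.of_apply, hev]
    rw [← Finset.mul_prod_erase univ _ (mem_univ a)]
    field_simp [h0 b a]
  have h2 : (vandermonde (fun i => - w i)).det * F.det = (-1) ^ (n * (n - 1) / 2) * (vandermonde (fun i => - w i)).det ^ 2 := by
    rw [← Matrix.det_mul, hV, ← pairprod_neg]
    have : (Matrix.of fun b a => (P a).eval (- w b)) = Matrix.diagonal fun a => ∏ c ∈ univ.erase a, (- w a - - w c) := by
      ext b a
      by_cases hab : b = a
      · subst hab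
        simp [hev]
      · rw [Matrix.diagonal_apply_ne _ hab, Matrix.of_apply, hev]
        apply prod_eq_zero (i := b) (by simp [hab])
        simp
    rw [this, Matrix.det_diagonal]
  have h3 : (vandermonde (fun i => - w i)).det ≠ 0 := by
    rw [Matrix.det_vandermonde_ne_zero_iff]
    intro a b h
    exact hw (neg_injective h)
  have h4 : (vandermonde (fun i => - w i)).det = (vandermonde y).det * (∏ i, w i) ^ (n - 1) := by
    rw [← pairprod_w, Matrix.det_vandermonde, Matrix.det_vandermonde, ← prod_mul_distrib]
    apply prod_congr rfl
    intro a _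
    rw [← prod_mul_distrib]
    apply prod_congr rfl
    intro c _
    linear_combination w c * hyw a - w a * hyw c
  have h5 : F.det = (-1) ^ (n * (n - 1) / 2) * (vandermonde (fun i => - w i)).det := by
    apply mul_left_cancel₀ h3
    rw [h2]; ring
  rw [mul_comm, ← h1, h5, h4]; ring

theorem det_rank1 (D u κ : Fin n → ℂ) (hD : ∀ i, D i ≠ 0) :
    (Matrix.diagonal D + Matrix.of fun a i => u a * κ i).det = (∏ i, D i) * (1 + ∑ a, κ a * u a / D a) := by
  have h1 : Matrix.diagonal D + (Matrix.of fun a i => u a * κ i) =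
      Matrix.diagonal D * (1 + Matrix.replicateCol Unit (fun a => u a / D a) * Matrix.replicateRow Unit κ) := by
    rw [mul_add, mul_one]
    congr 1
    ext a i
    rw [Matrix.diagonal_mul, Matrix.mul_apply]
    simp
    field_simp [hD a]
  rw [h1, Matrix.det_mul, Matrix.det_diagonal, Matrix.det_one_add_replicateCol_mul_replicateRow]
  congr 2
  simp only [dotProduct]
  apply sum_congr rfl
  intros; ring

end
end S3

open Complex Matrix BigOperators Finset

namespace S3

set_option linter.unusedSectionVars false

section
open Polynomial
variable {n : ℕ}

theorem low_prod {ι : Type*} (s : Finset ι) (v : ι → ℂ) :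
    ∃ R : ℂ[X], ∏ c ∈ s, (1 + X * C (v c)) = 1 + X * C (∑ c ∈ s, v c) + X ^ 2 * R := by
  classical
  induction s using Finset.induction_on with
  | empty => exact ⟨0, by simp⟩
  | insert a s ha ih =>
    obtain ⟨R, hR⟩ := ih
    refine ⟨C (v a) * C (∑ c ∈ s, v c) + R + X * C (v a) * R, ?_⟩
    rw [prod_insert ha, sum_insert ha, hR, C_add]
    ring

theorem ssum (hne : Even n) (y w : Fin n → ℂ) (hyw : ∀ i, w i * y i = 1) (hy : Function.Injective y)
    (s : ℂ) (hs : s ^ 2 = 1) (hsy : ∀ a, s ≠ y a) :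
    (∏ c, (s - y c)) * ∑ a, (∏ c, (y a + w c)) / (y a ^ 2 * ((s - y a) * ∏ c ∈ univ.erase a, (y a - y c)))
      = ∏ c, (s + w c) - (∏ c, w c) ^ 2 * (1 + (∑ c, (w c + y c)) * s) * ∏ c, (s - y c) := by
  have hy0 : ∀ a, y a ≠ 0 := fun a h => by have := hyw a; simp [h] at this
  set W := ∏ c, w c with hW
  set Z := ∏ c, y c with hZ
  have hWZ : W * Z = 1 := by rw [hW, hZ, ← prod_mul_distrib]; exact prod_eq_one (fun i _ => hyw i)
  obtain ⟨R1, h1⟩ := low_prod univ y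
  obtain ⟨R2, h2⟩ := low_prod univ (fun c => - w c)
  have hQ : ∏ c, (X + C (w c)) = C W * ∏ c, (1 + X * C (y c)) := by
    rw [hW, map_prod, ← prod_mul_distrib]
    apply prod_congr rfl
    intro c _
    have := congrArg C (hyw c)
    rw [C_mul, C_1] at this
    linear_combination (-X) * this
  have hY : ∏ c, (X - C (y c)) = C Z * ∏ c, (1 + X * C (- w c)) := by
    have h3 : ∏ c : Fin n, (-1 : ℂ[X]) = 1 := by simp [hne.neg_one_pow]
    have h4 : ∏ c, (X - C (y c)) = (∏ c : Fin n, (-1 : ℂ[X])) * ∏ c, (X - C (y c)) := by rw [h3, one_mul]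
    rw [hZ, map_prod, ← prod_mul_distrib, h4, ← prod_mul_distrib]
    apply prod_congr rfl
    intro c _
    have := congrArg C (hyw c)
    rw [C_mul, C_1] at this
    rw [C_neg]
    linear_combination X * this
  set σ := ∑ c, (w c + y c) with hσ
  have hσ' : σ = ∑ c, y c + ∑ c, w c := by rw [hσ, sum_add_distrib, add_comm]
  have hsn : ∑ c, - w c = - ∑ c, w c := by simp
  rw [hsn] at h2
  set b1 := ∑ c, y c
  set b2 := ∑ c, w c
  let α : ℂ[X] := C W ^ 2 * (1 + C σ * X)
  obtain ⟨β, hβ⟩ : ∃ β : ℂ[X], ∏ c, (X + C (w c)) - α * ∏ c, (X - C (y c)) = X ^ 2 * β := by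
    refine ⟨C W * (C b1 * C b2 + C b2 ^ 2 + R1 - R2 - C σ * X * R2), ?_⟩
    have := congrArg C hWZ
    rw [C_mul, C_1] at this
    rw [hQ, hY, h1, h2, C_neg]
    simp only [α, hσ', C_add]
    linear_combination (-(C W * (1 + (C b1 + C b2) * X) * (1 - X * C b2 + X ^ 2 * R2))) * this
  have hdeg : β.degree < n := by
    by_cases hb : β = 0
    · rw [hb, degree_zero]; exact WithBot.bot_lt_coe _
    · rw [degree_eq_natDegree hb]
      have h3 : (X ^ 2 * β).natDegree = β.natDegree + 2 := by
        rw [natDegree_mul (by simp) hb, natDegree_X_pow, add_comm]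
      have h4 : (X ^ 2 * β).natDegree ≤ n + 1 := by
        rw [← hβ]
        apply (natDegree_sub_le _ _).trans
        apply max_le
        · rw [natDegree_prod_of_monic _ _ (fun c _ => monic_X_add_C _)]; simp
        · apply natDegree_mul_le.trans
          rw [natDegree_prod_of_monic _ _ (fun c _ => monic_X_sub_C _)]
          have : α.natDegree ≤ 1 := by
            simp only [α]; compute_degree
          simp; omega
      exact_mod_cast (by omega : β.natDegree < n)
  have hev : ∀ z, ∏ c, (z + w c) - W ^ 2 * (1 + σ * z) * ∏ c, (z - y c) = z ^ 2 * β.eval z := by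
    intro z
    have := congrArg (eval z) hβ
    simpa [α, eval_prod] using this
  have hl := lag y hy β hdeg s hsy
  have := hev s
  rw [this, hs, one_mul, hl]
  congr 1
  apply sum_congr rfl
  intro a _
  have h5 := hev (y a)
  rw [prod_eq_zero (f := fun c => y a - y c) (mem_univ a) (by simp), mul_zero, sub_zero] at h5
  rw [h5, mul_div_mul_left _ _ (pow_ne_zero 2 (hy0 a))]

end
end S3

open Complex Matrix BigOperators Finset

namespace S3

set_option linter.unusedSectionVars false
variable {p : ℕ} [hpF : Fact p.Prime] {n : ℕ}

theorem card_ne0 (hn : p = 2 * n + 1) : #(univ.erase (0 : ZMod p)) = 2 * n := by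
  rw [card_erase_of_mem (mem_univ _), card_univ, ZMod.card]; omega

theorem chi_pm {c : ZMod p} (hc : c ≠ 0) : chi p c = 1 ∨ chi p c = -1 := by
  have h : (chi p c - 1) * (chi p c + 1) = 0 := by linear_combination chi_sq hc
  rcases mul_eq_zero.1 h with h | h
  · left; linear_combination h
  · right; linear_combination h

open Classical in
theorem card_nonres (hp4 : p % 4 = 1) (hn : p = 2 * n + 1) :
    #((univ.erase (0 : ZMod p)).filter (fun c => chi p c = -1)) = n := by
  have h1 : ((#((univ.erase (0 : ZMod p)).filter (fun c => chi p c = -1)) : ℕ) : ℂ) = n := by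
    rw [card_filter]
    push_cast
    have h2 : ∀ c ∈ univ.erase (0 : ZMod p), (if chi p c = -1 then (1 : ℂ) else 0) = (1 - chi p c) / 2 := by
      intro c hc
      rcases chi_pm (c := c) (by simpa using hc) with h | h
      · rw [h]; norm_num
      · rw [h]; norm_num
    rw [sum_congr rfl h2, ← sum_div, sum_sub_distrib, sum_const, card_ne0 hn]
    have h3 := MulChar.sum_eq_zero_of_ne_one (chi_ne_one hp4)
    rw [← Finset.add_sum_erase _ _ (mem_univ (0 : ZMod p)), MulChar.map_zero, zero_add] at h3
    rw [h3]; simp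
  exact_mod_cast h1

theorem T_val (hp4 : p % 4 = 1) (hn : p = 2 * n + 1) {u : ZMod p} (hu : u ≠ 0) :
    ∏ a ∈ univ.erase (0 : ZMod p), (om p a + om p (a * u)) =
      ∏ a ∈ univ.erase (0 : ZMod p), (1 + chi p u * psi p ((u - 1) * a)) := by
  have h : ∏ a ∈ univ.erase (0 : ZMod p), (1 + chi p u * psi p ((u - 1) * a)) =
      (∏ c ∈ univ.erase (0 : ZMod p), om p c) * ∏ a ∈ univ.erase (0 : ZMod p), (1 + chi p u * psi p ((u - 1) * a)) := by
    rw [prod_om hp4 hn, one_mul]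
  rw [h, ← prod_mul_distrib]
  apply prod_congr rfl
  intro a _
  rw [om, om, ← mul_assoc 2 a u, map_mul (chi p) (2 * a) u, show a * u = a + (u - 1) * a by ring, AddChar.map_add_eq_mul]
  ring

open Classical in
theorem T_val2 (hp4 : p % 4 = 1) (hn : p = 2 * n + 1) {u : ZMod p} (hu : u ≠ 0) :
    ∏ a ∈ univ.erase (0 : ZMod p), (om p a + om p (a * u)) =
      (if u = 1 then 2 ^ (2 * n) else 1) * (if chi p u = -1 then (p : ℂ) else 1) := by
  rw [T_val hp4 hn hu]
  by_cases h1 : u = 1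
  · subst h1
    have : ¬ ((1 : ℂ) = -1) := by norm_num
    simp only [map_one, this, if_false, if_true, sub_self, zero_mul, AddChar.map_zero_eq_one, mul_one]
    rw [prod_const, card_ne0 hn]; norm_num
  · rw [prod_scale (fun c => 1 + chi p u * psi p c) (sub_ne_zero.2 h1), if_neg h1, one_mul]
    rcases chi_pm hu with h | h
    · have : ¬ ((1 : ℂ) = -1) := by norm_num
      rw [h, if_neg this]; simp only [one_mul]; exact prod_one_add hp4
    · rw [h, if_pos rfl]; simp only [neg_one_mul, ← sub_eq_add_neg]; exact prod_one_sub

theorem double_prod (hp4 : p % 4 = 1) (hn : p = 2 * n + 1) :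
    ∏ a ∈ univ.erase (0 : ZMod p), G p (- om p a) = 2 ^ (2 * n) * (p : ℂ) ^ n := by
  classical
  have h1 : ∏ a ∈ univ.erase (0 : ZMod p), G p (- om p a) =
      ∏ a ∈ univ.erase (0 : ZMod p), ∏ u ∈ univ.erase (0 : ZMod p), (om p a + om p (a * u)) := by
    apply prod_congr rfl
    intro a ha
    rw [G_neg hp4, prod_scale (fun c => om p a + om p c) (by simpa using ha)]
  rw [h1, prod_comm, prod_congr rfl (fun u hu => T_val2 hp4 hn (by simpa using hu)), prod_mul_distrib]
  congr 1
  · rw [Finset.prod_ite_eq' (univ.erase (0 : ZMod p)) (1 : ZMod p) (fun _ => (2 : ℂ) ^ (2 * n)), if_pos (by simp)]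
  · rw [← prod_filter, prod_const, card_nonres hp4 hn]

theorem X_sq (hp4 : p % 4 = 1) (hn : p = 2 * n + 1) :
    ((∏ i : Fin n, om p (e p i)) ^ n * ∏ i : Fin n, G p (- om p (- e p i))) ^ 2 = 2 ^ (2 * n) * (p : ℂ) ^ n := by
  rw [← double_prod hp4 hn, half_prod hn]
  have h : ∀ i : Fin n, G p (- om p (e p i)) = om p (e p i) ^ (2 * n) * G p (- om p (- e p i)) := by
    intro i
    have h2 := om_mul_neg hp4 (e_ne hn i)
    rw [G_recip hp4 hn (z := - om p (e p i)) (y := - om p (-e p i)) (by linear_combination h2), Even.neg_pow (by simp)]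
  rw [prod_congr rfl (fun i _ => h i), prod_mul_distrib, prod_pow]
  ring

/-- real trace of a signed root -/
noncomputable def th (p : ℕ) [Fact p.Prime] (i : Fin n) : ℝ :=
  (legendreSym p (2 * ((i : ℕ) + 1 : ℕ)) : ℝ) * (2 * Real.cos (2 * Real.pi * (i + 1) / p))

theorem om_e (i : Fin n) : om p (e p i) = (legendreSym p (2 * ((i : ℕ) + 1 : ℕ)) : ℂ) * psi p (e p i) := by
  rw [om, ← chi_leg, e]; congr 2; push_cast; rfl

theorem om_neg_e (hp4 : p % 4 = 1) (i : Fin n) :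
    om p (- e p i) = (legendreSym p (2 * ((i : ℕ) + 1 : ℕ)) : ℂ) * psi p (- e p i) := by
  rw [om, ← chi_leg, e, mul_neg, chi_neg hp4]; congr 2; push_cast; rfl

theorem th_eq (hp4 : p % 4 = 1) (i : Fin n) : om p (e p i) + om p (- e p i) = (th p i : ℂ) := by
  rw [om_e, om_neg_e hp4, psi_e_exp, psi_neg_e_exp, th]
  push_cast
  rw [Complex.cos]
  ring

theorem G_half (hp4 : p % 4 = 1) (hn : p = 2 * n + 1) (i : Fin n) :
    G p (- om p (- e p i)) = (∏ c : Fin n, (om p (- e p i) + om p (- e p c))) * ∏ c : Fin n, (om p (- e p i) + om p (e p c)) := by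
  rw [G_neg hp4, half_prod hn, mul_comm]

theorem X_real (hp4 : p % 4 = 1) (hn : p = 2 * n + 1) :
    (∏ i : Fin n, om p (e p i)) ^ n * ∏ i : Fin n, G p (- om p (- e p i)) =
      ((∏ a : Fin n, ∏ c : Fin n, (th p a + th p c) : ℝ) : ℂ) := by
  push_cast
  rw [← prod_pow, ← prod_mul_distrib]
  apply prod_congr rfl
  intro a _
  have h1 : om p (e p a) ^ n = ∏ c : Fin n, om p (e p a) := by simp
  rw [G_half hp4 hn, h1, ← prod_mul_distrib, ← prod_mul_distrib]
  apply prod_congr rfl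
  intro c _
  rw [← th_eq hp4, ← th_eq hp4]
  have ha := om_mul_neg hp4 (e_ne hn a)
  have hc := om_mul_neg hp4 (e_ne hn c)
  linear_combination (om p (-e p a) + om p (e p c) + om p (- e p c)) * ha + om p (e p a) * hc

theorem cos_sign (hp4 : p % 4 = 1) (hn : p = 2 * n + 1) :
    0 ≤ (-1 : ℝ) ^ (n / 2) * ∏ i : Fin n, Real.cos (2 * Real.pi * (i + 1) / p) := by
  obtain ⟨m, hm⟩ : ∃ m, n = m + m := ⟨n / 2, by omega⟩
  have hp0 : (0 : ℝ) < p := by exact_mod_cast hpF.out.pos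
  have hpm : (p : ℝ) = 4 * m + 1 := by rw [hn, hm]; push_cast; ring
  have hpi := Real.pi_pos
  rw [Fin.prod_univ_eq_prod_range (fun i => Real.cos (2 * Real.pi * (i + 1) / p)), hm, prod_range_add,
    show (m + m) / 2 = m by omega]
  have h1 : 0 ≤ ∏ i ∈ range m, Real.cos (2 * Real.pi * ((i : ℕ) + 1) / p) := by
    apply prod_nonneg
    intro i hi
    have : (i : ℝ) + 1 ≤ m := by exact_mod_cast mem_range.1 hi
    apply Real.cos_nonneg_of_neg_pi_div_two_le_of_le
    · have : 0 ≤ 2 * Real.pi * ((i : ℝ) + 1) / p := by positivity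
      linarith
    · rw [div_le_iff₀ hp0, hpm]
      nlinarith
  have h2 : 0 ≤ ∏ i ∈ range m, -Real.cos (2 * Real.pi * (((m + i : ℕ) : ℝ) + 1) / p) := by
    apply prod_nonneg
    intro i hi
    have : (i : ℝ) + 1 ≤ m := by exact_mod_cast mem_range.1 hi
    have hi0 : (0 : ℝ) ≤ i := by positivity
    rw [neg_nonneg]
    push_cast
    apply Real.cos_nonpos_of_pi_div_two_le_of_le
    · rw [le_div_iff₀ hp0, hpm]
      nlinarith
    · rw [div_le_iff₀ hp0, hpm]
      nlinarith
  rw [prod_neg, card_range] at h2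
  calc (0 : ℝ) ≤ _ := mul_nonneg h1 h2
    _ = _ := by ring

theorem th_prod (hp4 : p % 4 = 1) (hn : p = 2 * n + 1) : 0 ≤ ∏ i : Fin n, th p i := by
  have hne : Even n := by rw [Nat.even_iff]; omega
  have h2 : (legendreSym p 2) ^ n = 1 := by
    rw [L_eq hp4 hn, ← pow_mul, mul_comm, pow_mul, hne.neg_one_pow, one_pow]
  have h1 : ∏ i : Fin n, legendreSym p (2 * ((i : ℕ) + 1 : ℕ)) = (-1) ^ (n / 2) := by
    have h3 : ∏ i : Fin n, legendreSym p ((i : ℕ) + 1 : ℕ) = (-1) ^ (n / 2) := by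
      rw [← L_eq hp4 hn]
      have := prod_chi_e hp4 hn
      have h4 : ∀ i : Fin n, chi p (e p i) = ((legendreSym p ((i : ℕ) + 1 : ℕ) : ℤ) : ℂ) := by
        intro i; rw [← chi_leg, e]; simp
      rw [prod_congr rfl (fun i _ => h4 i)] at this
      exact_mod_cast this
    rw [prod_congr rfl (fun i _ => legendreSym.mul p 2 _), prod_mul_distrib, h3]
    simp [h2]
  have h5 : ∏ i : Fin n, th p i = 2 ^ n * ((-1 : ℝ) ^ (n / 2) * ∏ i : Fin n, Real.cos (2 * Real.pi * (i + 1) / p)) := by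
    simp only [th]
    rw [prod_mul_distrib, prod_mul_distrib]
    have : ∏ i : Fin n, (legendreSym p (2 * ((i : ℕ) + 1 : ℕ)) : ℝ) = (-1) ^ (n / 2) := by
      have := congrArg (Int.cast : ℤ → ℝ) h1
      push_cast at this ⊢
      exact this
    rw [this]; simp; ring
  rw [h5]
  exact mul_nonneg (by positivity) (cos_sign hp4 hn)

theorem pair_nonneg (θ : Fin n → ℝ) (h : 0 ≤ ∏ i, θ i) : 0 ≤ ∏ a, ∏ c, (θ a + θ c) := by
  have h1 : ∏ a, ∏ c, (θ a + θ c) = (2 ^ n * ∏ i, θ i) * (∏ a, ∏ c ∈ Ioi a, (θ a + θ c)) ^ 2 := by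
    have h2 := Finset.prod_prod_Ioi_mul_eq_prod_prod_off_diag (fun a c : Fin n => θ c + θ a)
    have h3 : (∏ a, ∏ c ∈ Ioi a, (θ a + θ c)) ^ 2 = ∏ a, ∏ c ∈ {a}ᶜ, (θ a + θ c) := by
      rw [← h2, sq, ← prod_mul_distrib]
      apply prod_congr rfl
      intro a _
      rw [← prod_mul_distrib]
      apply prod_congr rfl
      intro c _
      ring
    have h4 : (2 : ℝ) ^ n = ∏ i : Fin n, 2 := by simp
    rw [h3, h4, ← prod_mul_distrib, ← prod_mul_distrib]
    apply prod_congr rfl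
    intro a _
    rw [← Finset.mul_prod_erase univ _ (mem_univ a), ← two_mul]
    congr 1
    apply prod_congr _ (fun _ _ => rfl)
    ext; simp
  rw [h1]; positivity

theorem X_val (hp4 : p % 4 = 1) (hn : p = 2 * n + 1) :
    (∏ i : Fin n, om p (e p i)) ^ n * ∏ i : Fin n, G p (- om p (- e p i)) = 2 ^ n * ((Real.sqrt p : ℝ) : ℂ) ^ n := by
  have h1 := X_sq hp4 hn
  have h2 := pair_nonneg (th p : Fin n → ℝ) (th_prod hp4 hn)
  rw [X_real hp4 hn] at h1 ⊢
  have h3 : (∏ a : Fin n, ∏ c : Fin n, (th p a + th p c)) ^ 2 = (2 ^ n * (Real.sqrt p) ^ n) ^ 2 := by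
    rw [mul_pow, ← pow_mul (Real.sqrt p), mul_comm n 2, pow_mul (Real.sqrt p), Real.sq_sqrt (by positivity), ← pow_mul, mul_comm n 2]
    exact_mod_cast h1
  have h4 := (pow_left_inj₀ h2 (by positivity) two_ne_zero).1 h3
  rw [h4]; push_cast; rfl

end S3

open Complex Matrix BigOperators Finset

namespace S3

set_option linter.unusedSectionVars false
variable {n : ℕ}

theorem pair_prod (y : Fin n → ℂ) :
    ∏ a, ∏ c, (y a + y c) = (2 ^ n * ∏ i, y i) * (∏ a, ∏ c ∈ Ioi a, (y c + y a)) ^ 2 := by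
  have h2 := Finset.prod_prod_Ioi_mul_eq_prod_prod_off_diag (fun a c : Fin n => y c + y a)
  have h3 : (∏ a, ∏ c ∈ Ioi a, (y c + y a)) ^ 2 = ∏ a, ∏ c ∈ {a}ᶜ, (y a + y c) := by
    rw [← h2, sq, ← prod_mul_distrib]
    apply prod_congr rfl
    intro a _
    rw [← prod_mul_distrib]
    apply prod_congr rfl
    intro c _
    ring
  have h4 : (2 : ℂ) ^ n = ∏ i : Fin n, 2 := by simp
  rw [h3, h4, ← prod_mul_distrib, ← prod_mul_distrib]
  apply prod_congr rfl
  intro a _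
  rw [← Finset.mul_prod_erase univ _ (mem_univ a), ← two_mul]
  congr 1
  apply prod_congr _ (fun _ _ => rfl)
  ext; simp

/-- product over a reciprocal pair of families -/
noncomputable def GG (y w : Fin n → ℂ) (z : ℂ) : ℂ := (∏ c, (z - w c)) * ∏ c, (z - y c)

theorem GG_neg (hne : Even n) (y w : Fin n → ℂ) (z : ℂ) :
    GG y w (-z) = (∏ c, (z + w c)) * ∏ c, (z + y c) := by
  have h : ∀ v : Fin n → ℂ, ∏ c, (-z - v c) = ∏ c, (z + v c) := by
    intro v
    have : ∀ c ∈ (univ : Finset (Fin n)), -z - v c = -(z + v c) := by intros; ring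
    rw [prod_congr rfl this, prod_neg]; simp [hne.neg_one_pow]
  rw [GG, h, h]

/-- evaluation of the correction factor -/
theorem S_eval (hne : Even n) (y w : Fin n → ℂ) (hyw : ∀ i, w i * y i = 1)
    (hx : Function.Injective fun i => y i ^ 2) (hx1 : ∀ a, y a ^ 2 ≠ 1)
    (hyy : ∀ a c, y a + y c ≠ 0) (h0 : ∀ a c, y a + w c ≠ 0)
    (P τ σ : ℂ) (hP : P ≠ 0) (D : Fin n → ℂ)
    (hD : ∀ a, D a * (1 - y a ^ 2) * GG y w (- y a) = 2 * P * y a ^ 4)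
    (hσ : ∑ c, (w c + y c) = σ)
    (hK : (∏ c, (1 - y c ^ 2)) ^ 2 * (∏ c, w c) ^ 2 = P) :
    1 + ∑ a, ((1 + τ) * (GG y w 1 / (1 - w a)) + (1 - τ) * (GG y w (-1) / (1 + w a))) / 2 *
        ((∏ c, (1 - y c ^ 2)) / ((1 - y a ^ 2) * ∏ c ∈ univ.erase a, (y a ^ 2 - y c ^ 2))) / D a
      = (∏ c, (1 - y c ^ 2)) * (∏ c, w c) ^ 2 / (2 * P) *
        ((1 + τ) * (1 + σ) * GG y w 1 + (1 - τ) * (1 - σ) * GG y w (-1)) := by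
  have hy : Function.Injective y := fun a b h => hx (by simp [h])
  have hy0 : ∀ a, y a ≠ 0 := fun a h => by have := hyw a; simp [h] at this
  have hw0 : ∀ a, w a ≠ 0 := fun a h => by have := hyw a; simp [h] at this
  have hm : ∀ a, 1 - y a ≠ 0 := fun a h => hx1 a (by linear_combination (-1 - y a) * h)
  have hp : ∀ a, -1 - y a ≠ 0 := fun a h => hx1 a (by linear_combination (1 - y a) * h)
  have s1 := ssum hne y w hyw hy 1 (by norm_num) (fun a h => hm a (by rw [← h]; ring))
  have s2 := ssum hne y w hyw hy (-1) (by norm_num) (fun a h => hp a (by rw [← h]; ring))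
  rw [hσ] at s1 s2
  set W := ∏ c, w c with hW
  set Yp := ∏ c, (1 - y c) with hYp
  set Ym := ∏ c, (-1 - y c) with hYm
  have hYp0 : Yp ≠ 0 := prod_ne_zero_iff.2 (fun a _ => hm a)
  have hYm0 : Ym ≠ 0 := prod_ne_zero_iff.2 (fun a _ => hp a)
  have hmul : ∀ f h : Fin n → ℂ, (∀ c, f c = w c * (- h c)) → ∏ c, f c = W * ∏ c, h c := by
    intro f h hfh
    have h1 : ∏ c, -h c = ∏ c, h c := by rw [prod_neg]; simp [hne.neg_one_pow]
    rw [← h1, hW, ← prod_mul_distrib]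
    exact prod_congr rfl (fun c _ => hfh c)
  have q1 : ∏ c, (1 + w c) = W * Ym := hmul _ _ (fun c => by linear_combination - hyw c)
  have q2 : ∏ c, (-1 + w c) = W * Yp := by
    have h2 : ∏ c, -(1 - y c) = Yp := by rw [prod_neg]; simp [hne.neg_one_pow, hYp]
    rw [← h2]
    exact hmul _ _ (fun c => by linear_combination hyw c)
  have g1 : GG y w 1 = W * Yp ^ 2 := by
    rw [GG, hmul (fun c => 1 - w c) (fun c => 1 - y c) (fun c => by linear_combination - hyw c)]
    ring
  have g2 : GG y w (-1) = W * Ym ^ 2 := by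
    have h2 : ∏ c, -(-1 - y c) = Ym := by rw [prod_neg]; simp [hne.neg_one_pow, hYm]
    rw [GG, hmul (fun c => -1 - w c) (fun c => -(-1 - y c)) (fun c => by linear_combination hyw c), h2]
    ring
  have hKY : ∏ c, (1 - y c ^ 2) = Yp * Ym := by
    have h2 : ∏ c, -(-1 - y c) = Ym := by rw [prod_neg]; simp [hne.neg_one_pow, hYm]
    rw [← h2, hYp, ← prod_mul_distrib]
    exact prod_congr rfl (fun c _ => by ring)
  rw [hKY] at hK ⊢
  rw [q1] at s1
  rw [q2] at s2
  set T : ℂ → Fin n → ℂ := fun s a => (∏ c, (y a + w c)) / (y a ^ 2 * ((s - y a) * ∏ c ∈ univ.erase a, (y a - y c))) with hT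
  have s1' : Yp * ∑ a, T 1 a = W * Ym - W ^ 2 * (1 + σ * 1) * Yp := s1
  have s2' : Ym * ∑ a, T (-1) a = W * Yp - W ^ 2 * (1 + σ * (-1)) * Ym := s2
  have hterm : ∀ a, ((1 + τ) * (GG y w 1 / (1 - w a)) + (1 - τ) * (GG y w (-1) / (1 + w a))) / 2 *
        ((Yp * Ym) / ((1 - y a ^ 2) * ∏ c ∈ univ.erase a, (y a ^ 2 - y c ^ 2))) / D a
      = -(Yp * Ym / (2 * P)) * (1 + τ) * GG y w 1 * T 1 a + -(Yp * Ym / (2 * P)) * (1 - τ) * GG y w (-1) * T (-1) a := by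
    intro a
    have hDa := hD a
    have e1 : ∏ c ∈ univ.erase a, (y a ^ 2 - y c ^ 2) = (∏ c ∈ univ.erase a, (y a - y c)) * ∏ c ∈ univ.erase a, (y a + y c) := by
      rw [← prod_mul_distrib]; exact prod_congr rfl (fun c _ => by ring)
    rw [GG_neg hne, ← Finset.mul_prod_erase univ (fun c => y a + y c) (mem_univ a)] at hDa
    rw [e1]
    simp only [hT]
    have n1 : ∏ c ∈ univ.erase a, (y a - y c) ≠ 0 := by
      apply prod_ne_zero_iff.2
      intro c hc h
      exact (ne_of_mem_erase hc) (hy (sub_eq_zero.1 h)).symm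
    have n2 : ∏ c ∈ univ.erase a, (y a + y c) ≠ 0 := prod_ne_zero_iff.2 (fun c _ => hyy a c)
    have n3 : ∏ c, (y a + w c) ≠ 0 := prod_ne_zero_iff.2 (fun c _ => h0 a c)
    have n4 : 1 - y a ^ 2 ≠ 0 := sub_ne_zero.2 (hx1 a).symm
    have hwa : w a = (y a)⁻¹ := eq_inv_of_mul_eq_one_left (hyw a)
    have n5 : 1 - w a = -(1 - y a) / y a := by rw [hwa]; field_simp [hy0 a]; ring
    have n6 : 1 + w a = -(-1 - y a) / y a := by rw [hwa]; field_simp [hy0 a]; ring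
    rw [n5, n6]
    generalize ∏ c ∈ univ.erase a, (y a - y c) = A1 at *
    generalize ∏ c ∈ univ.erase a, (y a + y c) = A2 at *
    generalize ∏ c, (y a + w c) = A3 at *
    have hya := hy0 a
    have hma := hm a
    have hpa := hp a
    generalize y a = x at *
    have hDval : D a = P * x ^ 3 / ((1 - x ^ 2) * A3 * A2) := by
      rw [eq_div_iff (by simp [*])]
      apply mul_left_cancel₀ (mul_ne_zero two_ne_zero hya)
      linear_combination hDa
    rw [hDval]
    field_simp
  rw [sum_congr rfl (fun a _ => hterm a), sum_add_distrib, ← mul_sum, ← mul_sum, g1, g2]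
  generalize ∑ a, T 1 a = S1 at *
  generalize ∑ a, T (-1) a = S2 at *
  have hgoal : 2 * P + (-(Yp * Ym) * (1 + τ) * (W * Yp ^ 2) * S1 + -(Yp * Ym) * (1 - τ) * (W * Ym ^ 2) * S2) =
      Yp * Ym * W ^ 2 * ((1 + τ) * (1 + σ) * (W * Yp ^ 2) + (1 - τ) * (1 - σ) * (W * Ym ^ 2)) := by
    linear_combination (-(Yp * Ym) * (1 + τ) * W * Yp) * s1' + (-(Yp * Ym) * (1 - τ) * W * Ym) * s2' - 2 * hK
  field_simp
  linear_combination hgoal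

theorem assemble (hn0 : 0 < n) (hne : Even n) (y w : Fin n → ℂ) (hyw : ∀ i, w i * y i = 1)
    (hx : Function.Injective fun i => y i ^ 2) (hx1 : ∀ a, y a ^ 2 ≠ 1)
    (hyy : ∀ a c, y a + y c ≠ 0) (h0 : ∀ a c, y a + w c ≠ 0)
    (P τ σ g : ℂ) (hP : P ≠ 0) (hg : g ^ 2 = P) (D : Fin n → ℂ)
    (hD : ∀ a, D a * (1 - y a ^ 2) * GG y w (- y a) = 2 * P * y a ^ 4)
    (hσ : ∑ c, (w c + y c) = σ)
    (hK : (∏ c, (1 - y c ^ 2)) ^ 2 * (∏ c, w c) ^ 2 = P)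
    (hX : (∏ c, w c) ^ n * ∏ a, GG y w (- y a) = 2 ^ n * g ^ n)
    (N F : Matrix (Fin n) (Fin n) ℂ)
    (hVF : ∀ b i, (vandermonde (fun a => y a ^ 2) * F) b i = - (1 / 2) * GG y w (- y b) * (y b + w i)⁻¹)
    (hNF : ∀ j i, g * (N * F) j i = D i * (y i ^ 2) ^ (j : ℕ) +
      ((1 + τ) * (GG y w 1 / (1 - w i)) + (1 - τ) * (GG y w (-1) / (1 + w i))) / 2) :
    N.det * (-1) ^ (n / 2) * (2 * P) = (1 + τ) * (1 + σ) * GG y w 1 + (1 - τ) * (1 - σ) * GG y w (-1) := by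
  have hS := S_eval hne y w hyw hx hx1 hyy h0 P τ σ hP D hD hσ hK
  have hy0 : ∀ a, y a ≠ 0 := fun a h => by have := hyw a; simp [h] at this
  have hg0 : g ≠ 0 := by rintro rfl; apply hP; rw [← hg]; simp
  set x : Fin n → ℂ := fun a => y a ^ 2 with hxdef
  set κ : Fin n → ℂ := fun i => ((1 + τ) * (GG y w 1 / (1 - w i)) + (1 - τ) * (GG y w (-1) / (1 + w i))) / 2 with hκ
  set u : Fin n → ℂ := fun a => (∏ c, (1 - y c ^ 2)) / ((1 - y a ^ 2) * ∏ c ∈ univ.erase a, (y a ^ 2 - y c ^ 2)) with hu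
  set br := (1 + τ) * (1 + σ) * GG y w 1 + (1 - τ) * (1 - σ) * GG y w (-1) with hbr
  set V := vandermonde x with hVdef
  have hD0 : ∀ a, D a ≠ 0 := by
    intro a h
    have := hD a
    rw [h, zero_mul, zero_mul] at this
    exact (mul_ne_zero (mul_ne_zero two_ne_zero hP) (pow_ne_zero 4 (hy0 a))) this.symm
  have hVu : ∀ j : Fin n, ∑ a, x a ^ (j : ℕ) * u a = 1 := by
    intro j
    have := lag x hx (Polynomial.X ^ (j : ℕ)) (by rw [Polynomial.degree_X_pow]; exact_mod_cast j.2) 1 (fun a => (hx1 a).symm)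
    simp only [Polynomial.eval_pow, Polynomial.eval_X, one_pow, mul_sum] at this
    rw [this]
    apply sum_congr rfl
    intro a _
    simp only [hu, hxdef]
    ring
  have hfac : g • (N * F) = Vᵀ * (Matrix.diagonal D + Matrix.of fun a i => u a * κ i) := by
    ext j i
    rw [Matrix.smul_apply, smul_eq_mul, hNF, mul_add, Matrix.add_apply, Matrix.mul_diagonal, Matrix.mul_apply]
    simp only [Matrix.transpose_apply, hVdef, vandermonde_apply, Matrix.of_apply, ← mul_assoc]
    rw [← sum_mul, hVu, one_mul, mul_comm (D i)]
  have hdet := congrArg Matrix.det hfac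
  rw [Matrix.det_smul, Fintype.card_fin, Matrix.det_mul, Matrix.det_mul, Matrix.det_transpose, det_rank1 D u κ hD0] at hdet
  have hS' : 1 + ∑ a, κ a * u a / D a = (∏ c, (1 - y c ^ 2)) * (∏ c, w c) ^ 2 / (2 * P) * br := hS
  rw [hS'] at hdet
  have hw : Function.Injective w := by
    intro a b h
    apply hx
    have h1 := hyw a
    have h2 := hyw b
    rw [h] at h1
    have : w b ≠ 0 := fun h3 => by simp [h3] at h2
    have : y a = y b := mul_left_cancel₀ this (h1.trans h2.symm)
    simp [hxdef, this]
  have hC := cauchy y w hyw hw h0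
  have hVFd : V.det * F.det * 2 ^ n = (∏ b, GG y w (- y b)) * (Matrix.of fun b a : Fin n => (y b + w a)⁻¹).det := by
    have h1 : V * F = Matrix.of fun b i => (- (1 / 2) * GG y w (- y b)) * (Matrix.of fun b a : Fin n => (y b + w a)⁻¹) b i := by
      ext b i; rw [hVF]; rfl
    rw [← Matrix.det_mul, h1, Matrix.det_mul_column, prod_mul_distrib, prod_const, card_univ, Fintype.card_fin]
    have : (-(1 / 2 : ℂ)) ^ n * 2 ^ n = 1 := by
      rw [← mul_pow, show -(1 / 2 : ℂ) * 2 = -1 by norm_num, hne.neg_one_pow]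
    linear_combination ((∏ b, GG y w (- y b)) * (Matrix.of fun b a : Fin n => (y b + w a)⁻¹).det) * this
  have hsgn : ((-1 : ℂ)) ^ (n * (n - 1) / 2) = (-1) ^ (n / 2) := by
    obtain ⟨m, hm⟩ := hne
    have h1 : n * (n - 1) / 2 = m * (n - 1) := by
      rw [hm, show (m + m) * (m + m - 1) = 2 * (m * (m + m - 1)) by ring]; simp
    have h2 : Odd (n - 1) := by rw [Nat.odd_iff]; omega
    rw [h1, mul_comm, pow_mul, h2.neg_one_pow]; congr 1; omega
  rw [hsgn] at hC
  set W := ∏ c, w c with hW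
  set Z := ∏ c, y c with hZ
  have hWZ : W * Z = 1 := by rw [hW, hZ, ← prod_mul_distrib]; exact prod_eq_one (fun i _ => hyw i)
  have hWn : W * W ^ (n - 1) = W ^ n := by rw [← pow_succ']; congr 1; omega
  set E := ∏ a, ∏ c ∈ Ioi a, (y c + y a) with hE
  have hPG : ∏ b, GG y w (- y b) = (∏ b, ∏ c, (y b + w c)) * (2 ^ n * Z * E ^ 2) := by
    rw [hZ, hE, ← pair_prod, ← prod_mul_distrib]
    exact prod_congr rfl (fun b _ => GG_neg hne y w (y b))
  have hVd : V.det = (vandermonde y).det * E := by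
    rw [hVdef, Matrix.det_vandermonde, Matrix.det_vandermonde, hE, ← prod_mul_distrib]
    apply prod_congr rfl
    intro a _
    rw [← prod_mul_distrib]
    apply prod_congr rfl
    intro c _
    simp only [hxdef]; ring
  have hPD : (∏ a, D a) * (∏ c, (1 - y c ^ 2)) * (∏ b, GG y w (- y b)) = 2 ^ n * P ^ n * Z ^ 4 := by
    rw [← prod_mul_distrib, ← prod_mul_distrib, prod_congr rfl (fun a _ => hD a), prod_mul_distrib, prod_const, card_univ,
      Fintype.card_fin, prod_pow, mul_pow]
  have hV0 : V.det ≠ 0 := by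
    rw [hVdef, Matrix.det_vandermonde_ne_zero_iff]; exact hx
  have hM0 : ∏ b, ∏ c, (y b + w c) ≠ 0 := prod_ne_zero_iff.2 (fun b _ => prod_ne_zero_iff.2 (fun c _ => h0 b c))
  rw [← hg, ← pow_mul, mul_comm 2 n, pow_mul] at hPD
  have h2n : (2 : ℂ) ^ n ≠ 0 := pow_ne_zero n two_ne_zero
  have hgn : g ^ n ≠ 0 := pow_ne_zero n hg0
  generalize (∏ b, ∏ c, (y b + w c)) = M at *
  generalize (∏ b, GG y w (- y b)) = PG at *
  generalize (∏ a, D a) = PD at *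
  generalize (∏ c, (1 - y c ^ 2)) = K at *
  generalize (Matrix.of fun b a : Fin n => (y b + w a)⁻¹).det = CD at *
  generalize (vandermonde y).det = d at *
  generalize ((-1 : ℂ)) ^ (n / 2) = L at *
  generalize W ^ (n - 1) = W1 at *
  generalize W ^ n = Wn at *
  generalize g ^ n = gn at *
  generalize (2 : ℂ) ^ n = t2 at *
  generalize V.det = v at *
  generalize F.det = f at *
  generalize N.det = N at *
  have k1 : v * f * M * W = L * d ^ 2 * gn := by
    apply mul_left_cancel₀ h2n
    have : PG * Wn = t2 * gn := by rw [← hX]; ring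
    linear_combination (M * W) * hVFd + (PG * W) * hC + (PG * L * d ^ 2) * hWn + (L * d ^ 2) * this
  have k2 : v * f * PG * W ^ 2 = L * v ^ 2 * t2 * gn := by
    rw [hPG, hVd]
    rw [hVd] at k1
    linear_combination (t2 * E ^ 2 * W * Z) * k1 + (L * d ^ 2 * gn * t2 * E ^ 2) * hWZ
  have k3 : N * f * gn * PG * W ^ 2 * (2 * P) = v * t2 * gn ^ 2 * br := by
    have e1 : gn * (N * f) * (2 * P) = v * (PD * K * W ^ 2 * br) := by
      rw [hdet]; field_simp
    have e2 : W ^ 4 * Z ^ 4 = 1 := by rw [← mul_pow, hWZ, one_pow]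
    linear_combination (PG * W ^ 2) * e1 + (v * W ^ 4 * br) * hPD + (v * br * t2 * gn ^ 2) * e2
  have hne0 : v ^ 2 * t2 * gn ^ 2 ≠ 0 := by
    refine mul_ne_zero (mul_ne_zero (pow_ne_zero 2 hV0) h2n) (pow_ne_zero 2 hgn)
  apply mul_left_cancel₀ hne0
  linear_combination v * k3 - (N * gn * 2 * P) * k2

end S3

open Complex Matrix BigOperators Finset

namespace S3

set_option linter.unusedSectionVars false
variable {p : ℕ} [hpF : Fact p.Prime] {n : ℕ}

theorem psi_ne_one {c : ZMod p} (hc : c ≠ 0) : psi p c ≠ 1 := by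
  intro h
  apply hc
  apply psi_inj
  rw [h, AddChar.map_zero_eq_one]

theorem om_sq_ne (hp4 : p % 4 = 1) {a c : ZMod p} (ha : a ≠ 0) (hc : c ≠ 0) (h : a ≠ c) : om p a ^ 2 ≠ om p c ^ 2 := by
  rw [om_sq hp4 ha, om_sq hp4 hc]
  intro h1
  exact h (mul_left_cancel₀ (two_ne hp4) (psi_inj h1))

theorem G_eq_GG (hn : p = 2 * n + 1) (z : ℂ) :
    GG (fun i : Fin n => om p (- e p i)) (fun i : Fin n => om p (e p i)) z = G p z := by
  rw [GG, G, half_prod hn]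

theorem sum_om (hp4 : p % 4 = 1) (hn : p = 2 * n + 1) :
    ∑ i : Fin n, (om p (e p i) + om p (- e p i)) = (legendreSym p 2 : ℂ) * ((Real.sqrt p : ℝ) : ℂ) := by
  rw [sum_add_distrib, ← half_sum hn (om p), ← gauss_val hp4 hn, gaussSum, mul_sum,
    ← Finset.add_sum_erase univ _ (mem_univ (0 : ZMod p)), MulChar.map_zero, zero_mul, mul_zero, zero_add]
  apply sum_congr rfl
  intro c _
  rw [om, map_mul, ← chi_leg, mul_assoc]
  simp

theorem K_val (hp4 : p % 4 = 1) (hn : p = 2 * n + 1) :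
    (∏ i : Fin n, (1 - om p (- e p i) ^ 2)) ^ 2 * (∏ i : Fin n, om p (e p i)) ^ 2 = (p : ℂ) := by
  have hne : Even n := by rw [Nat.even_iff]; omega
  have h1 := prod_one_sub (p := p)
  rw [← prod_scale (fun c => 1 - psi p c) (two_ne hp4), half_prod hn] at h1
  rw [← h1]
  have h2 : ∀ i : Fin n, 1 - psi p (2 * e p i) = -(om p (e p i) ^ 2 * (1 - om p (- e p i) ^ 2)) := by
    intro i
    rw [← om_sq hp4 (e_ne hn i)]
    have := om_mul_neg hp4 (e_ne hn i)
    linear_combination (-1 - om p (e p i) * om p (- e p i)) * this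
  have h3 : ∀ i : Fin n, 1 - psi p (2 * - e p i) = 1 - om p (- e p i) ^ 2 := by
    intro i
    rw [← om_sq hp4 (neg_ne_zero.2 (e_ne hn i))]
  rw [prod_congr rfl (fun i _ => h2 i), prod_congr rfl (fun i _ => h3 i), prod_neg, prod_mul_distrib, prod_pow]
  simp [hne.neg_one_pow]; ring

theorem det_val (hp4 : p % 4 = 1) (hn : p = 2 * n + 1) (t : ℂ) :
    (Matrix.of fun j k : Fin n => t + chi p ((j : ℕ) - (k : ℕ) + 1)).det * (legendreSym p 2 : ℂ) * (2 * p) =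
      (1 + t * ((Real.sqrt p : ℝ) : ℂ)) * (1 + (legendreSym p 2 : ℂ) * ((Real.sqrt p : ℝ) : ℂ)) * G p 1 +
      (1 - t * ((Real.sqrt p : ℝ) : ℂ)) * (1 - (legendreSym p 2 : ℂ) * ((Real.sqrt p : ℝ) : ℂ)) * G p (-1) := by
  have hne : Even n := by rw [Nat.even_iff]; omega
  have hn0 : 0 < n := by have := hpF.out.two_le; omega
  have hg : ((Real.sqrt p : ℝ) : ℂ) ^ 2 = p := by
    rw [← Complex.ofReal_pow, Real.sq_sqrt (by positivity)]; simp
  have hL : (legendreSym p 2 : ℂ) = (-1) ^ (n / 2) := by rw [L_eq hp4 hn]; push_cast; rfl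
  have hEn := fun i : Fin n => neg_ne_zero.2 (e_ne hn i)
  have hw1 : ∀ i : Fin n, om p (e p i) ^ 2 ≠ 1 := by
    intro i
    rw [om_sq hp4 (e_ne hn i)]
    exact psi_ne_one (mul_ne_zero (two_ne hp4) (e_ne hn i))
  have hA := assemble hn0 hne (fun i : Fin n => om p (- e p i)) (fun i : Fin n => om p (e p i))
    (fun i => om_mul_neg hp4 (e_ne hn i))
    (by
      intro a b h
      by_contra hab
      refine om_sq_ne hp4 (hEn a) (hEn b) ?_ h
      intro h1
      exact hab (e_inj hn (neg_injective h1)))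
    (by
      intro a
      rw [om_sq hp4 (hEn a)]
      exact psi_ne_one (mul_ne_zero (two_ne hp4) (hEn a)))
    (by
      intro a c h
      by_cases hac : a = c
      · subst hac
        have h1 := om_mul_neg hp4 (e_ne hn a)
        have h2 : om p (- e p a) = 0 := by linear_combination h / 2
        rw [h2] at h1; simp at h1
      · refine om_sq_ne hp4 (hEn a) (hEn c) (fun h1 => hac (e_inj hn (neg_injective h1))) ?_
        linear_combination (om p (- e p a) - om p (- e p c)) * h)
    (by
      intro a c h
      refine om_sq_ne hp4 (hEn a) (e_ne hn c) (fun h1 => e_ne_neg hn c a h1.symm) ?_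
      linear_combination (om p (- e p a) - om p (e p c)) * h)
    (p : ℂ) (t * ((Real.sqrt p : ℝ) : ℂ)) ((legendreSym p 2 : ℂ) * ((Real.sqrt p : ℝ) : ℂ)) ((Real.sqrt p : ℝ) : ℂ)
    (by exact_mod_cast hpF.out.ne_zero) hg
    (fun i => chi p (2 * e p i) * (q (e p i)).eval (om p (e p i)) * psi p (-(2 * e p i)))
    (by
      intro a
      rw [G_eq_GG hn]
      exact Delta_eq hp4 hn (e_ne hn a))
    (sum_om hp4 hn) (K_val hp4 hn)
    (by
      simp only [G_eq_GG hn]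
      exact X_val hp4 hn)
    (Matrix.of fun j k : Fin n => t + chi p ((j : ℕ) - (k : ℕ) + 1))
    (Matrix.of fun k i : Fin n => (q (e p i)).coeff (2 * k))
    (by
      intro b i
      rw [G_eq_GG hn, Matrix.mul_apply]
      have h1 := eval_even (q_natDegree hn (e_ne hn i)) (om p (- e p b))
      rw [q_zero (hEn b) (fun h => e_ne_neg hn i b h.symm), zero_add] at h1
      have h2 := q_mul (e_ne hn i) (- om p (- e p b))
      have h3 : om p (- e p b) + om p (e p i) ≠ 0 := by
        intro h
        refine om_sq_ne hp4 (hEn b) (e_ne hn i) (fun h1 => e_ne_neg hn i b h1.symm) ?_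
        linear_combination (om p (- e p b) - om p (e p i)) * h
      simp only [vandermonde_apply, Matrix.of_apply]
      rw [sum_congr rfl (fun k _ => mul_comm _ _), h1, ← h2]
      field_simp
      ring)
    (by
      intro j i
      rw [G_eq_GG hn, G_eq_GG hn, Matrix.mul_apply]
      have h1 := key1 hp4 hn (e_ne hn i) j
      have hd := q_natDegree hn (e_ne hn i)
      rw [sum_odd hd, gauss_val hp4 hn] at h1
      have h2 := sum_even hd
      have h3 := q_mul (e_ne hn i) 1
      have h4 := q_mul (e_ne hn i) (-1)
      have h5 : 1 - om p (e p i) ≠ 0 := fun h => hw1 i (by linear_combination (-1 - om p (e p i)) * h)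
      have h6 : 1 + om p (e p i) ≠ 0 := fun h => hw1 i (by linear_combination (om p (e p i) - 1) * h)
      have h7 : G p 1 / (1 - om p (e p i)) = (q (e p i)).eval 1 := by rw [← h3]; field_simp
      have h8 : G p (-1) / (1 + om p (e p i)) = - (q (e p i)).eval (-1) := by
        rw [← h4, div_eq_iff h6]; ring
      have h9 : om p (- e p i) ^ 2 = psi p (-(2 * e p i)) := by
        rw [om_sq hp4 (hEn i)]; congr 1; ring
      rw [h7, h8, h9]
      simp only [Matrix.of_apply, add_mul, sum_add_distrib, ← mul_sum]
      rw [mul_add, h1, h2]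
      ring)
  rw [G_eq_GG hn, G_eq_GG hn] at hA
  rw [hL] at hA ⊢
  exact hA

theorem prod_Icc {f : ℕ → ℂ} (n : ℕ) : ∏ r ∈ Finset.Icc 1 n, f r = ∏ i : Fin n, f (i + 1) := by
  rw [Fin.prod_univ_eq_prod_range (fun i => f (i + 1))]
  induction n with
  | zero => simp
  | succ n ih => rw [Finset.prod_Icc_succ_top (by omega), ih, prod_range_succ]

theorem prod_om_e (hp4 : p % 4 = 1) (hn : p = 2 * n + 1) :
    ∏ i : Fin n, om p (e p i) = (legendreSym p 2 : ℂ) * psi p 1 ^ (n * (n + 1) / 2) := by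
  have hne : Even n := by rw [Nat.even_iff]; omega
  have hL : (legendreSym p 2 : ℂ) ^ n = 1 := by
    rw [L_eq hp4 hn]; push_cast; rw [← pow_mul, mul_comm, pow_mul, hne.neg_one_pow, one_pow]
  have h1 : ∀ i : Fin n, om p (e p i) = (legendreSym p 2 : ℂ) * chi p (e p i) * psi p 1 ^ ((i : ℕ) + 1) := by
    intro i
    rw [om, map_mul, ← chi_leg, e, psi_nat]; simp
  rw [prod_congr rfl (fun i _ => h1 i), prod_mul_distrib, prod_mul_distrib, prod_chi_e hp4 hn, prod_const, card_univ,
    Fintype.card_fin, hL, one_mul, prod_pow_eq_pow_sum]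
  congr 2
  rw [Fin.sum_univ_eq_sum_range (fun i => i + 1), ← Finset.sum_range_succ' (fun i => i) n |>.trans (add_zero _) |>.symm.symm]
  rw [Finset.sum_range_id, mul_comm]; simp

theorem leg_pm (hp4 : p % 4 = 1) (hn : p = 2 * n + 1) : (legendreSym p 2 : ℂ) = 1 ∨ (legendreSym p 2 : ℂ) = -1 := by
  rw [L_eq hp4 hn]; push_cast; exact neg_one_pow_eq_or ℂ _

theorem om_neg_e' (hp4 : p % 4 = 1) (i : Fin n) :
    om p (- e p i) = (legendreSym p 2 : ℂ) * ((legendreSym p (((i : ℕ) + 1 : ℕ) : ℤ) : ℂ) * psi p 1 ^ (-(((i : ℕ) + 1 : ℕ) : ℤ))) := by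
  rw [om, mul_neg, chi_neg hp4, map_mul, ← chi_leg, ← chi_leg, AddChar.map_neg_eq_inv, _root_.zpow_neg, zpow_natCast, e, psi_nat, mul_assoc]
  simp

theorem G_one (hp4 : p % 4 = 1) (hn : p = 2 * n + 1) :
    G p 1 = (∏ i : Fin n, om p (e p i)) * ∏ i : Fin n, (1 - om p (- e p i)) ^ 2 := by
  have hne : Even n := by rw [Nat.even_iff]; omega
  have h : ∀ i : Fin n, 1 - om p (e p i) = -(om p (e p i) * (1 - om p (- e p i))) := by
    intro i
    linear_combination - om_mul_neg hp4 (e_ne hn i)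
  rw [G, half_prod hn, prod_congr rfl (fun i _ => h i), prod_neg, prod_mul_distrib, prod_pow]
  simp [hne.neg_one_pow]; ring

theorem G_neg_one (hp4 : p % 4 = 1) (hn : p = 2 * n + 1) :
    G p (-1) = (∏ i : Fin n, om p (e p i)) * ∏ i : Fin n, (1 + om p (- e p i)) ^ 2 := by
  have h : ∀ i : Fin n, 1 + om p (e p i) = (om p (e p i) * (1 + om p (- e p i))) := by
    intro i
    linear_combination - om_mul_neg hp4 (e_ne hn i)
  rw [G_neg hp4, half_prod hn, prod_congr rfl (fun i _ => h i), prod_mul_distrib, prod_pow]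
  ring

end S3

theorem stmt_3 (p : ℕ) [Fact p.Prime] (hp4 : p % 4 = 1)
    (n : ℕ) (hn : n = (p - 1) / 2)
    (ζ : ℂ) (hζ : ζ = Complex.exp (2 * Real.pi * Complex.I / p))
    (A B : ℝ) (hBA : B ≠ A)
    (hAB1 : ∏ r ∈ Finset.Icc 1 n, (1 + (legendreSym p (r : ℤ) : ℂ) * ζ ^ (-(r : ℤ))) ^ 2
        = (-1 : ℂ) ^ (n / 2) * ζ ^ (-((n * (n + 1) / 2 : ℕ) : ℤ))
          * ((B : ℂ) * (p : ℂ) + (A : ℂ) * ((Real.sqrt p : ℝ) : ℂ)))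
    (hAB2 : ∏ r ∈ Finset.Icc 1 n, (1 - (legendreSym p (r : ℤ) : ℂ) * ζ ^ (-(r : ℤ))) ^ 2
        = (-1 : ℂ) ^ (n / 2) * ζ ^ (-((n * (n + 1) / 2 : ℕ) : ℤ))
          * ((B : ℂ) * (p : ℂ) - (A : ℂ) * ((Real.sqrt p : ℝ) : ℂ)))
    (L : ℝ) (hL : L = (legendreSym p 2 : ℝ))
    (t : ℝ) :
    (Matrix.of fun j k : Fin n =>
        t + (legendreSym p (((j : ℕ) : ℤ) - ((k : ℕ) : ℤ) + 1) : ℝ)).det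
      = ((p : ℝ) * B - A) * t + L * (B - A) := by
  have hn' : p = 2 * n + 1 := by omega
  have hp0 : (p : ℂ) ≠ 0 := by exact_mod_cast (Fact.out : p.Prime).ne_zero
  have hdet := S3.det_val hp4 hn' (t : ℂ)
  have hcast : (((Matrix.of fun j k : Fin n =>
        t + (legendreSym p (((j : ℕ) : ℤ) - ((k : ℕ) : ℤ) + 1) : ℝ)).det : ℝ) : ℂ) =
      (Matrix.of fun j k : Fin n => (t : ℂ) + S3.chi p ((j : ℕ) - (k : ℕ) + 1)).det := by
    rw [← Complex.ofRealHom_eq_coe, RingHom.map_det]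
    congr 1
    ext j k
    simp only [RingHom.mapMatrix_apply, Matrix.map_apply, Matrix.of_apply, Complex.ofRealHom_eq_coe]
    push_cast
    rw [← S3.chi_leg]
    push_cast
    rfl
  have hζ' : ζ = S3.psi p 1 := by rw [hζ, S3.psi_one]
  have hζ0 : S3.psi p 1 ≠ 0 := S3.psi_ne 1
  have hLp : ((-1 : ℂ)) ^ (n / 2) = (legendreSym p 2 : ℂ) := by rw [S3.L_eq hp4 hn']; push_cast; rfl
  rw [S3.prod_Icc, hζ', hLp] at hAB1 hAB2
  have hg : ((Real.sqrt p : ℝ) : ℂ) ^ 2 = p := by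
    rw [← Complex.ofReal_pow, Real.sq_sqrt (by positivity)]; simp
  have hW := S3.prod_om_e hp4 hn'
  have hz : S3.psi p 1 ^ (n * (n + 1) / 2) * S3.psi p 1 ^ (-((n * (n + 1) / 2 : ℕ) : ℤ)) = 1 := by
    rw [_root_.zpow_neg, zpow_natCast]
    exact mul_inv_cancel₀ (pow_ne_zero _ hζ0)
  have hG1 := S3.G_one hp4 hn'
  have hG2 := S3.G_neg_one hp4 hn'
  simp only [S3.om_neg_e' hp4] at hG1 hG2
  rw [hW] at hG1 hG2
  have hfin : (((Matrix.of fun j k : Fin n =>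
        t + (legendreSym p (((j : ℕ) : ℤ) - ((k : ℕ) : ℤ) + 1) : ℝ)).det : ℝ) : ℂ) =
      ((((p : ℝ) * B - A) * t + L * (B - A) : ℝ) : ℂ) := by
    rw [hcast]
    have hLc : ((L : ℝ) : ℂ) = (legendreSym p 2 : ℂ) := by rw [hL]; push_cast; rfl
    push_cast
    rw [hLc]
    apply mul_left_cancel₀ (mul_ne_zero two_ne_zero hp0)
    rcases S3.leg_pm hp4 hn' with h | h
    · rw [h] at hAB1 hAB2 hG1 hG2 hdet ⊢
      simp only [one_mul] at hG1 hG2 hAB1 hAB2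
      rw [hAB2] at hG1
      rw [hAB1] at hG2
      have hG1' : S3.G p 1 = B * p - A * ((Real.sqrt p : ℝ) : ℂ) := by
        rw [hG1]; linear_combination (B * p - A * ((Real.sqrt p : ℝ) : ℂ)) * hz
      have hG2' : S3.G p (-1) = B * p + A * ((Real.sqrt p : ℝ) : ℂ) := by
        rw [hG2]; linear_combination (B * p + A * ((Real.sqrt p : ℝ) : ℂ)) * hz
      rw [hG1', hG2'] at hdet
      linear_combination hdet + (2 * B * p * t - 2 * A - 2 * t * A) * hg
    · rw [h] at hAB1 hAB2 hG1 hG2 hdet ⊢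
      simp only [neg_one_mul, sub_neg_eq_add, ← sub_eq_add_neg] at hG1 hG2 hAB1 hAB2
      rw [hAB1] at hG1
      rw [hAB2] at hG2
      have hG1' : S3.G p 1 = B * p + A * ((Real.sqrt p : ℝ) : ℂ) := by
        rw [hG1]; linear_combination (B * p + A * ((Real.sqrt p : ℝ) : ℂ)) * hz
      have hG2' : S3.G p (-1) = B * p - A * ((Real.sqrt p : ℝ) : ℂ) := by
        rw [hG2]; linear_combination (B * p - A * ((Real.sqrt p : ℝ) : ℂ)) * hz
      rw [hG1', hG2'] at hdet
      linear_combination -hdet + (2 * B * p * t + 2 * A - 2 * t * A) * hg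
  exact_mod_cast hfin
end
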